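/- arXiv:2511.12672 — 5 statements merged into one kernel-verified Lean document; each statement's English description precedes it below -/
import Mathlib

section
/- Let K be a nonempty compact Hausdorff zero-dimensional (totally disconnected) topological space without isolated points, and let L be a compact Hausdorff space whose set of isolated points is countably infinite and dense in L (i.e. L is a compactification of ω). Then every continuous linear equivalence T : C(K,ℝ) ≃ C(L,ℝ) satisfies ‖T‖·‖T⁻¹‖ ≥ 3 + 2√2. -/
open Filter Topology


namespace BMLower

/-- Characteristic function of a clopen set as a continuous function. -/
noncomputable def chi {X : Type*} [TopologicalSpace X] (U : Set X) (hU : IsClopen U) : C(X, ℝ) :=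
  ⟨U.indicator (fun _ => (1 : ℝ)), continuous_const.indicator (by simp [hU.frontier_eq])⟩

lemma chi_mem {X : Type*} [TopologicalSpace X] {U : Set X} (hU : IsClopen U) {x : X}
    (hx : x ∈ U) : chi U hU x = 1 := by simp [chi, hx]

lemma chi_notMem {X : Type*} [TopologicalSpace X] {U : Set X} (hU : IsClopen U) {x : X}
    (hx : x ∉ U) : chi U hU x = 0 := by simp [chi, hx]

lemma abs_sum_chi_le {X ι : Type*} [TopologicalSpace X] (I : Finset ι) (A : ι → Set X)
    (hA : ∀ i, IsClopen (A i)) (hd : Pairwise fun i j => Disjoint (A i) (A j))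
    (c : ι → ℝ) (hc : ∀ i, |c i| ≤ 1) (x : X) :
    |(∑ i ∈ I, c i • chi (A i) (hA i)) x| ≤ 1 := by
  rw [ContinuousMap.sum_apply]
  by_cases h : ∃ i ∈ I, x ∈ A i
  · obtain ⟨i, hi, hx⟩ := h
    rw [Finset.sum_eq_single i]
    · simpa [chi_mem (hA i) hx] using hc i
    · intro j _ hj
      have : x ∉ A j := fun h' => Set.disjoint_left.1 (hd hj) h' hx
      simp [chi_notMem (hA j) this]
    · exact fun h => absurd hi h
  · push Not at h
    rw [Finset.sum_eq_zero]
    · simp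
    · intro j hj
      simp [chi_notMem (hA j) (h j hj)]

lemma sum_abs_le {X Y ι : Type*} [TopologicalSpace X] [CompactSpace X]
    [TopologicalSpace Y] [CompactSpace Y] (Φ : C(X, ℝ) →L[ℝ] C(Y, ℝ))
    (I : Finset ι) (A : ι → Set X)
    (hA : ∀ i, IsClopen (A i)) (hd : Pairwise fun i j => Disjoint (A i) (A j)) (y : Y) :
    ∑ i ∈ I, |Φ (chi (A i) (hA i)) y| ≤ ‖Φ‖ := by
  set c : ι → ℝ := fun i => SignType.sign (Φ (chi (A i) (hA i)) y) with hc
  have hc1 : ∀ i, |c i| ≤ 1 := by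
    intro i
    simp only [hc]
    cases SignType.sign (Φ (chi (A i) (hA i)) y) <;> simp
  have h1 : ‖∑ i ∈ I, c i • chi (A i) (hA i)‖ ≤ 1 :=
    (ContinuousMap.norm_le _ zero_le_one).2 fun x => abs_sum_chi_le I A hA hd c hc1 x
  have h2 : ∑ i ∈ I, |Φ (chi (A i) (hA i)) y| = Φ (∑ i ∈ I, c i • chi (A i) (hA i)) y := by
    rw [map_sum, ContinuousMap.sum_apply]
    refine Finset.sum_congr rfl fun i _ => ?_
    simp [hc, sign_mul_self]
  rw [h2]
  calc _ ≤ ‖Φ (∑ i ∈ I, c i • chi (A i) (hA i)) y‖ := le_abs_self _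
    _ ≤ ‖Φ (∑ i ∈ I, c i • chi (A i) (hA i))‖ := ContinuousMap.norm_coe_le_norm _ _
    _ ≤ ‖Φ‖ * ‖∑ i ∈ I, c i • chi (A i) (hA i)‖ := Φ.le_opNorm _
    _ ≤ ‖Φ‖ * 1 := by gcongr
    _ = ‖Φ‖ := mul_one _

lemma exists_small {K L : Type*} [TopologicalSpace K] [CompactSpace K] [T2Space K]
    [TotallyDisconnectedSpace K] (hK : ∀ x : K, (𝓝[≠] x).NeBot)
    [TopologicalSpace L] [CompactSpace L] (T : C(K, ℝ) →L[ℝ] C(L, ℝ))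
    {ι : Type*} (F : Finset ι) (p : ι → L) {ε : ℝ} (hε : 0 < ε)
    (W : Set K) (hW : IsOpen W) (x₀ : K) (hx₀ : x₀ ∈ W) :
    ∃ (U : Set K) (hU : IsClopen U), U ⊆ W ∧ U.Nonempty ∧
      ∀ n ∈ F, |T (chi U hU) (p n)| ≤ ε := by
  have := hK x₀
  have hinf : W.Infinite := infinite_of_mem_nhds x₀ (hW.mem_nhds hx₀)
  obtain ⟨N, hN⟩ := exists_nat_gt (F.card * ‖T‖ / ε)
  obtain ⟨s, hsW, hsN⟩ := hinf.exists_subset_card_eq N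
  obtain ⟨O, hO, hOd⟩ := s.finite_toSet.t2_separation
  have hex : ∀ i : s, ∃ V : Set K, IsClopen V ∧ (i : K) ∈ V ∧ V ⊆ O i ∩ W := fun i =>
    compact_exists_isClopen_in_isOpen ((hO i).2.inter hW) ⟨(hO i).1, hsW i.2⟩
  choose V hV hiV hVO using hex
  have hd : Pairwise fun i j => Disjoint (V i) (V j) := by
    intro i j hij
    have := hOd i.2 j.2 (fun h => hij (Subtype.ext h))
    exact this.mono ((hVO i).trans Set.inter_subset_left) ((hVO j).trans Set.inter_subset_left)
  by_contra hcon
  push Not at hcon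
  have h1 : ∀ i : s, ε ≤ ∑ n ∈ F, |T (chi (V i) (hV i)) (p n)| := by
    intro i
    obtain ⟨n, hn, h⟩ := hcon (V i) (hV i) ((hVO i).trans Set.inter_subset_right) ⟨i, hiV i⟩
    exact h.le.trans (Finset.single_le_sum
      (f := fun n => |T (chi (V i) (hV i)) (p n)|) (fun _ _ => abs_nonneg _) hn)
  have h2 : (N : ℝ) * ε ≤ F.card * ‖T‖ := by
    calc (N : ℝ) * ε = ∑ i : s, ε := by simp [hsN]
      _ ≤ ∑ i : s, ∑ n ∈ F, |T (chi (V i) (hV i)) (p n)| := Finset.sum_le_sum fun i _ => h1 i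
      _ = ∑ n ∈ F, ∑ i : s, |T (chi (V i) (hV i)) (p n)| := Finset.sum_comm
      _ ≤ ∑ n ∈ F, ‖T‖ := Finset.sum_le_sum fun n _ => sum_abs_le T Finset.univ V hV hd (p n)
      _ = _ := by simp
  rw [div_lt_iff₀ hε] at hN
  linarith

lemma core {K L : Type*} [TopologicalSpace K] [CompactSpace K] [T2Space K]
    [TotallyDisconnectedSpace K] (hK : ∀ x : K, (𝓝[≠] x).NeBot)
    [TopologicalSpace L] [CompactSpace L]
    (T : C(K, ℝ) →L[ℝ] C(L, ℝ)) (S : C(L, ℝ) →L[ℝ] C(K, ℝ))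
    (hST : ∀ f, S (T f) = f) (hTS : ∀ g, T (S g) = g)
    (P : Set L) (hP : ∀ n : P, IsClopen ({(n : L)} : Set L)) (hPd : Dense P)
    (a : ℝ) (ha : 0 < a)
    (hle : ∀ (F : Finset P) (x : K), ∑ n ∈ F, |S (chi _ (hP n)) x| ≤ a)
    (hlub : ∀ ε > 0, ∃ (F : Finset P) (x : K), a - ε < ∑ n ∈ F, |S (chi _ (hP n)) x|)
    (ε β : ℝ) (hε : 0 < ε) (hβ : 0 ≤ β) (h : ‖S‖ * (β + ε) < 1 + β * (a - ε)) :
    1 + 2 * a * β ≤ ‖T‖ * (a + 2 * ε) := by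
  classical
  obtain ⟨F, x₀, hx₀⟩ := hlub ε hε
  set f : P → C(K, ℝ) := fun n => S (chi _ (hP n)) with hf
  set c : P → ℝ := fun n => SignType.sign (f n x₀) with hc
  have hc1 : ∀ i, |c i| ≤ 1 := by
    intro i
    simp only [hc]
    cases SignType.sign (f i x₀) <;> simp
  set q : C(K, ℝ) := ∑ n ∈ F, c n • f n with hq
  have hqapp : ∀ x, q x = ∑ n ∈ F, c n * f n x := by
    intro x; simp [hq, ContinuousMap.sum_apply]
  have hqx₀ : a - ε < q x₀ := by
    rw [hqapp]; convert hx₀ using 2 with n hn; simp [hc, sign_mul_self]; rfl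
  have hqle : ∀ x, |q x| ≤ ∑ n ∈ F, |f n x| := by
    intro x
    rw [hqapp]
    refine (Finset.abs_sum_le_sum_abs _ _).trans (Finset.sum_le_sum fun n _ => ?_)
    rw [abs_mul]
    exact mul_le_of_le_one_left (abs_nonneg _) (hc1 n)
  obtain ⟨U, hU, hUW, ⟨u, hu⟩, hUF⟩ := exists_small hK T F (fun n => (n : L)) hε
    {x | a - ε < q x} (isOpen_lt continuous_const q.continuous) x₀ hqx₀
  set g : C(L, ℝ) := T (chi U hU) with hg
  have hTf : ∀ n, T (f n) = chi _ (hP n) := fun n => hTS _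
  have hchi_ne : ∀ n m : P, m ≠ n → chi _ (hP n) (m : L) = 0 := fun n m hmn =>
    chi_notMem (hP n) (fun h' => hmn (Subtype.ext h'))
  have hchi_eq : ∀ n : P, chi _ (hP n) (n : L) = 1 := fun n => chi_mem (hP n) rfl
  have hm : ∃ m : P, m ∉ F ∧ β < |g m| := by
    by_contra hcon
    push Not at hcon
    set G : C(L, ℝ) := g + β • ∑ n ∈ F, c n • chi _ (hP n) with hG
    have hGP : ∀ y ∈ P, |G y| ≤ β + ε := by
      intro y hy
      have hGy : G y = g y + β * ∑ n ∈ F, c n * chi _ (hP n) y := by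
        simp [hG]
      rw [hGy]
      by_cases hyF : (⟨y, hy⟩ : P) ∈ F
      · rw [Finset.sum_eq_single_of_mem _ hyF
          (fun n _ hn => by rw [hchi_ne n ⟨y, hy⟩ hn.symm, mul_zero]), hchi_eq ⟨y, hy⟩, mul_one]
        have h1 : |g y| ≤ ε := hUF _ hyF
        have h2 : |β * c ⟨y, hy⟩| ≤ β := by
          rw [abs_mul, abs_of_nonneg hβ]
          exact mul_le_of_le_one_right hβ (hc1 _)
        exact (abs_add_le _ _).trans (by linarith)
      · rw [Finset.sum_eq_zero (fun n hn => by
          rw [hchi_ne n ⟨y, hy⟩ (fun h' => hyF (h' ▸ hn)), mul_zero]), mul_zero, add_zero]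
        exact (hcon ⟨y, hy⟩ hyF).trans (by linarith)
    have hGall : ∀ y, |G y| ≤ β + ε := by
      have hcl : IsClosed {y | |G y| ≤ β + ε} := isClosed_le G.continuous.abs continuous_const
      intro y
      exact hcl.closure_subset_iff.2 hGP (hPd y)
    have hGn : ‖G‖ ≤ β + ε := (ContinuousMap.norm_le _ (by positivity)).2 hGall
    have hSG : S G = chi U hU + β • q := by
      simp only [hG, map_add, map_smul, map_sum, hg, hST, hq, hf]
    have hSGu : S G u = 1 + β * q u := by
      rw [hSG]; simp [chi_mem hU hu]
    have h3 : S G u ≤ ‖S‖ * (β + ε) := by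
      calc _ ≤ ‖S G u‖ := le_abs_self _
        _ ≤ ‖S G‖ := ContinuousMap.norm_coe_le_norm _ _
        _ ≤ ‖S‖ * ‖G‖ := S.le_opNorm _
        _ ≤ _ := by gcongr
    have h4 : β * (a - ε) ≤ β * q u := mul_le_mul_of_nonneg_left (le_of_lt (hUW hu)) hβ
    linarith
  obtain ⟨m, hmF, hmβ⟩ := hm
  set σ : ℝ := ((SignType.sign (g (m : L)) : SignType) : ℝ) with hσ
  have hσ1 : |σ| ≤ 1 := by
    simp only [hσ]
    cases SignType.sign (g m) <;> simp
  have hσg : σ * g m = |g m| := by simp [hσ, sign_mul_self]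
  have hfm : ∀ x, |f m x| + ∑ n ∈ F, |f n x| ≤ a := by
    intro x
    have := hle (insert m F) x
    rwa [Finset.sum_insert hmF] at this
  set H : C(K, ℝ) := f m + σ • ((2 * a) • chi U hU - q) with hH
  have hHn : ‖H‖ ≤ a + 2 * ε := by
    refine (ContinuousMap.norm_le _ (by positivity)).2 fun x => ?_
    have hHx : H x = f m x + σ * (2 * a * chi U hU x - q x) := by simp [hH]
    rw [hHx, Real.norm_eq_abs]
    have h1 := hfm x
    have h2 := hqle x
    have h3 : |σ * (2 * a * chi U hU x - q x)| ≤ |2 * a * chi U hU x - q x| := by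
      rw [abs_mul]; exact mul_le_of_le_one_left (abs_nonneg _) hσ1
    refine (abs_add_le _ _).trans ?_
    by_cases hx : x ∈ U
    · rw [chi_mem hU hx] at h3 ⊢
      have h4 : a - ε < q x := hUW hx
      have h5 := le_abs_self (q x)
      have h6 := abs_nonneg (f m x)
      have h7 : |2 * a * 1 - q x| ≤ a + ε := abs_le.2 ⟨by linarith, by linarith⟩
      linarith
    · rw [chi_notMem hU hx] at h3 ⊢
      have h7 : |2 * a * 0 - q x| = |q x| := by rw [mul_zero, zero_sub, abs_neg]
      linarith
  have hTq : T q m = 0 := by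
    simp only [hq, map_sum, map_smul, hTf, ContinuousMap.sum_apply]
    refine Finset.sum_eq_zero fun n hn => ?_
    rw [ContinuousMap.smul_apply, hchi_ne n m (fun h' => hmF (h' ▸ hn)), smul_zero]
  have hTH : T H m = 1 + 2 * a * |g m| := by
    have : T H m = 1 + σ * (2 * a * g m - T q m) := by
      simp only [hH, map_add, map_smul, map_sub, hTf, ContinuousMap.add_apply,
        ContinuousMap.smul_apply, ContinuousMap.sub_apply, hchi_eq, smul_eq_mul, hg]
    rw [this, hTq, ← hσg]; ring
  calc 1 + 2 * a * β ≤ 1 + 2 * a * |g m| := by gcongr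
    _ = T H m := hTH.symm
    _ ≤ ‖T H m‖ := le_abs_self _
    _ ≤ ‖T H‖ := ContinuousMap.norm_coe_le_norm _ _
    _ ≤ ‖T‖ * ‖H‖ := T.le_opNorm _
    _ ≤ _ := by gcongr

lemma arith (a s t : ℝ) (ha : 0 < a) (hs : 0 ≤ s) (ht : 0 ≤ t)
    (h : ∀ ε β : ℝ, 0 < ε → 0 ≤ β → s * (β + ε) < 1 + β * (a - ε) →
      1 + 2 * a * β ≤ t * (a + 2 * ε)) : 3 + 2 * Real.sqrt 2 ≤ t * s := by
  have h1 : ∀ β : ℝ, 0 ≤ β → s * β < 1 + β * a → 1 + 2 * a * β ≤ t * a := by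
    intro β hβ hlt
    have hev : ∀ᶠ ε in 𝓝[>] (0 : ℝ), s * (β + ε) < 1 + β * (a - ε) := by
      apply eventually_nhdsWithin_of_eventually_nhds
      have c1 : Continuous fun ε : ℝ => s * (β + ε) := by fun_prop
      have c2 : Continuous fun ε : ℝ => 1 + β * (a - ε) := by fun_prop
      exact c1.continuousAt.eventually_lt c2.continuousAt (by simpa using hlt)
    have hten : Tendsto (fun ε : ℝ => t * (a + 2 * ε)) (𝓝[>] 0) (𝓝 (t * a)) := by
      have c1 : Continuous fun ε : ℝ => t * (a + 2 * ε) := by fun_prop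
      have := c1.tendsto 0
      simp only [mul_zero, add_zero] at this
      exact this.mono_left nhdsWithin_le_nhds
    refine ge_of_tendsto hten ?_
    filter_upwards [hev, self_mem_nhdsWithin] with ε h2 h3
    exact h ε β h3 hβ h2
  have hsa : a < s := by
    by_contra hcon
    push Not at hcon
    have := h1 t ht (by nlinarith)
    nlinarith
  have hd : 0 < s - a := sub_pos.2 hsa
  have h2 : 1 + 2 * a * (1 / (s - a)) ≤ t * a := by
    have hten : Tendsto (fun r : ℝ => 1 + 2 * a * (r / (s - a))) (𝓝[<] 1)
        (𝓝 (1 + 2 * a * (1 / (s - a)))) := by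
      have c1 : Continuous fun r : ℝ => 1 + 2 * a * (r / (s - a)) := by fun_prop
      exact (c1.tendsto 1).mono_left nhdsWithin_le_nhds
    refine le_of_tendsto hten ?_
    filter_upwards [Ioo_mem_nhdsLT (zero_lt_one' ℝ)] with r hr
    refine h1 _ (div_nonneg hr.1.le hd.le) ?_
    have : r / (s - a) * (s - a) = r := div_mul_cancel₀ _ hd.ne'
    nlinarith [hr.2]
  have h3 : s - a + 2 * a ≤ t * a * (s - a) := by
    have := mul_le_mul_of_nonneg_right h2 hd.le
    have e : (1 + 2 * a * (1 / (s - a))) * (s - a) = s - a + 2 * a := by field_simp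
    linarith
  have h4 : (3 + 2 * Real.sqrt 2) * (a * (s - a)) ≤ s * (s + a) := by
    have hsq : Real.sqrt 2 ^ 2 = 2 := Real.sq_sqrt (by norm_num)
    have e : s * (s + a) - (3 + 2 * Real.sqrt 2) * (a * (s - a)) =
        (s - (1 + Real.sqrt 2) * a) ^ 2 := by linear_combination (-a ^ 2) * hsq
    have := sq_nonneg (s - (1 + Real.sqrt 2) * a)
    linarith
  have h5 : s * (s + a) ≤ t * s * (a * (s - a)) := by
    nlinarith [mul_le_mul_of_nonneg_left h3 hs]
  exact le_of_mul_le_mul_right (h4.trans h5) (mul_pos ha hd)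

end BMLower

/-- If `K` is a nonempty compact Hausdorff zero-dimensional space without isolated points
and `L` is a compact Hausdorff space whose set of isolated points is countably infinite and
dense (a compactification of ω), then every continuous linear equivalence
`T : C(K,ℝ) ≃ C(L,ℝ)` has distortion at least `3 + 2√2`. -/
theorem banachMazur_lower_bound_CK_CL
    {K L : Type*} [TopologicalSpace K] [CompactSpace K] [T2Space K]
    [Nonempty K] [TotallyDisconnectedSpace K]
    (hK : ∀ x : K, (𝓝[≠] x).NeBot)
    [TopologicalSpace L] [CompactSpace L] [T2Space L]
    (hLcount : {y : L | ¬ (𝓝[≠] y).NeBot}.Countable)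
    (hLinf : {y : L | ¬ (𝓝[≠] y).NeBot}.Infinite)
    (hLdense : Dense {y : L | ¬ (𝓝[≠] y).NeBot})
    (T : C(K, ℝ) ≃L[ℝ] C(L, ℝ)) :
    3 + 2 * Real.sqrt 2 ≤
      ‖(T : C(K, ℝ) →L[ℝ] C(L, ℝ))‖ * ‖(T.symm : C(L, ℝ) →L[ℝ] C(K, ℝ))‖ := by
  classical
  set P : Set L := {y : L | ¬ (𝓝[≠] y).NeBot} with hPdef
  have hP : ∀ n : P, IsClopen ({(n : L)} : Set L) := by
    intro n
    refine ⟨isClosed_singleton, ?_⟩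
    rw [isOpen_singleton_iff_punctured_nhds]
    exact not_neBot.1 n.2
  set S : C(L, ℝ) →L[ℝ] C(K, ℝ) := (T.symm : C(L, ℝ) →L[ℝ] C(K, ℝ)) with hS
  set T' : C(K, ℝ) →L[ℝ] C(L, ℝ) := (T : C(K, ℝ) →L[ℝ] C(L, ℝ)) with hT'
  have hST : ∀ f, S (T' f) = f := fun f => T.symm_apply_apply f
  have hTS : ∀ g, T' (S g) = g := fun g => T.apply_symm_apply g
  set v : Finset P × K → ℝ := fun z => ∑ n ∈ z.1, |S (BMLower.chi _ (hP n)) z.2| with hv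
  have hbdd : BddAbove (Set.range v) := by
    refine ⟨‖S‖, ?_⟩
    rintro _ ⟨z, rfl⟩
    refine BMLower.sum_abs_le S z.1 (fun n : P => {(n : L)}) hP ?_ z.2
    intro i j hij
    exact Set.disjoint_singleton.2 fun h' => hij (Subtype.ext h')
  have hle : ∀ (F : Finset P) (x : K),
      ∑ n ∈ F, |S (BMLower.chi _ (hP n)) x| ≤ ⨆ z, v z := fun F x => le_ciSup hbdd (F, x)
  have hpos : 0 < ⨆ z, v z := by
    obtain ⟨y, hy⟩ := hLinf.nonempty
    by_contra hcon
    push Not at hcon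
    have h0 : S (BMLower.chi _ (hP ⟨y, hy⟩)) = 0 := by
      ext x
      have := (hle {⟨y, hy⟩} x).trans hcon
      rw [Finset.sum_singleton] at this
      simpa using this
    have h1 := hTS (BMLower.chi _ (hP ⟨y, hy⟩))
    rw [h0, map_zero] at h1
    have h2 := BMLower.chi_mem (hP ⟨y, hy⟩) (x := y) rfl
    rw [← h1] at h2
    simp at h2
  refine BMLower.arith (⨆ z, v z) ‖S‖ ‖T'‖ hpos S.opNorm_nonneg T'.opNorm_nonneg ?_
  intro ε β hε hβ h
  refine BMLower.core hK T' S hST hTS P hP hLdense _ hpos hle ?_ ε β hε hβ h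
  intro ε hε
  obtain ⟨z, hz⟩ := exists_lt_of_lt_ciSup (sub_lt_self (⨆ z, v z) hε)
  exact ⟨z.1, z.2, hz⟩
end

section
/- Let K be a nonempty compact Hausdorff zero-dimensional space without isolated points, let L be a compact Hausdorff space whose set D of isolated points is countably infinite and dense in L, and let T : C(K,ℝ) ≃ C(L,ℝ) be a continuous linear equivalence with ‖Tg‖ ≥ ‖g‖ for every g ∈ C(K,ℝ). Let Φ be the set of all φ ∈ C(K,ℝ) for which there exist a finite set I ⊆ D and σ : I → {−1,1} such that (Tφ)(i) = σ(i) for all i ∈ I and (Tφ)(d) = 0 for all d ∈ D∖I, and let r = sup{‖φ‖ : φ ∈ Φ}. If 0 < r < 1, then ‖T‖ ≥ 2/(1−r) + 1/r. -/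
open Filter Topology

lemma aux_indicator {K : Type*} [TopologicalSpace K] (U : Set K) (hU : IsClopen U) :
    ∃ f : C(K, ℝ), (∀ x ∈ U, f x = 1) ∧ ∀ x, x ∉ U → f x = 0 := by
  classical
  refine ⟨⟨U.indicator (fun _ => 1), ?_⟩, ?_, ?_⟩
  · exact Continuous.indicator (by simp [hU.frontier_eq]) continuous_const
  · intro x hx; simp [hx]
  · intro x hx; simp [hx]

/-- A family of disjoint clopen bumps has absolutely summable values under `T`. -/
lemma aux_sum {K L : Type*} [TopologicalSpace K] [CompactSpace K]
    [TopologicalSpace L] [CompactSpace L]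
    (T : C(K, ℝ) →L[ℝ] C(L, ℝ)) (s : Finset K) (U : K → Set K)
    (hU : (s : Set K).PairwiseDisjoint U) (u : K → C(K, ℝ))
    (hu1 : ∀ p, ∀ x ∈ U p, u p x = 1) (hu0 : ∀ p, ∀ x, x ∉ U p → u p x = 0) (i : L) :
    ∑ p ∈ s, |T (u p) i| ≤ ‖T‖ := by
  classical
  set c : K → ℝ := fun p => (SignType.sign (T (u p) i) : ℝ) with hc
  have hc1 : ∀ p, |c p| ≤ 1 := by
    intro p
    simp only [hc]
    rcases lt_trichotomy (T (u p) i) 0 with h | h | h <;> simp [h]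
  set g : C(K, ℝ) := ∑ p ∈ s, c p • u p with hg
  have hgn : ‖g‖ ≤ 1 := by
    rw [ContinuousMap.norm_le _ zero_le_one]
    intro x
    have hgx : g x = ∑ p ∈ s, c p * u p x := by
      simp [hg, ContinuousMap.sum_apply]
    rw [hgx]
    by_cases hx : ∃ p ∈ s, x ∈ U p
    · obtain ⟨p, hp, hxp⟩ := hx
      rw [Finset.sum_eq_single_of_mem p hp]
      · rw [hu1 p x hxp, mul_one]; exact hc1 p
      · intro q hq hqp
        rw [hu0 q x, mul_zero]
        intro hxq
        exact Set.disjoint_left.1 (hU hq hp hqp) hxq hxp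
    · push Not at hx
      rw [Finset.sum_eq_zero]
      · simp
      · intro p hp
        rw [hu0 p x (hx p hp), mul_zero]
  have hTg : T g i = ∑ p ∈ s, |T (u p) i| := by
    simp only [hg, map_sum, map_smul, ContinuousMap.sum_apply, ContinuousMap.smul_apply,
      smul_eq_mul, hc]
    refine Finset.sum_congr rfl fun p _ => ?_
    exact sign_mul_self _
  rw [← hTg]
  calc T g i ≤ ‖T g i‖ := le_abs_self _
    _ ≤ ‖T g‖ := (T g).norm_coe_le_norm i
    _ ≤ ‖T‖ * ‖g‖ := T.le_opNorm g
    _ ≤ ‖T‖ * 1 := by gcongr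
    _ = ‖T‖ := mul_one _

/-- Small bumps: in any nonempty open set there is a clopen bump with small image on `I`. -/
lemma aux_small {K L : Type*} [TopologicalSpace K] [CompactSpace K] [T2Space K]
    [TotallyDisconnectedSpace K]
    (hK : ∀ x : K, (𝓝[≠] x).NeBot)
    [TopologicalSpace L] [CompactSpace L]
    (T : C(K, ℝ) →L[ℝ] C(L, ℝ)) (V : Set K) (hV : IsOpen V) (hVn : V.Nonempty)
    (I : Finset L) (η : ℝ) (hη : 0 < η) :
    ∃ (U : Set K) (u : C(K, ℝ)), U ⊆ V ∧ U.Nonempty ∧ (∀ x ∈ U, u x = 1) ∧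
      (∀ x, x ∉ U → u x = 0) ∧ ∀ i ∈ I, |T u i| ≤ η := by
  classical
  obtain ⟨y, hy⟩ := hVn
  haveI := hK y
  have hinf : V.Infinite := infinite_of_mem_nhds y (hV.mem_nhds hy)
  obtain ⟨N, hN⟩ := exists_nat_gt ((I.card : ℝ) * ‖T‖ / η)
  obtain ⟨s, hsV, hs⟩ := hinf.exists_subset_card_eq N
  obtain ⟨W, hW, hWd⟩ := s.finite_toSet.t2_separation
  have hex : ∀ p : K, ∃ U : Set K, IsClopen U ∧ (p ∈ s → p ∈ U ∧ U ⊆ W p ∩ V) := by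
    intro p
    by_cases hp : p ∈ s
    · obtain ⟨U, hU, hpU, hUs⟩ := compact_exists_isClopen_in_isOpen
        ((hW p).2.inter hV) (show p ∈ W p ∩ V from ⟨(hW p).1, hsV hp⟩)
      exact ⟨U, hU, fun _ => ⟨hpU, hUs⟩⟩
    · exact ⟨∅, isClopen_empty, fun h => absurd h hp⟩
  choose U hUc hU using hex
  choose u hu1 hu0 using fun p => aux_indicator (U p) (hUc p)
  have hd : (s : Set K).PairwiseDisjoint U := by
    intro p hp q hq hpq
    exact (hWd hp hq hpq).mono (fun x hx => ((hU p hp).2 hx).1) (fun x hx => ((hU q hq).2 hx).1)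
  have htot : ∑ p ∈ s, ∑ i ∈ I, |T (u p) i| ≤ I.card * ‖T‖ := by
    rw [Finset.sum_comm]
    calc _ ≤ ∑ i ∈ I, ‖T‖ := Finset.sum_le_sum fun i _ => aux_sum T s U hd u hu1 hu0 i
      _ = _ := by simp
  have : ∃ p ∈ s, ∑ i ∈ I, |T (u p) i| < η := by
    by_contra hcon
    push Not at hcon
    have h1 : (s.card : ℝ) * η ≤ ∑ p ∈ s, ∑ i ∈ I, |T (u p) i| := by
      rw [← nsmul_eq_mul]
      exact Finset.card_nsmul_le_sum s _ η hcon
    rw [hs] at h1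
    rw [div_lt_iff₀ hη] at hN
    linarith
  obtain ⟨p, hp, hpη⟩ := this
  refine ⟨U p, u p, fun x hx => ((hU p hp).2 hx).2, ⟨p, (hU p hp).1⟩, hu1 p, hu0 p, ?_⟩
  intro i hi
  exact (Finset.single_le_sum (f := fun i => |T (u p) i|) (fun _ _ => abs_nonneg _) hi).trans hpη.le

/-- Quantitative lower bound on `‖T‖` for a norm-increasing isomorphism
`T : C(K,ℝ) ≃ C(L,ℝ)` in terms of `r = sup{‖φ‖ : φ ∈ Φ}`, where `Φ` is the family
of functions whose image under `T` takes values `±1` on a finite subset `I` of the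
set `D` of isolated points of `L` and vanishes on `D \ I`. -/
theorem norm_lower_bound_of_sup_Phi
    {K L : Type*} [TopologicalSpace K] [CompactSpace K] [T2Space K]
    [Nonempty K] [TotallyDisconnectedSpace K]
    (hK : ∀ x : K, (𝓝[≠] x).NeBot)
    [TopologicalSpace L] [CompactSpace L] [T2Space L]
    (D : Set L) (hD : D = {y : L | ¬ (𝓝[≠] y).NeBot})
    (hDcount : D.Countable) (hDinf : D.Infinite) (hDdense : Dense D)
    (T : C(K, ℝ) ≃L[ℝ] C(L, ℝ))
    (hT : ∀ g : C(K, ℝ), ‖g‖ ≤ ‖T g‖)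
    (Φ : Set C(K, ℝ))
    (hΦ : Φ = {φ : C(K, ℝ) | ∃ (I : Finset L) (σ : L → ℝ), ↑I ⊆ D ∧
      (∀ i ∈ I, σ i = 1 ∨ σ i = -1) ∧
      (∀ i ∈ I, (T φ) i = σ i) ∧
      (∀ d ∈ D \ ↑I, (T φ) d = 0)})
    (r : ℝ) (hr : r = sSup ((fun φ : C(K, ℝ) => ‖φ‖) '' Φ))
    (hr0 : 0 < r) (hr1 : r < 1) :
    2 / (1 - r) + 1 / r ≤ ‖(T : C(K, ℝ) →L[ℝ] C(L, ℝ))‖ := by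
  classical
  have hΦn : ∀ φ ∈ Φ, ‖φ‖ ≤ 1 := by
    intro φ hφ
    rw [hΦ] at hφ
    obtain ⟨I, σ, hI, hσ, h1, h0⟩ := hφ
    refine (hT φ).trans ?_
    rw [ContinuousMap.norm_le _ zero_le_one]
    intro x
    have hcl : IsClosed {x | ‖T φ x‖ ≤ 1} := isClosed_le (by fun_prop) continuous_const
    have hsub : D ⊆ {x | ‖T φ x‖ ≤ 1} := by
      intro d hd
      by_cases hdI : d ∈ I
      · rcases hσ d hdI with h | h <;> simp [h1 d hdI, h]
      · simp [h0 d ⟨hd, by simpa using hdI⟩]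
    exact (hcl.closure_subset_iff.2 hsub) (hDdense x)
  have hbdd : BddAbove ((fun φ : C(K, ℝ) => ‖φ‖) '' Φ) :=
    ⟨1, by rintro _ ⟨φ, hφ, rfl⟩; exact hΦn φ hφ⟩
  have hΦr : ∀ φ ∈ Φ, ‖φ‖ ≤ r := by
    intro φ hφ
    rw [hr]
    exact le_csSup hbdd ⟨φ, hφ, rfl⟩
  have hne : ((fun φ : C(K, ℝ) => ‖φ‖) '' Φ).Nonempty := by
    by_contra h
    rw [Set.not_nonempty_iff_eq_empty] at h
    rw [h, Real.sSup_empty] at hr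
    linarith
  have hneg : ∀ φ ∈ Φ, -φ ∈ Φ := by
    intro φ hφ
    rw [hΦ] at hφ ⊢
    obtain ⟨I, σ, hI, hσ, h1, h0⟩ := hφ
    refine ⟨I, fun i => - σ i, hI, fun i hi => ?_, fun i hi => ?_, fun d hd => ?_⟩
    · rcases hσ i hi with h | h <;> simp [h]
    · simp [h1 i hi]
    · simp [h0 d hd]
  set M := ‖(T : C(K, ℝ) →L[ℝ] C(L, ℝ))‖ with hM
  have key : ∀ ε : ℝ, 0 < ε → ε < r →
      2 / (1 - r + 3 * ε) + 1 / r ≤ M * (1 + 2 * ε / r) := by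
    intro ε hε hεr
    obtain ⟨φ, hφ, y, hy⟩ : ∃ φ ∈ Φ, ∃ y, r - ε < φ y := by
      obtain ⟨_, ⟨φ, hφ, rfl⟩, hlt⟩ := exists_lt_of_lt_csSup hne (show r - ε < _ by
        rw [← hr]; linarith)
      have : ∃ y, r - ε < ‖φ y‖ := by
        by_contra hcon
        push Not at hcon
        have := (ContinuousMap.norm_le φ (by linarith : (0:ℝ) ≤ r - ε)).2 hcon
        simp only at hlt
        linarith
      obtain ⟨y, hy⟩ := this
      rw [Real.norm_eq_abs, lt_abs] at hy
      rcases hy with hy | hy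
      · exact ⟨φ, hφ, y, hy⟩
      · exact ⟨-φ, hneg φ hφ, y, by simpa using hy⟩
    have hφ' := hφ
    rw [hΦ] at hφ'
    obtain ⟨I, σ, hI, hσ, h1, h0⟩ := hφ'
    set s : ℝ := 1 - r + 3 * ε with hs
    have hs0 : 0 < s := by linarith
    obtain ⟨U, u, hUV, ⟨x₀, hx₀⟩, hu1, hu0, huI⟩ := aux_small hK
      (T : C(K, ℝ) →L[ℝ] C(L, ℝ)) {x | r - ε < φ x}
      (isOpen_lt continuous_const (by fun_prop)) ⟨y, hy⟩ I (ε / s) (by positivity)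
    simp only [ContinuousLinearEquiv.coe_coe] at huI
    obtain ⟨d, hd, hdlt⟩ : ∃ d ∈ D, 1 + ε < |T (φ + s • u) d| := by
      have hn : 1 + 2 * ε < ‖T (φ + s • u)‖ := by
        refine lt_of_lt_of_le ?_ (((φ + s • u).norm_coe_le_norm x₀).trans (hT _))
        refine lt_of_lt_of_le ?_ (le_abs_self _)
        have : r - ε < φ x₀ := hUV hx₀
        simp only [ContinuousMap.add_apply, ContinuousMap.smul_apply, smul_eq_mul, hu1 x₀ hx₀]
        linarith
      have hex : ∃ z, 1 + ε < |T (φ + s • u) z| := by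
        by_contra hcon
        push Not at hcon
        have := (ContinuousMap.norm_le (T (φ + s • u)) (by linarith : (0:ℝ) ≤ 1 + ε)).2 hcon
        linarith
      obtain ⟨d, hd1, hd2⟩ := hDdense.exists_mem_open
        (isOpen_lt (continuous_const (y := 1 + ε)) (T (φ + s • u)).continuous.abs) hex
      exact ⟨d, hd1, hd2⟩
    have hdx : T (φ + s • u) d = T φ d + s * T u d := by simp
    have hdI : d ∉ I := by
      intro hdI
      have h2 : |T φ d| = 1 := by
        rcases hσ d hdI with h | h <;> simp [h1 d hdI, h]
      have h3 : s * |T u d| ≤ ε := by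
        have := huI d hdI
        rwa [le_div_iff₀ hs0, mul_comm] at this
      have h4 := abs_add_le (T φ d) (s * T u d)
      rw [abs_mul, abs_of_pos hs0] at h4
      rw [hdx] at hdlt
      linarith
    have hφd : T φ d = 0 := h0 d ⟨hd, by simpa using hdI⟩
    have hud : 1 / s < |T u d| := by
      rw [hdx, hφd, zero_add, abs_mul, abs_of_pos hs0] at hdlt
      rw [div_lt_iff₀ hs0, mul_comm]
      linarith
    have hdopen : IsOpen ({d} : Set L) := by
      rw [hD] at hd
      rw [isOpen_singleton_iff_punctured_nhds]
      simpa [neBot_iff] using hd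
    obtain ⟨v, hv1, hv0⟩ := aux_indicator ({d} : Set L) ⟨isClosed_singleton, hdopen⟩
    have hv1 : v d = 1 := hv1 d rfl
    set e := T.symm v with he
    have hTe : T e = v := by simp [he]
    have hmem : ∀ τ : ℝ, (τ = 1 ∨ τ = -1) → φ + τ • e ∈ Φ := by
      intro τ hτ
      rw [hΦ]
      refine ⟨insert d I, fun i => if i = d then τ else σ i, ?_, ?_, ?_, ?_⟩
      · intro i hi
        rcases Finset.mem_insert.1 (Finset.mem_coe.1 hi) with rfl | hi
        · exact hd
        · exact hI hi
      · intro i hi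
        by_cases hid : i = d
        · simpa [hid] using hτ
        · simpa [hid] using hσ i (by simpa [hid] using hi)
      · intro i hi
        by_cases hid : i = d
        · subst hid
          simp [hTe, hφd, hv1]
        · have hiI : i ∈ I := by simpa [hid] using hi
          simp [hTe, hid, hv0 i hid, h1 i hiI]
      · rintro i ⟨hiD, hi⟩
        have hi' : i ≠ d ∧ i ∉ I := by simpa using hi
        simp [hTe, hv0 i hi'.1, h0 i ⟨hiD, by simpa using hi'.2⟩]
    obtain ⟨τ, hτ, hτu⟩ : ∃ τ : ℝ, (τ = 1 ∨ τ = -1) ∧ |τ / r - 2 * T u d| = 1 / r + 2 * |T u d| := by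
      have hrp : 0 < 1 / r := by positivity
      rcases le_total 0 (T u d) with h | h
      · refine ⟨-1, Or.inr rfl, ?_⟩
        rw [abs_of_nonneg h, neg_div, abs_of_nonpos] <;> linarith
      · refine ⟨1, Or.inl rfl, ?_⟩
        rw [abs_of_nonpos h, abs_of_nonneg] <;> linarith
    have hup : ∀ x, |φ x + τ * e x| ≤ r := by
      intro x
      have := ((φ + τ • e).norm_coe_le_norm x).trans (hΦr _ (hmem τ hτ))
      simpa using this
    have hdn : ∀ x, |φ x - τ * e x| ≤ r := by
      intro x
      have := ((φ + (-τ) • e).norm_coe_le_norm x).trans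
        (hΦr _ (hmem (-τ) (by rcases hτ with h | h <;> simp [h])))
      simpa [sub_eq_add_neg] using this
    set g : C(K, ℝ) := (1 / r) • (φ + τ • e) - (2 : ℝ) • u with hg
    have hgn : ‖g‖ ≤ 1 + 2 * ε / r := by
      rw [ContinuousMap.norm_le _ (by positivity)]
      intro x
      have hgx : g x = (φ x + τ * e x) / r - 2 * u x := by
        simp [hg]; ring
      rw [hgx, Real.norm_eq_abs]
      have hA := abs_le.1 (hup x)
      have hB := abs_le.1 (hdn x)
      have h2 : 0 ≤ 2 * ε / r := by positivity
      by_cases hx : x ∈ U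
      · have h3 : r - ε < φ x := hUV hx
        rw [hu1 x hx]
        have h4 : (φ x + τ * e x) / r ≤ 1 := by
          rw [div_le_one hr0]; exact hA.2
        have h5 : 1 - 2 * ε / r ≤ (φ x + τ * e x) / r := by
          rw [← div_self hr0.ne', ← sub_div]
          gcongr
          linarith
        rw [abs_le]
        constructor <;> linarith
      · rw [hu0 x hx, mul_zero, sub_zero, abs_div, abs_of_pos hr0]
        have := (div_le_one hr0).2 (hup x)
        linarith
    have hTg : T g d = τ / r - 2 * T u d := by
      simp [hg, hTe, hφd, hv1]; ring
    calc 2 / s + 1 / r ≤ 1 / r + 2 * |T u d| := by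
          have : 2 / s = 2 * (1 / s) := by ring
          linarith
      _ = ‖T g d‖ := by rw [hTg, Real.norm_eq_abs, hτu]
      _ ≤ ‖T g‖ := (T g).norm_coe_le_norm d
      _ ≤ M * ‖g‖ := (T : C(K, ℝ) →L[ℝ] C(L, ℝ)).le_opNorm g
      _ ≤ M * (1 + 2 * ε / r) := by gcongr
  have hl : Tendsto (fun ε : ℝ => 2 / (1 - r + 3 * ε) + 1 / r) (𝓝[>] 0)
      (𝓝 (2 / (1 - r) + 1 / r)) := by
    have : ContinuousAt (fun ε : ℝ => 2 / (1 - r + 3 * ε) + 1 / r) 0 := by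
      refine ContinuousAt.add (ContinuousAt.div continuousAt_const (by fun_prop) ?_)
        continuousAt_const
      simp; linarith
    have h := this.tendsto.mono_left (nhdsWithin_le_nhds (s := Set.Ioi 0))
    simpa using h
  have hR : Tendsto (fun ε : ℝ => M * (1 + 2 * ε / r)) (𝓝[>] 0) (𝓝 M) := by
    have : ContinuousAt (fun ε : ℝ => M * (1 + 2 * ε / r)) 0 := by fun_prop
    have h := this.tendsto.mono_left (nhdsWithin_le_nhds (s := Set.Ioi 0))
    simpa using h
  refine le_of_tendsto_of_tendsto hl hR ?_
  filter_upwards [Ioo_mem_nhdsGT hr0] with ε hε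
  exact key ε hε.1 hε.2
end

section
/- Every continuous linear equivalence T : L∞[0,1] ≃ ℓ∞ satisfies ‖T‖·‖T⁻¹‖ ≥ 7.41. Equivalently, the Banach–Mazur distance of L∞[0,1] and ℓ∞ is at least 7.41. -/
open MeasureTheory ENNReal

abbrev SeqE : Type := lp (fun _ : ℕ => ℝ) ∞

theorem seq_exists (g : ℕ → ℝ) (C : ℝ) (h : ∀ n, |g n| ≤ C) : ∃ x : SeqE, ∀ n, x n = g n := by
  refine ⟨⟨g, memℓp_infty ⟨C, ?_⟩⟩, fun n => rfl⟩
  rintro _ ⟨n, rfl⟩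
  exact h n

theorem seq_apply_le (x : SeqE) (n : ℕ) : |x n| ≤ ‖x‖ :=
  lp.norm_apply_le_norm (by simp) x n

theorem seq_norm_le {x : SeqE} {C : ℝ} (hC : 0 ≤ C) (h : ∀ n, |x n| ≤ C) : ‖x‖ ≤ C :=
  lp.norm_le_of_forall_le hC h

theorem seq_mul_apply (x y : SeqE) (n : ℕ) : (x * y) n = x n * y n := by
  rw [lp.infty_coeFn_mul]; rfl

theorem seq_sum_apply {ι : Type*} (s : Finset ι) (f : ι → SeqE) (n : ℕ) :
    (∑ i ∈ s, f i) n = ∑ i ∈ s, f i n := by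
  rw [lp.coeFn_sum]; simp

/-- `x` is small for a finite family of functionals, in the total variation sense. -/
def SmallFor (Λ : Finset (SeqE →L[ℝ] ℝ)) (x : SeqE) : Prop :=
  ∀ l ∈ Λ, ∀ a : SeqE, ‖a‖ ≤ 1 → |l (a * x)| ≤ 1

theorem sum_functional_le {K : ℕ} (l : SeqE →L[ℝ] ℝ) (C : ℝ) (hC : 0 ≤ C) (w : Fin K → SeqE)
    (hw : ∀ n, ∑ i, |w i n| ≤ C) (a : Fin K → SeqE) (ha : ∀ i, ‖a i‖ ≤ 1) :
    ∑ i, |l (a i * w i)| ≤ ‖l‖ * C := by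
  have h1 : ∀ i, ∃ e : ℝ, |e| ≤ 1 ∧ |l (a i * w i)| = e * l (a i * w i) := by
    intro i
    rcases le_total 0 (l (a i * w i)) with h | h
    · exact ⟨1, by simp, by rw [abs_of_nonneg h]; ring⟩
    · exact ⟨-1, by simp, by rw [abs_of_nonpos h]; ring⟩
  choose e he1 he2 using h1
  have h2 : ∑ i, |l (a i * w i)| = l (∑ i, e i • (a i * w i)) := by
    simp only [map_sum, map_smul, smul_eq_mul, he2]
  rw [h2]
  refine (le_abs_self _).trans ((l.le_opNorm _).trans ?_)
  gcongr
  refine seq_norm_le hC fun n => ?_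
  rw [seq_sum_apply]
  refine (Finset.abs_sum_le_sum_abs _ _).trans (le_trans (Finset.sum_le_sum fun i _ => ?_) (hw n))
  rw [lp.coeFn_smul, Pi.smul_apply, seq_mul_apply, smul_eq_mul, abs_mul, abs_mul]
  have h3 : |a i n| ≤ 1 := (seq_apply_le _ _).trans (ha i)
  have h4 := he1 i
  calc |e i| * (|a i n| * |w i n|) ≤ 1 * (1 * |w i n|) := by gcongr
    _ = _ := by ring

theorem pigeon (Λ : Finset (SeqE →L[ℝ] ℝ)) (C : ℝ) (hC : 0 ≤ C) :
    ∃ K : ℕ, ∀ w : Fin K → SeqE, (∀ n, ∑ i, |w i n| ≤ C) → ∃ i, SmallFor Λ (w i) := by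
  obtain ⟨K, hK⟩ := exists_nat_gt (∑ l ∈ Λ, ‖l‖ * C)
  refine ⟨K, fun w hw => ?_⟩
  by_contra hcon
  simp only [SmallFor] at hcon
  push Not at hcon
  choose l hl a ha hbad using hcon
  have h1 : (K : ℝ) ≤ ∑ i : Fin K, |l i (a i * w i)| := by
    calc (K : ℝ) = ∑ i : Fin K, (1 : ℝ) := by simp
      _ ≤ _ := Finset.sum_le_sum fun i _ => (hbad i).le
  have h2 : ∑ i : Fin K, |l i (a i * w i)| ≤ ∑ i : Fin K, ∑ k ∈ Λ, |k (a i * w i)| :=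
    Finset.sum_le_sum fun i _ =>
      Finset.single_le_sum (f := fun k : SeqE →L[ℝ] ℝ => |k (a i * w i)|)
        (fun k _ => abs_nonneg _) (hl i)
  rw [Finset.sum_comm] at h2
  have h3 : ∑ k ∈ Λ, ∑ i : Fin K, |k (a i * w i)| ≤ ∑ k ∈ Λ, ‖k‖ * C :=
    Finset.sum_le_sum fun k _ => sum_functional_le k C hC w hw a ha
  linarith

set_option linter.unusedSectionVars false

section
variable {Ω : Type*} [MeasurableSpace Ω] {μ : Measure Ω} [IsFiniteMeasure μ]

theorem Linf_ae_le (f : Lp ℝ ∞ μ) : ∀ᵐ t ∂μ, |f t| ≤ ‖f‖ := by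
  have h := ae_le_eLpNormEssSup (f := (f : Ω → ℝ)) (μ := μ)
  filter_upwards [h] with t ht
  rw [Lp.norm_def, eLpNorm_exponent_top]
  have hfin : eLpNormEssSup (f : Ω → ℝ) μ ≠ ∞ := by
    rw [← eLpNorm_exponent_top]; exact (Lp.memLp f).2.ne
  have := ENNReal.toReal_mono hfin ht
  simpa using this

theorem Linf_norm_le {f : Lp ℝ ∞ μ} {C : ℝ} (hC : 0 ≤ C) (h : ∀ᵐ t ∂μ, |f t| ≤ C) :
    ‖f‖ ≤ C := by
  rw [Lp.norm_def, eLpNorm_exponent_top]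
  exact ENNReal.toReal_le_of_le_ofReal hC (eLpNormEssSup_le_of_ae_bound h)

theorem Linf_integrable (f : Lp ℝ ∞ μ) (B : Set Ω) : IntegrableOn f B μ :=
  ((Lp.memLp f).integrable (by simp)).integrableOn

theorem intCLM (B : Set Ω) : ∃ l : Lp ℝ ∞ μ →L[ℝ] ℝ, ∀ f, l f = ∫ t in B, f t ∂μ := by
  refine ⟨LinearMap.mkContinuous
    { toFun := fun f : Lp ℝ ∞ μ => ∫ t in B, f t ∂μ
      map_add' := fun f g => ?_
      map_smul' := fun c f => ?_ } (μ.real B) ?_, fun f => rfl⟩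
  · rw [← integral_add (Linf_integrable f B) (Linf_integrable g B)]
    exact integral_congr_ae (ae_restrict_of_ae (Lp.coeFn_add f g))
  · rw [RingHom.id_apply, ← integral_smul]
    exact integral_congr_ae (ae_restrict_of_ae (Lp.coeFn_smul c f))
  · intro f
    have := norm_setIntegral_le_of_norm_le_const_ae (f := f) (s := B) (μ := μ) (C := ‖f‖)
      (measure_lt_top _ _) (ae_restrict_of_ae (Linf_ae_le f))
    rw [mul_comm]; exact this

theorem Linf_measurableSet_lt (f : Lp ℝ ∞ μ) (s : ℝ) : MeasurableSet {t | s < f t} :=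
  measurableSet_lt measurable_const (Lp.stronglyMeasurable f).measurable

/-- Existence of a small vector on which `S` is big somewhere on `B`. -/
def Good (S : SeqE →L[ℝ] Lp ℝ ∞ μ) (B : Set Ω) (Λ : Finset (SeqE →L[ℝ] ℝ)) (s : ℝ) : Prop :=
  ∃ x : SeqE, ‖x‖ ≤ 1 ∧ SmallFor Λ x ∧ μ (B ∩ {t | s < S x t}) ≠ 0

theorem disj (S : SeqE →L[ℝ] Lp ℝ ∞ μ) (B : Set Ω) (s : ℝ)
    (hQ : ∀ B' ⊆ B, MeasurableSet B' → μ B' ≠ 0 → ∀ Λ, Good S B' Λ s) (K : ℕ) :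
    ∀ (D : Fin K → Set Ω), (∀ i, MeasurableSet (D i)) → (∀ i, μ (D i) ≠ 0) → (∀ i, D i ⊆ B) →
    ∀ ε > 0, ∃ c : Fin K → SeqE, (∀ n, ∑ i, |c i n| ≤ 1) ∧
      ∀ i, μ (D i ∩ {t | s - ε < S (c i) t}) ≠ 0 := by
  classical
  induction K with
  | zero => intro D _ _ _ ε _; exact ⟨fun i => 0, by simp, fun i => i.elim0⟩
  | succ K ih =>
    intro D hDm hDp hDB ε hε
    obtain ⟨c, hc, hcp⟩ := ih (fun i => D i.succ) (fun i => hDm _) (fun i => hDp _)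
      (fun i => hDB _) (ε / 2) (by positivity)
    have hl : ∀ i : Fin K, ∃ l : Lp ℝ ∞ μ →L[ℝ] ℝ,
        ∀ f, l f = ∫ t in (D i.succ ∩ {t | s - ε / 2 < S (c i) t}), f t ∂μ := fun i => intCLM _
    choose l hl using hl
    set Bi : Fin K → Set Ω := fun i => D i.succ ∩ {t | s - ε / 2 < S (c i) t} with hBi
    have hBm : ∀ i, MeasurableSet (Bi i) := fun i => (hDm _).inter (Linf_measurableSet_lt _ _)
    have hBr : ∀ i, 0 < μ.real (Bi i) := fun i =>
      ENNReal.toReal_pos (hcp i) (measure_ne_top _ _)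
    obtain ⟨x, hx1, hxs, hxp⟩ := hQ (D 0) (hDB 0) (hDm 0) (hDp 0)
      (Finset.univ.image fun i : Fin K => (μ.real (Bi i) * (ε / 2))⁻¹ • ((l i).comp S))
    obtain ⟨y, hy⟩ := seq_exists (fun n => |x n|) ‖x‖ (fun n => by
      rw [abs_abs]; exact seq_apply_le x n)
    have hx1n : ∀ n, |x n| ≤ 1 := fun n => (seq_apply_le x n).trans hx1
    have hcn : ∀ i n, |c i n| ≤ 1 := fun i n =>
      (Finset.single_le_sum (f := fun i => |c i n|) (fun _ _ => abs_nonneg _)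
        (Finset.mem_univ i)).trans (hc n)
    refine ⟨Fin.cons x (fun i => c i - c i * y), ?_, ?_⟩
    · intro n
      rw [Fin.sum_univ_succ]
      simp only [Fin.cons_zero, Fin.cons_succ]
      have h1 : ∀ i, |(c i - c i * y) n| = |c i n| * (1 - |x n|) := by
        intro i
        rw [lp.coeFn_sub, Pi.sub_apply, seq_mul_apply, hy,
          show c i n - c i n * |x n| = c i n * (1 - |x n|) by ring, abs_mul,
          abs_of_nonneg (a := 1 - |x n|) (by linarith [hx1n n])]
      simp only [h1]
      rw [← Finset.sum_mul]
      nlinarith [hc n, hx1n n]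
    · intro i
      refine Fin.cases ?_ (fun i => ?_) i
      · simp only [Fin.cons_zero]
        refine fun h => hxp (measure_mono_null ?_ h)
        rintro t ⟨h1, h2⟩
        exact ⟨h1, by simp only [Set.mem_ofPred_eq] at h2 ⊢; linarith⟩
      · simp only [Fin.cons_succ]
        intro hnull
        obtain ⟨a, ha⟩ := seq_exists (fun n => c i n * SignType.sign (x n)) 1 (fun n => by
          rw [abs_mul]
          have : |((SignType.sign (x n) : SignType) : ℝ)| ≤ 1 := by
            rcases lt_trichotomy (x n) 0 with h | h | h <;> simp [h]
          calc _ ≤ (1 : ℝ) * 1 := by gcongr; exact hcn i n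
            _ = 1 := by ring)
        have hax : a * x = c i * y := by
          apply lp.ext; funext n
          rw [seq_mul_apply, seq_mul_apply, ha, hy, mul_assoc, sign_mul_self]
        have ha1 : ‖a‖ ≤ 1 := seq_norm_le zero_le_one (fun n => by
          rw [ha, abs_mul]
          have : |((SignType.sign (x n) : SignType) : ℝ)| ≤ 1 := by
            rcases lt_trichotomy (x n) 0 with h | h | h <;> simp [h]
          calc _ ≤ (1 : ℝ) * 1 := by gcongr; exact hcn i n
            _ = 1 := by ring)
        have h1 := hxs _ (Finset.mem_image_of_mem _ (Finset.mem_univ i)) a ha1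
        have hpos : 0 < μ.real (Bi i) * (ε / 2) := mul_pos (hBr i) (by positivity)
        rw [hax, smul_apply, smul_eq_mul, abs_mul, abs_inv,
          abs_of_pos hpos, inv_mul_le_iff₀ hpos, mul_one, ContinuousLinearMap.comp_apply] at h1
        have h2 : l i (S (c i - c i * y)) ≤ (s - ε) * μ.real (Bi i) := by
          rw [hl]
          have : ∫ t in Bi i, (s - ε) ∂μ = (s - ε) * μ.real (Bi i) := by
            rw [setIntegral_const, smul_eq_mul, mul_comm]
          rw [← this]
          refine setIntegral_mono_on_ae (Linf_integrable _ _) (integrable_const _) (hBm i) ?_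
          have h3 : ∀ᵐ t ∂μ, t ∉ D i.succ ∩ {t | s - ε < S (c i - c i * y) t} :=
            measure_eq_zero_iff_ae_notMem.mp hnull
          filter_upwards [h3] with t ht htB
          by_contra hlt
          exact ht ⟨htB.1, not_le.mp hlt⟩
        have h3 : (s - ε / 2) * μ.real (Bi i) < l i (S (c i)) := by
          rw [hl]
          have : ∫ t in Bi i, (s - ε / 2) ∂μ = (s - ε / 2) * μ.real (Bi i) := by
            rw [setIntegral_const, smul_eq_mul, mul_comm]
          rw [← this, ← sub_pos, ← integral_sub (Linf_integrable _ _) (integrable_const _)]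
          rw [setIntegral_pos_iff_support_of_nonneg_ae]
          · refine pos_iff_ne_zero.mpr fun h => hcp i (measure_mono_null ?_ h)
            intro t ht
            refine ⟨?_, ht⟩
            have := ht.2
            simp only [Set.mem_ofPred_eq] at this
            simp only [Function.mem_support]
            linarith
          · filter_upwards [ae_restrict_mem (hBm i)] with t ht
            have := ht.2
            simp only [Set.mem_ofPred_eq] at this
            simp only [Pi.zero_apply]
            linarith
          · exact (Linf_integrable _ _).sub (integrable_const _)
        rw [map_sub, map_sub] at h2
        have h4 := (abs_le.mp h1).2
        nlinarith
end

theorem halve {μ : Measure ℝ} [NullSingletonClass μ] (B : Set ℝ) (hB : MeasurableSet B)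
    (h : μ B ≠ 0) :
    ∃ B₁ B₂, MeasurableSet B₁ ∧ MeasurableSet B₂ ∧ B₁ ⊆ B ∧ B₂ ⊆ B ∧ Disjoint B₁ B₂ ∧
      μ B₁ ≠ 0 ∧ μ B₂ ≠ 0 := by
  obtain ⟨x, hx, hxp⟩ := exists_mem_forall_mem_nhdsWithin_pos_measure h
  have h2 : μ (B \ {x}) ≠ 0 := by
    rw [measure_sdiff_null (measure_singleton x)]; exact h
  obtain ⟨z, hz, hzp⟩ := exists_mem_forall_mem_nhdsWithin_pos_measure h2
  have hzx : z ≠ x := hz.2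
  have hzp' : ∀ t ∈ nhdsWithin z B, 0 < μ t := fun t ht =>
    hzp t (nhdsWithin_mono z Set.sdiff_subset ht)
  have key : ∀ u v : ℝ, u < v → (∀ t ∈ nhdsWithin u B, 0 < μ t) →
      (∀ t ∈ nhdsWithin v B, 0 < μ t) → ∃ B₁ B₂, MeasurableSet B₁ ∧ MeasurableSet B₂ ∧
        B₁ ⊆ B ∧ B₂ ⊆ B ∧ Disjoint B₁ B₂ ∧ μ B₁ ≠ 0 ∧ μ B₂ ≠ 0 := by
    intro u v huv hu hv
    obtain ⟨q, hq1, hq2⟩ := exists_between huv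
    refine ⟨B ∩ Set.Iio q, B ∩ Set.Ioi q, hB.inter measurableSet_Iio, hB.inter measurableSet_Ioi,
      Set.inter_subset_left, Set.inter_subset_left, ?_, ?_, ?_⟩
    · rw [Set.disjoint_left]
      rintro t ⟨_, h1⟩ ⟨_, h2⟩
      exact lt_asymm (Set.mem_Iio.mp h1) (Set.mem_Ioi.mp h2)
    · exact (hu _ (Filter.inter_mem self_mem_nhdsWithin
        (mem_nhdsWithin_of_mem_nhds (Iio_mem_nhds hq1)))).ne'
    · exact (hv _ (Filter.inter_mem self_mem_nhdsWithin
        (mem_nhdsWithin_of_mem_nhds (Ioi_mem_nhds hq2)))).ne'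
  rcases lt_or_gt_of_ne hzx with hlt | hlt
  · exact key z x hlt hzp' hxp
  · exact key x z hlt hxp hzp'

theorem split {μ : Measure ℝ} [NullSingletonClass μ] (K : ℕ) :
    ∀ (B : Set ℝ), MeasurableSet B → μ B ≠ 0 →
    ∃ D : Fin K → Set ℝ, (∀ i, MeasurableSet (D i)) ∧ (∀ i, μ (D i) ≠ 0) ∧ (∀ i, D i ⊆ B) ∧
      Pairwise (Function.onFun Disjoint D) := by
  induction K with
  | zero => intro B _ _; exact ⟨fun _ => ∅, fun i => i.elim0, fun i => i.elim0, fun i => i.elim0,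
      fun i => i.elim0⟩
  | succ K ih =>
    intro B hB h
    obtain ⟨B₁, B₂, m1, m2, s1, s2, hd, p1, p2⟩ := halve B hB h
    obtain ⟨D, hm, hp, hs, hdd⟩ := ih B₂ m2 p2
    refine ⟨Fin.cons B₁ D, ?_, ?_, ?_, ?_⟩
    · intro i; refine Fin.cases ?_ (fun i => ?_) i
      · simpa using m1
      · simpa using hm i
    · intro i; refine Fin.cases ?_ (fun i => ?_) i
      · simpa using p1
      · simpa using hp i
    · intro i; refine Fin.cases ?_ (fun i => ?_) i
      · simpa using s1
      · simpa using (hs i).trans s2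
    · intro i j
      refine Fin.cases ?_ (fun i => ?_) i <;> refine Fin.cases ?_ (fun j => ?_) j
      · intro h; exact absurd rfl h
      · intro _; simp only [Function.onFun, Fin.cons_zero, Fin.cons_succ]
        exact hd.mono_right (hs j)
      · intro _; simp only [Function.onFun, Fin.cons_zero, Fin.cons_succ]
        exact (hd.mono_right (hs i)).symm
      · intro h; simp only [Function.onFun, Fin.cons_succ]
        exact hdd (fun e => h (by rw [e]))

set_option linter.unusedSectionVars false

section
variable {Ω : Type*} [MeasurableSpace Ω] {μ : Measure Ω} [IsFiniteMeasure μ]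

theorem kill_finite (S : SeqE →L[ℝ] Lp ℝ ∞ μ)
    (hS : ∀ n, S (lp.single ∞ n (1 : ℝ)) = 0) (m : ℕ) (x y : SeqE)
    (h : ∀ n, m ≤ n → x n = y n) : S x = S y := by
  have h1 : x - y = ∑ k ∈ Finset.range m, ((x - y) k) • (lp.single ∞ k (1 : ℝ) : SeqE) := by
    apply lp.ext; funext n
    rw [seq_sum_apply]
    simp only [lp.coeFn_smul, Pi.smul_apply, smul_eq_mul, lp.coeFn_single, Pi.single_apply,
      mul_ite, mul_one, mul_zero]
    rw [Finset.sum_ite_eq]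
    split_ifs with hn
    · rfl
    · rw [lp.coeFn_sub, Pi.sub_apply, h n (by simpa using hn), sub_self]
  rw [← sub_eq_zero, ← map_sub, h1, map_sum]
  exact Finset.sum_eq_zero fun k _ => by rw [map_smul, hS, smul_zero]

theorem exists_threshold (Q : ℝ → Prop) (h0 : Q (-1)) (h1 : ¬ Q 9) :
    ∃ s, Q s ∧ ¬ Q (s + 1 / 1000) := by
  by_contra hcon
  push Not at hcon
  have : ∀ k : ℕ, Q (-1 + k * (1 / 1000)) := by
    intro k
    induction k with
    | zero => simpa using h0
    | succ k ih =>
      have := hcon _ ih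
      push_cast
      convert this using 1
      ring
  exact h1 (by convert this 10000 using 1; norm_num)

/-- Norm estimate for sums of pieces. -/
theorem pieces_bound (T : Lp ℝ ∞ μ →L[ℝ] SeqE) (S : SeqE →L[ℝ] Lp ℝ ∞ μ)
    (hT : ‖T‖ ≤ 8) (hS : ‖S‖ ≤ 9) {K : ℕ} (c : Fin K → SeqE) (hc : ∀ n, ∑ i, |c i n| ≤ 1)
    (g : Fin K → Lp ℝ ∞ μ) (D : Fin K → Set Ω)
    (hg : ∀ i, g i =ᵐ[μ] (D i).indicator fun _ => (1 : ℝ))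
    (hD : Pairwise (Function.onFun Disjoint D)) (n : ℕ) :
    ∑ i, |(T (S (c i)) + (2 : ℝ) • T (g i)) n| ≤ 88 := by
  have h1 : ∀ i, ∃ e : ℝ, |e| ≤ 1 ∧ |(T (S (c i)) + (2 : ℝ) • T (g i)) n| =
      e * (T (S (c i)) + (2 : ℝ) • T (g i)) n := by
    intro i
    rcases le_total 0 ((T (S (c i)) + (2 : ℝ) • T (g i)) n) with h | h
    · exact ⟨1, by simp, by rw [abs_of_nonneg h]; ring⟩
    · exact ⟨-1, by simp, by rw [abs_of_nonpos h]; ring⟩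
  choose e he1 he2 using h1
  have h2 : ∑ i, |(T (S (c i)) + (2 : ℝ) • T (g i)) n| =
      (T (S (∑ i, e i • c i) + (2 : ℝ) • ∑ i, e i • g i)) n := by
    simp only [he2]
    have : T (S (∑ i, e i • c i) + (2 : ℝ) • ∑ i, e i • g i) =
        ∑ i, e i • (T (S (c i)) + (2 : ℝ) • T (g i)) := by
      simp only [map_add, map_sum, map_smul, smul_add, Finset.smul_sum, Finset.sum_add_distrib]
      congr 1
      exact Finset.sum_congr rfl fun i _ => smul_comm _ _ _
    rw [this, seq_sum_apply]
    rfl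
  rw [h2]
  refine (le_abs_self _).trans ((seq_apply_le _ _).trans ((T.le_opNorm _).trans ?_))
  have hc1 : ‖∑ i, e i • c i‖ ≤ 1 := by
    refine seq_norm_le zero_le_one fun n => ?_
    rw [seq_sum_apply]
    refine (Finset.abs_sum_le_sum_abs _ _).trans
      (le_trans (Finset.sum_le_sum fun i _ => ?_) (hc n))
    rw [lp.coeFn_smul, Pi.smul_apply, smul_eq_mul, abs_mul]
    have := he1 i
    calc |e i| * |c i n| ≤ 1 * |c i n| := by gcongr
      _ = _ := one_mul _
  have hg1 : ‖∑ i, e i • g i‖ ≤ 1 := by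
    refine Linf_norm_le zero_le_one ?_
    have hsum : ∀ s : Finset (Fin K), ((∑ i ∈ s, e i • g i : Lp ℝ ∞ μ) : Ω → ℝ) =ᵐ[μ]
        fun t => ∑ i ∈ s, e i * (D i).indicator (fun _ => (1 : ℝ)) t := by
      intro s
      classical
      induction s using Finset.induction_on with
      | empty =>
        simp only [Finset.sum_empty]
        exact Lp.coeFn_zero ℝ ∞ μ
      | insert a s ha ih =>
        rw [Finset.sum_insert ha]
        filter_upwards [ih, Lp.coeFn_add (e a • g a) (∑ i ∈ s, e i • g i),
          Lp.coeFn_smul (e a) (g a), hg a] with t h1 h2 h3 h4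
        rw [h2, Pi.add_apply, h1, h3, Pi.smul_apply, h4, Finset.sum_insert ha, smul_eq_mul]
    filter_upwards [hsum Finset.univ] with t ht
    rw [ht]
    by_cases hex : ∃ j, t ∈ D j
    · obtain ⟨j, hj⟩ := hex
      rw [Finset.sum_eq_single j]
      · simp only [Set.indicator_of_mem hj, mul_one]; exact he1 j
      · intro i _ hij
        have : t ∉ D i := fun hi => Set.disjoint_left.mp (hD hij) hi hj
        simp [this]
      · simp
    · push Not at hex
      simp [hex]
  calc ‖T‖ * ‖S (∑ i, e i • c i) + (2 : ℝ) • ∑ i, e i • g i‖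
      ≤ 8 * (9 * 1 + 2 * 1) := by
        gcongr
        refine (norm_add_le _ _).trans (add_le_add ?_ ?_)
        · exact (S.le_opNorm _).trans (by gcongr)
        · rw [norm_smul]; simp; linarith
    _ = 88 := by norm_num
end

section
variable {Ω : Type*} [MeasurableSpace Ω] {μ : Measure Ω} [IsFiniteMeasure μ]

theorem exists_of_ae {p : Ω → Prop} (h : ∀ᵐ t ∂μ, p t) {B : Set Ω} (hB : μ B ≠ 0) :
    ∃ t ∈ B, p t := by
  by_contra hcon
  push Not at hcon
  exact hB (measure_mono_null (fun t ht => hcon t ht) (ae_iff.mp h))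

set_option maxHeartbeats 1000000 in
theorem core (T : Lp ℝ ∞ μ →L[ℝ] SeqE) (R A : SeqE →L[ℝ] Lp ℝ ∞ μ)
    (hTR : ∀ x, T (R x) = x) (hRT : ∀ f, R (T f) = f) (hA : ‖A‖ ≤ 1)
    (hAe : ∀ n, A (lp.single ∞ n (1 : ℝ)) = R (lp.single ∞ n (1 : ℝ)))
    (B : Set Ω) (hB : MeasurableSet B) (hBp : μ B ≠ 0) (N : ℕ) (y : SeqE) (hy : ‖y‖ ≤ 1)
    (hyN : ∀ n, N ≤ n → y n = 0)
    (P1 : ∀ c : SeqE, ‖c‖ ≤ 1 → (∀ n < N, c n = y n) →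
      ∀ᵐ t ∂μ, t ∈ B → 1 - 2 / 10000 ≤ A c t)
    (P2 : ∀ c : SeqE, (∀ n < N, |c n| ≤ 1 / 1000) → ‖c‖ ≤ 88 →
      ∀ᵐ t ∂μ, t ∈ B → |A c t| ≤ 1 / 1000 + 88 / 10000)
    (hsplit : ∀ (K : ℕ) (B : Set Ω), MeasurableSet B → μ B ≠ 0 →
      ∃ D : Fin K → Set Ω, (∀ i, MeasurableSet (D i)) ∧ (∀ i, μ (D i) ≠ 0) ∧ (∀ i, D i ⊆ B) ∧
      Pairwise (Function.onFun Disjoint D)) :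
    (7.41 : ℝ) ≤ ‖T‖ * ‖R‖ := by
  classical
  by_contra hcon
  push Not at hcon
  set S : SeqE →L[ℝ] Lp ℝ ∞ μ := R - A with hSdef
  have hSe : ∀ n, S (lp.single ∞ n (1 : ℝ)) = 0 := fun n => by
    rw [hSdef, sub_apply, hAe, sub_self]
  have hRAS : ∀ x, R x = A x + S x := fun x => by
    rw [hSdef, sub_apply]; abel
  have hA' : ∀ x, ‖x‖ ≤ 1 → ‖A x‖ ≤ 1 := fun x hx =>
    (A.le_opNorm x).trans (mul_le_one₀ hA (norm_nonneg _) hx)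
  -- bounds on the norms
  have hR1 : (1 : ℝ) - 2 / 10000 ≤ ‖R‖ := by
    have hSy : S y = 0 := by
      rw [kill_finite S hSe N y 0 (fun n hn => by rw [hyN n hn]; rfl), map_zero]
    have hRy : R y = A y := by rw [hRAS, hSy, add_zero]
    obtain ⟨t, htB, h1, h2⟩ := exists_of_ae ((P1 y hy (fun _ _ => rfl)).and (Linf_ae_le (A y))) hBp
    have h3 := h1 htB
    have h4 : ‖R y‖ ≤ ‖R‖ := (R.le_opNorm y).trans
      (mul_le_of_le_one_right (norm_nonneg _) hy)
    rw [hRy] at h4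
    linarith [le_abs_self (A y t)]
  have hT1 : (1 : ℝ) ≤ ‖T‖ := by
    have h1 : ‖(lp.single ∞ 0 (1 : ℝ) : SeqE)‖ = 1 := by
      rw [lp.norm_single (by simp)]; simp
    have h2 := T.le_opNorm (R (lp.single ∞ 0 (1 : ℝ)))
    rw [hTR, h1, ← hAe] at h2
    have h3 := hA' _ h1.le
    nlinarith [norm_nonneg T]
  have hT8 : ‖T‖ ≤ 8 := by nlinarith [norm_nonneg T]
  have hR8 : ‖R‖ ≤ 8 := by nlinarith [norm_nonneg R]
  have hS9 : ‖S‖ ≤ 9 := (norm_sub_le R A).trans (by linarith)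
  -- patching in low coordinates
  have patch : ∀ x : SeqE, ‖x‖ ≤ 1 → ∃ c : SeqE, ‖c‖ ≤ 1 ∧ (∀ n < N, c n = y n) ∧
      ∀ n, N ≤ n → c n = x n := by
    intro x hx
    have hb : ∀ n, |(if n < N then y n else x n)| ≤ 1 := by
      intro n; split_ifs
      · exact (seq_apply_le y n).trans hy
      · exact (seq_apply_le x n).trans hx
    obtain ⟨c, hc⟩ := seq_exists (fun n => if n < N then y n else x n) 1 hb
    refine ⟨c, seq_norm_le zero_le_one (fun n => by rw [hc]; exact hb n), fun n hn => ?_,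
      fun n hn => ?_⟩
    · rw [hc]; simp [hn]
    · rw [hc]; simp [not_lt.mpr hn]
  -- threshold
  have hub : ∀ s x, ‖x‖ ≤ 1 → μ (B ∩ {t | s < S x t}) ≠ 0 → 1 - 2 / 10000 + s ≤ ‖R‖ := by
    intro s x hx hpos
    obtain ⟨c, hc1, hcy, hcx⟩ := patch x hx
    have hSc : S c = S x := kill_finite S hSe N c x hcx
    obtain ⟨t, ht, ⟨h1, h2⟩, h3⟩ := exists_of_ae (((P1 c hc1 hcy).and (Linf_ae_le (R c))).and
      (Lp.coeFn_add (A c) (S c))) hpos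
    have h4 := h1 ht.1
    have h5 : s < S x t := ht.2
    rw [← hRAS, Pi.add_apply, hSc] at h3
    have h6 : ‖R c‖ ≤ ‖R‖ := (R.le_opNorm c).trans
      (mul_le_of_le_one_right (norm_nonneg _) hc1)
    linarith [le_abs_self (R c t)]
  obtain ⟨s, hQs, hnQ⟩ := exists_threshold
    (fun s => ∀ B' ⊆ B, MeasurableSet B' → μ B' ≠ 0 → ∀ Λ, Good S B' Λ s)
    (by
      intro B' _ hB'm hB'p Λ
      refine ⟨0, by simp, fun l _ a _ => by simp, ?_⟩
      intro hnull
      rw [map_zero] at hnull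
      obtain ⟨t, ht, h1, h2⟩ := exists_of_ae
        ((measure_eq_zero_iff_ae_notMem.mp hnull).and (Lp.coeFn_zero ℝ ∞ μ)) hB'p
      refine h1 ⟨ht, ?_⟩
      simp only [Set.mem_ofPred_eq]
      rw [h2]; norm_num)
    (by
      intro h
      obtain ⟨x, hx1, _, hx3⟩ := h B subset_rfl hB hBp ∅
      have := hub 9 x hx1 hx3
      linarith)
  have hRs : 1 - 2 / 10000 + s ≤ ‖R‖ := by
    obtain ⟨x, hx1, _, hx3⟩ := hQs B subset_rfl hB hBp ∅
    exact hub s x hx1 hx3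
  push Not at hnQ
  obtain ⟨B', hB'B, hB'm, hB'p, Λ, hbad⟩ := hnQ
  obtain ⟨K, hK⟩ := pigeon
    (Λ ∪ (Finset.range N).image fun n => (1000 : ℝ) • lp.evalCLM ℝ (fun _ : ℕ => ℝ) ∞ n) 88
    (by norm_num)
  obtain ⟨D, hDm, hDp, hDB, hDd⟩ := hsplit K B' hB'm hB'p
  obtain ⟨c, hc, hcp⟩ := disj S B' s (fun B'' h => hQs B'' (h.trans hB'B)) K D hDm hDp hDB
    (1 / 1000) (by norm_num)
  set E : Fin K → Set Ω := fun i => D i ∩ {t | s - 1 / 1000 < S (c i) t} with hE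
  have hEm : ∀ i, MeasurableSet (E i) := fun i => (hDm i).inter (Linf_measurableSet_lt _ _)
  set g : Fin K → Lp ℝ ∞ μ := fun i =>
    indicatorConstLp ∞ (hEm i) (measure_ne_top μ _) (1 : ℝ) with hg
  have hgE : ∀ i, g i =ᵐ[μ] (E i).indicator fun _ => (1 : ℝ) := fun i => indicatorConstLp_coeFn
  have hEd : Pairwise (Function.onFun Disjoint E) := fun i j hij =>
    (hDd hij).mono Set.inter_subset_left Set.inter_subset_left
  obtain ⟨i, hi⟩ := hK (fun i => T (S (c i)) + (2 : ℝ) • T (g i))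
    (pieces_bound T S hT8 hS9 c hc g E hgE hEd)
  set w : SeqE := T (S (c i)) + (2 : ℝ) • T (g i) with hw
  have hw88 : ‖w‖ ≤ 88 := seq_norm_le (by norm_num) fun n =>
    (Finset.single_le_sum (f := fun i => |(T (S (c i)) + (2 : ℝ) • T (g i)) n|)
      (fun _ _ => abs_nonneg _) (Finset.mem_univ i)).trans
      (pieces_bound T S hT8 hS9 c hc g E hgE hEd n)
  have hwN : ∀ n < N, |w n| ≤ 1 / 1000 := by
    intro n hn
    have h1 := hi _ (Finset.mem_union_right _ (Finset.mem_image_of_mem _ (Finset.mem_range.mpr hn)))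
      1 (by simp)
    rw [one_mul, smul_apply, smul_eq_mul, abs_mul, abs_of_pos (by norm_num : (0:ℝ) < 1000)] at h1
    have h2 : |w n| = |(lp.evalCLM ℝ (fun _ : ℕ => ℝ) ∞ n) w| := rfl
    rw [h2]
    linarith
  have hEB : E i ⊆ B' := Set.inter_subset_left.trans (hDB i)
  have hc1 : ‖c i‖ ≤ 1 := seq_norm_le zero_le_one fun n =>
    (Finset.single_le_sum (f := fun i => |c i n|)
      (fun _ _ => abs_nonneg _) (Finset.mem_univ i)).trans (hc n)
  -- lower estimate for `S w` on `E i`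
  have hSw : ∀ᵐ t ∂μ, t ∈ E i → s - 1 / 1000 + 2 - (1 / 1000 + 88 / 10000) ≤ S w t := by
    have h1 : S w = S (c i) + (2 : ℝ) • g i - A w := by
      have : R w = S (c i) + (2 : ℝ) • g i := by
        rw [hw, map_add, map_smul, hRT, hRT]
      rw [← this, hRAS]; abel
    rw [h1]
    filter_upwards [P2 w hwN hw88, Lp.coeFn_sub (S (c i) + (2 : ℝ) • g i) (A w),
      Lp.coeFn_add (S (c i)) ((2 : ℝ) • g i), Lp.coeFn_smul (2 : ℝ) (g i), hgE i]
      with t h2 h3 h4 h5 h6 ht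
    rw [h3, Pi.sub_apply, h4, Pi.add_apply, h5, Pi.smul_apply, h6, Set.indicator_of_mem ht,
      smul_eq_mul]
    have h7 : s - 1 / 1000 < S (c i) t := ht.2
    have h8 := (abs_le.mp (h2 (hB'B (hEB ht)))).2
    linarith
  -- upper estimate for the far coordinates of `w`
  have hup : ∀ n, N ≤ n → 1 + |w n| ≤ ‖T‖ * (1 + 2 / 10000) := by
    intro n hn
    obtain ⟨e, he1, he2⟩ : ∃ e : ℝ, |e| = 1 ∧ |e + w n| = 1 + |w n| := by
      rcases le_total 0 (w n) with h | h
      · exact ⟨1, by simp, by rw [abs_of_nonneg h, abs_of_nonneg (by linarith)]⟩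
      · exact ⟨-1, by simp, by rw [abs_of_nonpos h, abs_of_nonpos (by linarith)]; ring⟩
    have hb : ∀ k, |(if k = n then -e else c i k)| ≤ 1 := by
      intro k; split_ifs
      · rw [abs_neg, he1]
      · exact (seq_apply_le _ k).trans hc1
    obtain ⟨c₁, hc₁⟩ := seq_exists (fun k => if k = n then -e else c i k) 1 hb
    have hc₁n : ‖c₁‖ ≤ 1 := seq_norm_le zero_le_one fun k => by rw [hc₁]; exact hb k
    obtain ⟨c₂, h21, h2y, h2c⟩ := patch c₁ hc₁n
    have hSc : S c₂ = S (c i) := kill_finite S hSe (n + 1) _ _ (fun k hk => by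
      rw [h2c k (by omega), hc₁]; simp [show k ≠ n by omega])
    have hTF : T (A c₂ - (2 : ℝ) • g i) = c₂ - w := by
      have : A c₂ = R c₂ - S (c i) := by rw [hRAS, hSc]; abel
      rw [this, hw, map_sub, map_sub, hTR, map_smul]; abel
    have hFn : ‖A c₂ - (2 : ℝ) • g i‖ ≤ 1 + 2 / 10000 := by
      refine Linf_norm_le (by norm_num) ?_
      filter_upwards [P1 c₂ h21 h2y, Linf_ae_le (A c₂), Lp.coeFn_sub (A c₂) ((2 : ℝ) • g i),
        Lp.coeFn_smul (2 : ℝ) (g i), hgE i] with t h1 h2 h3 h4 h5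
      have h6 := abs_le.mp (h2.trans (hA' c₂ h21))
      rw [h3, Pi.sub_apply, h4, Pi.smul_apply, h5, smul_eq_mul]
      by_cases ht : t ∈ E i
      · rw [Set.indicator_of_mem ht, abs_le]
        have := h1 (hB'B (hEB ht))
        constructor <;> linarith
      · rw [Set.indicator_of_notMem ht, abs_le]
        constructor <;> linarith
    have h1 : |(T (A c₂ - (2 : ℝ) • g i)) n| ≤ ‖T‖ * (1 + 2 / 10000) :=
      (seq_apply_le _ _).trans ((T.le_opNorm _).trans (by gcongr))
    rw [hTF, lp.coeFn_sub, Pi.sub_apply, h2c n hn, hc₁, if_pos rfl, ← abs_neg,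
      show -(-e - w n) = e + w n by ring, he2] at h1
    exact h1
  -- compare with the bad pair
  set W : ℝ := max 1 (‖T‖ * (1 + 2 / 10000) - 1) with hWdef
  have hW1 : 1 ≤ W := le_max_left _ _
  have hW0 : 0 < W := by linarith
  have hwW : ∀ n, N ≤ n → |w n| ≤ W := fun n hn =>
    (by linarith [hup n hn] : |w n| ≤ ‖T‖ * (1 + 2 / 10000) - 1).trans (le_max_right _ _)
  have hqb : ∀ n, |(if n < N then 0 else W⁻¹)| ≤ 1 := by
    intro n; split_ifs
    · simp
    · rw [abs_of_pos (by positivity)]; exact inv_le_one_of_one_le₀ hW1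
  obtain ⟨q, hq⟩ := seq_exists (fun n => if n < N then 0 else W⁻¹) 1 hqb
  have hq1 : ‖q‖ ≤ 1 := seq_norm_le zero_le_one fun n => by rw [hq]; exact hqb n
  have hx1 : ‖q * w‖ ≤ 1 := by
    refine seq_norm_le zero_le_one fun n => ?_
    rw [seq_mul_apply, hq]
    split_ifs with hn
    · simp
    · rw [abs_mul, abs_of_pos (by positivity : 0 < W⁻¹), inv_mul_le_iff₀ hW0, mul_one]
      exact hwW n (not_lt.mp hn)
  have hxs : SmallFor Λ (q * w) := by
    intro l hl a ha
    rw [← mul_assoc]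
    refine hi l (Finset.mem_union_left _ hl) (a * q) ?_
    exact (norm_mul_le _ _).trans (mul_le_one₀ ha (norm_nonneg _) hq1)
  have hnull : μ (B' ∩ {t | s + 1 / 1000 < S (q * w) t}) = 0 := by
    by_contra hne
    exact hbad ⟨q * w, hx1, hxs, hne⟩
  have hSx : S (q * w) = W⁻¹ • S w := by
    rw [← map_smul]
    refine kill_finite S hSe N _ _ fun n hn => ?_
    rw [seq_mul_apply, hq, if_neg (not_lt.mpr hn)]; rfl
  obtain ⟨t, ht, ⟨h1, h2⟩, h3⟩ := exists_of_ae
    (((measure_eq_zero_iff_ae_notMem.mp hnull).and hSw).and (Lp.coeFn_smul W⁻¹ (S w))) (hcp i)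
  have h4 := h2 ht
  have h5 : S (q * w) t ≤ s + 1 / 1000 := by
    by_contra hlt
    exact h1 ⟨hEB ht, not_le.mp hlt⟩
  rw [hSx, h3, Pi.smul_apply, smul_eq_mul, inv_mul_le_iff₀ hW0] at h5
  have h6 : s + 2 - 118 / 10000 ≤ W * (s + 1 / 1000) := by
    norm_num at h4 h5 ⊢; linarith
  clear_value W
  -- final arithmetic
  have hu : 0 < s + 1 / 1000 := by
    by_contra hneg
    nlinarith
  have hWe : W = ‖T‖ * (1 + 2 / 10000) - 1 := by
    rcases max_choice 1 (‖T‖ * (1 + 2 / 10000) - 1) with h | h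
    · rw [h] at hWdef; rw [hWdef] at h6; linarith
    · rw [hWdef, h]
  rw [hWe] at h6
  generalize ‖T‖ = M at *
  generalize ‖R‖ = r at *
  obtain ⟨u, rfl⟩ : ∃ u, s = u - 1 / 1000 := ⟨s + 1 / 1000, by ring⟩
  have hu : 0 < u := by linarith
  have h7 : 2 * u + 1.98 ≤ M * 1.0002 * u := by norm_num at h6 ⊢; nlinarith
  have h8 : u + 0.99 ≤ r := by norm_num at hRs ⊢; linarith
  have h9 : (2 * u + 1.98) * (u + 0.99) ≤ M * 1.0002 * u * r :=
    mul_le_mul h7 h8 (by positivity) (by positivity)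
  have h10 : M * 1.0002 * u * r ≤ 7.41 * 1.0002 * u := by
    have : M * r * u ≤ 7.41 * u := by gcongr
    linarith
  norm_num at h9 h10
  nlinarith [sq_nonneg (u - 1)]
end

section
variable {Ω : Type*} [MeasurableSpace Ω] {μ : Measure Ω} [IsFiniteMeasure μ]

theorem summable_aux {g : ℕ → ℝ} {a : ℝ} (h : ∀ m, ∑ n ∈ Finset.range m, |g n| ≤ a) :
    Summable fun n => |g n| :=
  summable_of_sum_range_le (fun n => abs_nonneg _) h

theorem summable_mul_aux {g : ℕ → ℝ} (h : Summable fun n => |g n|) (c : SeqE) :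
    Summable fun n => |c n * g n| := by
  refine Summable.of_nonneg_of_le (fun n => abs_nonneg _) (fun n => ?_) (h.mul_left ‖c‖)
  rw [abs_mul]
  exact mul_le_mul_of_nonneg_right (seq_apply_le c n) (abs_nonneg _)

theorem exists_series_op (f : ℕ → Lp ℝ ∞ μ)
    (h : ∀ᵐ t ∂μ, ∀ m, ∑ n ∈ Finset.range m, |f n t| ≤ 1) :
    ∃ A : SeqE →L[ℝ] Lp ℝ ∞ μ, ‖A‖ ≤ 1 ∧ ∀ c, A c =ᵐ[μ] fun t => ∑' n, c n * f n t := by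
  have hbd : ∀ c : SeqE, ∀ᵐ t ∂μ, |∑' n, c n * f n t| ≤ ‖c‖ := by
    intro c
    filter_upwards [h] with t ht
    have hs := summable_aux ht
    have hs2 := summable_mul_aux hs c
    have h1 : |∑' n, c n * f n t| ≤ ∑' n, |c n * f n t| := by
      have := norm_tsum_le_tsum_norm (f := fun n => c n * f n t) hs2
      exact this
    refine h1.trans ?_
    calc ∑' n, |c n * f n t| ≤ ∑' n, ‖c‖ * |f n t| := by
          refine hs2.tsum_le_tsum (fun n => ?_) (hs.mul_left ‖c‖)
          rw [abs_mul]
          exact mul_le_mul_of_nonneg_right (seq_apply_le c n) (abs_nonneg _)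
      _ = ‖c‖ * ∑' n, |f n t| := tsum_mul_left
      _ ≤ ‖c‖ * 1 := by
          gcongr
          exact Real.tsum_le_of_sum_range_le (fun n => abs_nonneg _) ht
      _ = ‖c‖ := mul_one _
  have hmeas : ∀ c : SeqE, AEStronglyMeasurable (fun t => ∑' n, c n * f n t) μ := by
    intro c
    refine aestronglyMeasurable_of_tendsto_ae (u := Filter.atTop)
      (f := fun m t => ∑ n ∈ Finset.range m, c n * f n t) ?_ ?_
    · intro m
      refine Finset.aestronglyMeasurable_fun_sum _ fun n _ => ?_
      exact (Lp.aestronglyMeasurable (f n)).const_mul _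
    · filter_upwards [h] with t ht
      exact (summable_mul_aux (summable_aux ht) c).of_abs.hasSum.tendsto_sum_nat
  have hmem : ∀ c : SeqE, MemLp (fun t => ∑' n, c n * f n t) ∞ μ := fun c =>
    memLp_top_of_bound (hmeas c) ‖c‖ (hbd c)
  refine ⟨LinearMap.mkContinuous
    { toFun := fun c => (hmem c).toLp _
      map_add' := fun c d => ?_
      map_smul' := fun a c => ?_ } 1 ?_, ?_, fun c => ?_⟩
  · apply Lp.ext
    filter_upwards [h, (hmem (c + d)).coeFn_toLp, (hmem c).coeFn_toLp, (hmem d).coeFn_toLp,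
      Lp.coeFn_add ((hmem c).toLp _) ((hmem d).toLp _)] with t ht h1 h2 h3 h4
    rw [h1, h4, Pi.add_apply, h2, h3]
    rw [← (summable_mul_aux (summable_aux ht) c).of_abs.tsum_add
      (summable_mul_aux (summable_aux ht) d).of_abs]
    congr 1
    ext n
    rw [lp.coeFn_add, Pi.add_apply, add_mul]
  · apply Lp.ext
    filter_upwards [h, (hmem (a • c)).coeFn_toLp, (hmem c).coeFn_toLp,
      Lp.coeFn_smul a ((hmem c).toLp _)] with t ht h1 h2 h4
    simp only [RingHom.id_apply]
    rw [h1, h4, Pi.smul_apply, h2, smul_eq_mul, ← tsum_mul_left]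
    congr 1
    ext n
    rw [lp.coeFn_smul, Pi.smul_apply, smul_eq_mul, mul_assoc]
  · intro c
    rw [one_mul]
    refine Linf_norm_le (norm_nonneg _) ?_
    filter_upwards [hbd c, (hmem c).coeFn_toLp] with t h1 h2
    change |((hmem c).toLp _ : Lp ℝ ∞ μ) t| ≤ _
    rw [h2]; exact h1
  · exact LinearMap.mkContinuous_norm_le _ zero_le_one _
  · exact (hmem c).coeFn_toLp

theorem Lp_sum_ae {ι : Type*} (s : Finset ι) (f : ι → Lp ℝ ∞ μ) :
    ∀ᵐ t ∂μ, (∑ i ∈ s, f i : Lp ℝ ∞ μ) t = ∑ i ∈ s, f i t := by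
  classical
  induction s using Finset.induction_on with
  | empty =>
    filter_upwards [Lp.coeFn_zero ℝ ∞ μ] with t ht
    simp only [Finset.sum_empty]
    rw [ht]; rfl
  | insert a s ha ih =>
    rw [Finset.sum_insert ha]
    filter_upwards [ih, Lp.coeFn_add (f a) (∑ i ∈ s, f i)] with t h1 h2
    rw [h2, Pi.add_apply, h1, Finset.sum_insert ha]

theorem partial_bound (R : SeqE →L[ℝ] Lp ℝ ∞ μ) :
    ∀ᵐ t ∂μ, ∀ m, ∑ n ∈ Finset.range m, |R (lp.single ∞ n (1 : ℝ)) t| ≤ ‖R‖ := by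
  classical
  have key : ∀ p : ℕ × Finset ℕ, ∀ᵐ t ∂μ,
      ∑ n ∈ Finset.range p.1, (if n ∈ p.2 then (1 : ℝ) else -1) * R (lp.single ∞ n (1 : ℝ)) t
        ≤ ‖R‖ := by
    rintro ⟨m, S⟩
    set x : SeqE := ∑ n ∈ Finset.range m, (if n ∈ S then (1 : ℝ) else -1) • lp.single ∞ n (1 : ℝ)
      with hx
    have hxn : ‖x‖ ≤ 1 := by
      refine seq_norm_le zero_le_one fun k => ?_
      rw [hx, seq_sum_apply]
      have : ∀ n ∈ Finset.range m, ((if n ∈ S then (1 : ℝ) else -1) •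
          (lp.single ∞ n (1 : ℝ) : SeqE)) k =
          if k = n then (if k ∈ S then (1 : ℝ) else -1) else 0 := by
        intro n _
        rw [lp.coeFn_smul, Pi.smul_apply, lp.coeFn_single, Pi.single_apply, smul_eq_mul]
        split_ifs <;> simp_all
      rw [Finset.sum_congr rfl this, Finset.sum_ite_eq]
      split_ifs <;> simp
    have hRx : R x = ∑ n ∈ Finset.range m, R ((if n ∈ S then (1 : ℝ) else -1) • lp.single ∞ n (1 : ℝ)) := by
      rw [hx, map_sum]
    have hle : ‖R x‖ ≤ ‖R‖ := (R.le_opNorm x).trans (mul_le_of_le_one_right (norm_nonneg _) hxn)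
    have hsm : ∀ᵐ t ∂μ, ∀ n, R ((if n ∈ S then (1 : ℝ) else -1) • lp.single ∞ n (1 : ℝ)) t =
        (if n ∈ S then (1 : ℝ) else -1) * R (lp.single ∞ n (1 : ℝ)) t := by
      rw [ae_all_iff]
      intro n
      rw [map_smul]
      filter_upwards [Lp.coeFn_smul (if n ∈ S then (1 : ℝ) else -1)
        (R (lp.single ∞ n (1 : ℝ)))] with t ht
      rw [ht]; rfl
    filter_upwards [Linf_ae_le (R x), hsm, Lp_sum_ae (Finset.range m)
      (fun n => R ((if n ∈ S then (1 : ℝ) else -1) • lp.single ∞ n (1 : ℝ)))] with t h1 h2 h3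
    rw [hRx, h3] at h1
    simp only [h2] at h1
    rw [← hRx] at h1
    exact (le_abs_self _).trans (h1.trans hle)
  filter_upwards [ae_all_iff.2 key] with t ht m
  refine le_trans (le_of_eq ?_) (ht (m, (Finset.range m).filter
    fun n => 0 ≤ R (lp.single ∞ n (1 : ℝ)) t))
  refine Finset.sum_congr rfl fun n hn => ?_
  by_cases h0 : 0 ≤ R (lp.single ∞ n (1 : ℝ)) t
  · rw [if_pos (Finset.mem_filter.2 ⟨hn, h0⟩), abs_of_nonneg h0, one_mul]
  · have hh : n ∉ (Finset.range m).filter fun n => 0 ≤ R (lp.single ∞ n (1 : ℝ)) t :=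
      fun h => h0 (Finset.mem_filter.1 h).2
    rw [if_neg hh, abs_of_neg (not_le.1 h0)]; ring

theorem tail_split {g : ℕ → ℝ} (h : ∀ m, ∑ n ∈ Finset.range m, |g n| ≤ 1) (N : ℕ) (c : SeqE)
    (hN : 1 - 1 / 10000 < ∑ n ∈ Finset.range N, |g n|) :
    |∑' n, c n * g n - ∑ n ∈ Finset.range N, c n * g n| ≤ ‖c‖ * (1 / 10000) := by
  have hs := summable_aux h
  have hs2 := summable_mul_aux hs c
  have h1 := hs.sum_add_tsum_nat_add N
  have h2 := hs2.of_abs.sum_add_tsum_nat_add N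
  have h3 : ∑' n, |g n| ≤ 1 := Real.tsum_le_of_sum_range_le (fun n => abs_nonneg _) h
  have h4 : ∑' n, c n * g n - ∑ n ∈ Finset.range N, c n * g n = ∑' i, c (i + N) * g (i + N) := by
    rw [← h2]; ring
  rw [h4]
  have hs3 := (summable_nat_add_iff N).2 hs2
  have hs4 := (summable_nat_add_iff N).2 hs
  have h5 : |∑' i, c (i + N) * g (i + N)| ≤ ∑' i, |c (i + N) * g (i + N)| :=
    norm_tsum_le_tsum_norm (f := fun i => c (i + N) * g (i + N)) hs3
  refine h5.trans ?_
  calc ∑' i, |c (i + N) * g (i + N)| ≤ ∑' i, ‖c‖ * |g (i + N)| := by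
        refine hs3.tsum_le_tsum (fun n => ?_) (hs4.mul_left ‖c‖)
        rw [abs_mul]
        exact mul_le_mul_of_nonneg_right (seq_apply_le c _) (abs_nonneg _)
    _ = ‖c‖ * ∑' i, |g (i + N)| := tsum_mul_left
    _ ≤ _ := by
        gcongr
        linarith

theorem exists_alpha (f : ℕ → Lp ℝ ∞ μ) (C : ℝ) (hC : 0 ≤ C)
    (h : ∀ᵐ t ∂μ, ∀ m, ∑ n ∈ Finset.range m, |f n t| ≤ C) (h0 : f 0 ≠ 0) :
    ∃ a : ℝ, 0 < a ∧ (∀ᵐ t ∂μ, ∀ m, ∑ n ∈ Finset.range m, |f n t| ≤ a) ∧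
      ∀ b < a, 0 ≤ b → ¬ ∀ᵐ t ∂μ, ∀ m, ∑ n ∈ Finset.range m, |f n t| ≤ b := by
  set X : Set ℝ := {a | 0 ≤ a ∧ ∀ᵐ t ∂μ, ∀ m, ∑ n ∈ Finset.range m, |f n t| ≤ a} with hX
  have hne : X.Nonempty := ⟨C, hC, h⟩
  have hbdd : BddBelow X := ⟨0, fun a ha => ha.1⟩
  have hatt : ∀ᵐ t ∂μ, ∀ m, ∑ n ∈ Finset.range m, |f n t| ≤ sInf X := by
    have h1 : ∀ k : ℕ, ∀ᵐ t ∂μ, ∀ m, ∑ n ∈ Finset.range m, |f n t| ≤ sInf X + 1 / (k + 1) := by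
      intro k
      obtain ⟨a, ha, hlt⟩ := exists_lt_of_csInf_lt hne
        (lt_add_of_pos_right (sInf X) (Nat.one_div_pos_of_nat (α := ℝ) (n := k)))
      filter_upwards [ha.2] with t ht m
      exact (ht m).trans hlt.le
    filter_upwards [ae_all_iff.2 h1] with t ht m
    refine le_of_forall_pos_le_add fun e he => ?_
    obtain ⟨k, hk⟩ := exists_nat_one_div_lt he
    linarith [ht k m]
  refine ⟨sInf X, ?_, hatt, fun b hb hb0 hcon => ?_⟩
  · rcases (le_csInf hne (fun a ha => ha.1) : 0 ≤ sInf X).lt_or_eq with h2 | h2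
    · exact h2
    · exfalso
      apply h0
      rw [← norm_le_zero_iff]
      refine Linf_norm_le le_rfl ?_
      filter_upwards [hatt] with t ht
      have := ht 1
      rw [← h2] at this
      simpa using this
  · exact absurd (csInf_le hbdd ⟨hb0, hcon⟩) (not_le.2 hb)

end

section
variable {Ω : Type*} [MeasurableSpace Ω] {μ : Measure Ω} [IsFiniteMeasure μ]

theorem normalized (T : Lp ℝ ∞ μ →L[ℝ] SeqE) (R : SeqE →L[ℝ] Lp ℝ ∞ μ)
    (hTR : ∀ x, T (R x) = x) (hRT : ∀ f, R (T f) = f)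
    (h1 : ∀ᵐ t ∂μ, ∀ m, ∑ n ∈ Finset.range m, |R (lp.single ∞ n (1 : ℝ)) t| ≤ 1)
    (h2 : ¬ ∀ᵐ t ∂μ, ∀ m, ∑ n ∈ Finset.range m, |R (lp.single ∞ n (1 : ℝ)) t| ≤ 1 - 1 / 10000)
    (hsplit : ∀ (K : ℕ) (B : Set Ω), MeasurableSet B → μ B ≠ 0 →
      ∃ D : Fin K → Set Ω, (∀ i, MeasurableSet (D i)) ∧ (∀ i, μ (D i) ≠ 0) ∧ (∀ i, D i ⊆ B) ∧
      Pairwise (Function.onFun Disjoint D)) :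
    (7.41 : ℝ) ≤ ‖T‖ * ‖R‖ := by
  classical
  set f : ℕ → Lp ℝ ∞ μ := fun n => R (lp.single ∞ n (1 : ℝ)) with hf
  have hfm : ∀ n, Measurable (f n) := fun n => (Lp.stronglyMeasurable (f n)).measurable
  obtain ⟨A, hA, hAc⟩ := exists_series_op f h1
  have hex : ∃ p : ℕ × Finset ℕ, μ {t | 1 - 1 / 10000 < ∑ n ∈ Finset.range p.1, |f n t| ∧
      ∀ n ∈ Finset.range p.1, (n ∈ p.2 ↔ 0 ≤ f n t)} ≠ 0 := by
    by_contra hcon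
    push Not at hcon
    apply h2
    have h3 : ∀ p : ℕ × Finset ℕ, ∀ᵐ t ∂μ, ¬ (1 - 1 / 10000 < ∑ n ∈ Finset.range p.1, |f n t| ∧
      ∀ n ∈ Finset.range p.1, (n ∈ p.2 ↔ 0 ≤ f n t)) := fun p =>
      measure_eq_zero_iff_ae_notMem.1 (hcon p)
    filter_upwards [ae_all_iff.2 h3] with t ht m
    by_contra hm
    refine ht (m, (Finset.range m).filter fun n => 0 ≤ f n t) ⟨not_le.1 hm, fun n hn => ?_⟩
    rw [Finset.mem_filter]
    exact ⟨fun h => h.2, fun h => ⟨hn, h⟩⟩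
  obtain ⟨⟨N, S⟩, hBp⟩ := hex
  simp only at hBp
  set B : Set Ω := {t | 1 - 1 / 10000 < ∑ n ∈ Finset.range N, |f n t| ∧
      ∀ n ∈ Finset.range N, (n ∈ S ↔ 0 ≤ f n t)} with hBdef
  have hB : MeasurableSet B := by
    refine MeasurableSet.inter ?_ ?_
    · exact measurableSet_lt measurable_const
        (Finset.measurable_fun_sum _ fun n _ => (hfm n).abs)
    · have : {t | ∀ n ∈ Finset.range N, (n ∈ S ↔ 0 ≤ f n t)} =
          ⋂ n ∈ Finset.range N, {t | n ∈ S ↔ 0 ≤ f n t} := by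
        ext t; simp
      change MeasurableSet {t | ∀ n ∈ Finset.range N, (n ∈ S ↔ 0 ≤ f n t)}
      rw [this]
      refine Finset.measurableSet_biInter _ fun n _ => ?_
      have hm : MeasurableSet {t | 0 ≤ f n t} := measurableSet_le measurable_const (hfm n)
      by_cases hn : n ∈ S
      · simpa [hn] using hm
      · have he : {t | n ∈ S ↔ 0 ≤ f n t} = {t | 0 ≤ f n t}ᶜ := by
          ext t
          change (n ∈ S ↔ 0 ≤ f n t) ↔ ¬ (0 ≤ f n t)
          tauto
        rw [he]
        exact hm.compl
  obtain ⟨y, hy⟩ := seq_exists (fun n => if n < N then (if n ∈ S then (1 : ℝ) else -1) else 0) 1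
    (fun n => by split_ifs <;> simp)
  refine core T R A hTR hRT hA ?_ B hB hBp N y ?_ ?_ ?_ ?_ hsplit
  · intro n
    apply Lp.ext
    filter_upwards [hAc (lp.single ∞ n (1 : ℝ))] with t ht
    rw [ht, tsum_eq_single n]
    · rw [lp.coeFn_single, Pi.single_eq_same, one_mul]
    · intro k hk
      rw [lp.coeFn_single, Pi.single_eq_of_ne hk, zero_mul]
  · refine seq_norm_le zero_le_one fun n => ?_
    rw [hy]
    split_ifs <;> simp
  · intro n hn
    rw [hy, if_neg (not_lt.2 hn)]
  · intro c hc hcy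
    filter_upwards [h1, hAc c] with t ht hct htB
    rw [hct]
    have h3 := tail_split ht N c htB.1
    have h4 : ∑ n ∈ Finset.range N, c n * f n t = ∑ n ∈ Finset.range N, |f n t| := by
      refine Finset.sum_congr rfl fun n hn => ?_
      have hn' := Finset.mem_range.1 hn
      rw [hcy n hn', hy, if_pos hn']
      by_cases hS : n ∈ S
      · rw [if_pos hS, abs_of_nonneg ((htB.2 n hn).1 hS), one_mul]
      · rw [if_neg hS, abs_of_neg (not_le.1 fun h => hS ((htB.2 n hn).2 h))]; ring
    have h5 := htB.1
    have h6 := (abs_le.1 h3).1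
    change -_ ≤ ∑' n, c n * f n t - ∑ n ∈ Finset.range N, c n * f n t at h6
    rw [h4] at h6
    linarith
  · intro c hcN hc
    filter_upwards [h1, hAc c] with t ht hct htB
    rw [hct]
    have h3 := tail_split ht N c htB.1
    change |∑' n, c n * f n t - ∑ n ∈ Finset.range N, c n * f n t| ≤ _ at h3
    have h4 : |∑ n ∈ Finset.range N, c n * f n t| ≤ 1 / 1000 := by
      refine (Finset.abs_sum_le_sum_abs _ _).trans ?_
      calc ∑ n ∈ Finset.range N, |c n * f n t| ≤ ∑ n ∈ Finset.range N, 1 / 1000 * |f n t| := by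
            refine Finset.sum_le_sum fun n hn => ?_
            rw [abs_mul]
            exact mul_le_mul_of_nonneg_right (hcN n (Finset.mem_range.1 hn)) (abs_nonneg _)
        _ = 1 / 1000 * ∑ n ∈ Finset.range N, |f n t| := by rw [Finset.mul_sum]
        _ ≤ 1 / 1000 * 1 := by
            gcongr
            exact ht N
        _ = 1 / 1000 := mul_one _
    have h5 := abs_le.1 h3
    have h6 := abs_le.1 h4
    rw [abs_le]
    constructor <;> linarith

theorem main_aux (T : Lp ℝ ∞ μ →L[ℝ] SeqE) (R : SeqE →L[ℝ] Lp ℝ ∞ μ)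
    (hTR : ∀ x, T (R x) = x) (hRT : ∀ f, R (T f) = f)
    (hsplit : ∀ (K : ℕ) (B : Set Ω), MeasurableSet B → μ B ≠ 0 →
      ∃ D : Fin K → Set Ω, (∀ i, MeasurableSet (D i)) ∧ (∀ i, μ (D i) ≠ 0) ∧ (∀ i, D i ⊆ B) ∧
      Pairwise (Function.onFun Disjoint D)) :
    (7.41 : ℝ) ≤ ‖T‖ * ‖R‖ := by
  have h0 : R (lp.single ∞ 0 (1 : ℝ)) ≠ 0 := by
    intro h
    have h1 := hTR (lp.single ∞ 0 (1 : ℝ))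
    rw [h, map_zero] at h1
    have h2 : ‖(lp.single ∞ 0 (1 : ℝ) : SeqE)‖ = 1 := by
      rw [lp.norm_single (by simp)]; simp
    rw [← h1, norm_zero] at h2
    exact zero_ne_one h2
  obtain ⟨a, ha, hle, hlt⟩ := exists_alpha (fun n => R (lp.single ∞ n (1 : ℝ))) ‖R‖ (norm_nonneg _)
    (partial_bound R) h0
  have hne := ha.ne'
  have hsm : ∀ᵐ t ∂μ, ∀ n, (a⁻¹ • R) (lp.single ∞ n (1 : ℝ)) t =
      a⁻¹ * R (lp.single ∞ n (1 : ℝ)) t := by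
    rw [ae_all_iff]
    intro n
    rw [smul_apply]
    filter_upwards [Lp.coeFn_smul a⁻¹ (R (lp.single ∞ n (1 : ℝ)))] with t ht
    rw [ht]; rfl
  have hsum : ∀ᵐ t ∂μ, ∀ m, ∑ n ∈ Finset.range m, |(a⁻¹ • R) (lp.single ∞ n (1 : ℝ)) t| =
      a⁻¹ * ∑ n ∈ Finset.range m, |R (lp.single ∞ n (1 : ℝ)) t| := by
    filter_upwards [hsm] with t ht m
    rw [Finset.mul_sum]
    refine Finset.sum_congr rfl fun n _ => ?_
    rw [ht n, abs_mul, abs_of_pos (inv_pos.2 ha)]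
  have key := normalized (a • T) (a⁻¹ • R) ?_ ?_ ?_ ?_ hsplit
  · rw [norm_smul, norm_smul, norm_inv] at key
    have : ‖a‖ ≠ 0 := norm_ne_zero_iff.2 hne
    calc (7.41 : ℝ) ≤ _ := key
      _ = ‖T‖ * ‖R‖ := by field_simp
  · intro x
    rw [smul_apply, smul_apply, map_smul, smul_smul, mul_inv_cancel₀ hne, one_smul, hTR]
  · intro g
    rw [smul_apply, smul_apply, map_smul, smul_smul, inv_mul_cancel₀ hne, one_smul, hRT]
  · filter_upwards [hsum, hle] with t h1 h2 m
    rw [h1, inv_mul_le_iff₀ ha, mul_one]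
    exact h2 m
  · intro hcon
    refine hlt (a * (1 - 1 / 10000)) (by linarith) (by linarith) ?_
    filter_upwards [hsum, hcon] with t h1 h2 m
    have := h2 m
    rwa [h1, inv_mul_le_iff₀ ha] at this

end

/-- Every continuous linear equivalence between `L∞[0,1]` and `ℓ∞` has distortion
at least `7.41`; i.e. `d_BM(L∞[0,1], ℓ∞) ≥ 7.41`. -/
theorem banachMazur_Linfty_linfty_lower_bound
    (T : Lp ℝ ∞ (volume.restrict (Set.Icc (0:ℝ) 1)) ≃L[ℝ] lp (fun _ : ℕ => ℝ) ∞) :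
    (7.41 : ℝ) ≤
      ‖(T : Lp ℝ ∞ (volume.restrict (Set.Icc (0:ℝ) 1)) →L[ℝ] lp (fun _ : ℕ => ℝ) ∞)‖ *
        ‖(T.symm : lp (fun _ : ℕ => ℝ) ∞ →L[ℝ] Lp ℝ ∞ (volume.restrict (Set.Icc (0:ℝ) 1)))‖ := by
  refine main_aux _ _ (fun x => ?_) (fun f => ?_) (fun K B => split K B)
  · simp
  · simp
end

section
/- There exists a continuous linear equivalence T : ℓ∞ ≃ L∞[0,1] with ‖T‖·‖T⁻¹‖ ≤ (3 + √2)². Equivalently, the Banach–Mazur distance of ℓ∞ and L∞[0,1] is at most (3 + √2)². -/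
open MeasureTheory ENNReal
open scoped Topology

/-- `X` behaves like `ℓ∞(X)` through the coordinate maps `π n`. -/
structure Glue {X : Type*} [NormedAddCommGroup X] [NormedSpace ℝ X] (π : ℕ → X →ₗ[ℝ] X) : Prop where
  le : ∀ n x, ‖π n x‖ ≤ ‖x‖
  ex : ∀ (w : ℕ → X) (C : ℝ), (∀ n, ‖w n‖ ≤ C) → ∃ x, ‖x‖ ≤ C ∧ ∀ n, π n x = w n
  inj : ∀ x, (∀ n, π n x = 0) → x = 0

section abs
variable {X Y V : Type*} [NormedAddCommGroup X] [NormedSpace ℝ X]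
  [NormedAddCommGroup Y] [NormedSpace ℝ Y] [NormedAddCommGroup V] [NormedSpace ℝ V]

theorem Glue.ext {π : ℕ → X →ₗ[ℝ] X} (h : Glue π) {x y : X} (e : ∀ n, π n x = π n y) : x = y := by
  apply sub_eq_zero.1
  apply h.inj
  intro n
  rw [map_sub, e, sub_self]

theorem Glue.map {π : ℕ → X →ₗ[ℝ] X} (h : Glue π) (L : ℕ → V →ₗ[ℝ] X) (C : ℝ)
    (hL : ∀ n v, ‖L n v‖ ≤ C * ‖v‖) :
    ∃ G : V →ₗ[ℝ] X, (∀ v, ‖G v‖ ≤ C * ‖v‖) ∧ ∀ n v, π n (G v) = L n v := by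
  choose g hg1 hg2 using fun v : V => h.ex (fun n => L n v) (C * ‖v‖) (fun n => hL n v)
  refine ⟨{ toFun := g, map_add' := ?_, map_smul' := ?_ }, hg1, fun n v => hg2 v n⟩
  · intro a b
    apply h.ext
    intro n
    simp [hg2]
  · intro a b
    apply h.ext
    intro n
    simp [hg2]

theorem abstract_bm {π : ℕ → X →ₗ[ℝ] X} (hX : Glue π) {ρ : ℕ → Y →ₗ[ℝ] Y} (hY : Glue ρ)
    (i : Y →ₗ[ℝ] X) (q : X →ₗ[ℝ] Y) (j : X →ₗ[ℝ] Y) (p : Y →ₗ[ℝ] X)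
    (hi : ∀ y, ‖i y‖ ≤ ‖y‖) (hq : ∀ x, ‖q x‖ ≤ ‖x‖) (hj : ∀ x, ‖j x‖ ≤ ‖x‖)
    (hp : ∀ y, ‖p y‖ ≤ ‖y‖) (hqi : ∀ y, q (i y) = y) (hpj : ∀ x, p (j x) = x) :
    ∃ T : X ≃L[ℝ] Y, ‖(T : X →L[ℝ] Y)‖ * ‖(T.symm : Y →L[ℝ] X)‖ ≤ (3 + Real.sqrt 2) ^ 2 := by
  set s := Real.sqrt 2 with hs
  have hs2 : s * s = 2 := Real.mul_self_sqrt (by norm_num)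
  have hs1 : 1 ≤ s := by rw [hs]; exact Real.one_le_sqrt.2 (by norm_num)
  have hss : s ≤ 2 := by nlinarith
  have b1 : (s - 1) * (s + 1) = 1 := by linarith
  have nP : ∀ x, ‖i (q x)‖ ≤ ‖x‖ := fun x => (hi _).trans (hq _)
  have nQ : ∀ y, ‖j (p y)‖ ≤ ‖y‖ := fun x => (hj _).trans (hp _)
  have nIP : ∀ x, ‖x - i (q x)‖ ≤ 2 * ‖x‖ := fun x => by
    have := norm_sub_le x (i (q x)); have := nP x; linarith
  have nIQ : ∀ x, ‖x - j (p x)‖ ≤ 2 * ‖x‖ := fun x => by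
    have := norm_sub_le x (j (p x)); have := nQ x; linarith
  have comb : ∀ {Z : Type _} [NormedAddCommGroup Z] [NormedSpace ℝ Z] (u v : Z) (c a b : ℝ),
      0 ≤ c → ‖u‖ ≤ a → ‖v‖ ≤ b → ‖u + c • v‖ ≤ a + c * b := by
    intro Z _ _ u v c a b hc hu hv
    refine (norm_add_le _ _).trans ?_
    rw [norm_smul, Real.norm_of_nonneg hc]
    gcongr
  have combY : ∀ (u v : Y) (c a b : ℝ),
      0 ≤ c → ‖u‖ ≤ a → ‖v‖ ≤ b → ‖u + c • v‖ ≤ a + c * b := by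
    intro u v c a b hc hu hv
    refine (norm_add_le _ _).trans ?_
    rw [norm_smul, Real.norm_of_nonneg hc]
    gcongr
  -- the auxiliary map on X
  obtain ⟨A, hA, hAπ⟩ := hX.map (V := X)
    (fun n => (LinearMap.id - i ∘ₗ q) ∘ₗ π n + (s - 1) • (i ∘ₗ q) ∘ₗ π (n + 1)) (2 + (s - 1) * 1) (by
      intro n x
      have h1 := (nIP (π n x)).trans (mul_le_mul_of_nonneg_left (hX.le n x) (by norm_num))
      have h2 := (nP (π (n + 1) x)).trans (hX.le (n + 1) x)
      have := comb _ _ (s - 1) _ _ (by linarith) h1 h2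
      simp only [LinearMap.add_apply, LinearMap.comp_apply, LinearMap.sub_apply, LinearMap.id_apply,
        LinearMap.smul_apply]
      linarith)
  -- the map to `y` in the inverse
  obtain ⟨B, hB, hBπ⟩ := hY.map (V := Y)
    (fun n => (LinearMap.id - j ∘ₗ p) ∘ₗ ρ n + (s - 1) • (j ∘ₗ p) ∘ₗ ρ (n + 1)) (2 + (s - 1) * 1) (by
      intro n x
      have h1 := (nIQ (ρ n x)).trans (mul_le_mul_of_nonneg_left (hY.le n x) (by norm_num))
      have h2 := (nQ (ρ (n + 1) x)).trans (hY.le (n + 1) x)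
      have := combY _ _ (s - 1) _ _ (by linarith) h1 h2
      simp only [LinearMap.add_apply, LinearMap.comp_apply, LinearMap.sub_apply, LinearMap.id_apply,
        LinearMap.smul_apply]
      linarith)
  -- forward
  obtain ⟨T, hT, hTρ⟩ := hY.map (V := X)
    (fun n => Nat.casesOn n (j ∘ₗ A + (LinearMap.id - j ∘ₗ p) ∘ₗ ρ 0 ∘ₗ q ∘ₗ π 0)
      (fun m => (LinearMap.id - j ∘ₗ p) ∘ₗ ρ (m + 1) ∘ₗ q ∘ₗ π 0 +
        (s + 1) • (j ∘ₗ p) ∘ₗ ρ m ∘ₗ q ∘ₗ π 0)) (3 + s) (by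
      intro n x
      have hy : ∀ m, ‖ρ m (q (π 0 x))‖ ≤ ‖x‖ := fun m =>
        (hY.le _ _).trans ((hq _).trans (hX.le _ _))
      have h1 : ∀ m, ‖ρ m (q (π 0 x)) - j (p (ρ m (q (π 0 x))))‖ ≤ 2 * ‖x‖ := fun m =>
        (nIQ _).trans (mul_le_mul_of_nonneg_left (hy m) (by norm_num))
      have h2 : ∀ m, ‖j (p (ρ m (q (π 0 x))))‖ ≤ ‖x‖ := fun m => (nQ _).trans (hy m)
      cases n with
      | zero =>
        have h3 := (hj (A x)).trans (hA x)
        have := norm_add_le (j (A x)) (ρ 0 (q (π 0 x)) - j (p (ρ 0 (q (π 0 x)))))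
        have := h1 0
        change ‖j (A x) + (ρ 0 (q (π 0 x)) - j (p (ρ 0 (q (π 0 x)))))‖ ≤ _
        linarith
      | succ m =>
        have := combY _ _ (s + 1) _ _ (by linarith) (h1 (m + 1)) (h2 m)
        simp only [LinearMap.add_apply, LinearMap.comp_apply, LinearMap.sub_apply,
          LinearMap.id_apply, LinearMap.smul_apply]
        linarith)
  -- backward
  obtain ⟨S, hS, hSπ⟩ := hX.map (V := Y)
    (fun n => Nat.casesOn n (i ∘ₗ B + (LinearMap.id - i ∘ₗ q) ∘ₗ π 0 ∘ₗ p ∘ₗ ρ 0)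
      (fun m => (LinearMap.id - i ∘ₗ q) ∘ₗ π (m + 1) ∘ₗ p ∘ₗ ρ 0 +
        (s + 1) • (i ∘ₗ q) ∘ₗ π m ∘ₗ p ∘ₗ ρ 0)) (3 + s) (by
      intro n x
      have hy : ∀ m, ‖π m (p (ρ 0 x))‖ ≤ ‖x‖ := fun m =>
        (hX.le _ _).trans ((hp _).trans (hY.le _ _))
      have h1 : ∀ m, ‖π m (p (ρ 0 x)) - i (q (π m (p (ρ 0 x))))‖ ≤ 2 * ‖x‖ := fun m =>
        (nIP _).trans (mul_le_mul_of_nonneg_left (hy m) (by norm_num))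
      have h2 : ∀ m, ‖i (q (π m (p (ρ 0 x))))‖ ≤ ‖x‖ := fun m => (nP _).trans (hy m)
      cases n with
      | zero =>
        have h3 := (hi (B x)).trans (hB x)
        have := norm_add_le (i (B x)) (π 0 (p (ρ 0 x)) - i (q (π 0 (p (ρ 0 x)))))
        have := h1 0
        change ‖i (B x) + (π 0 (p (ρ 0 x)) - i (q (π 0 (p (ρ 0 x)))))‖ ≤ _
        linarith
      | succ m =>
        have := comb _ _ (s + 1) _ _ (by linarith) (h1 (m + 1)) (h2 m)
        simp only [LinearMap.add_apply, LinearMap.comp_apply, LinearMap.sub_apply,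
          LinearMap.id_apply, LinearMap.smul_apply]
        linarith)
  have hT0 : ∀ x, ρ 0 (T x) = j (A x) + (ρ 0 (q (π 0 x)) - j (p (ρ 0 (q (π 0 x))))) := fun x => hTρ 0 x
  have hT1 := fun m x => hTρ (m + 1) x
  have hS0 : ∀ x, π 0 (S x) = i (B x) + (π 0 (p (ρ 0 x)) - i (q (π 0 (p (ρ 0 x))))) := fun x => hSπ 0 x
  have hS1 := fun m x => hSπ (m + 1) x
  simp only [LinearMap.add_apply, LinearMap.comp_apply, LinearMap.sub_apply,
    LinearMap.id_apply, LinearMap.smul_apply] at hT1 hS1 hAπ hBπ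
  have b2 : (s + 1) * (s - 1) = 1 := by linarith
  -- identities
  have pT : ∀ x, p (ρ 0 (T x)) = A x := by
    intro x
    rw [hT0]; simp [hpj]
  have BT : ∀ x, B (T x) = q (π 0 x) := by
    intro x
    apply hY.ext
    intro n
    rw [hBπ, hT1]
    have : j (p (ρ n (T x))) + ρ n (q (π 0 x)) = ρ n (T x) + j (p (ρ n (q (π 0 x)))) := by
      cases n with
      | zero => rw [hT0]; simp only [map_add, map_sub, hpj]; abel
      | succ m => rw [hT1]; simp only [map_add, map_sub, map_smul, hpj]; abel
    have e : ρ n (T x) - j (p (ρ n (T x))) = ρ n (q (π 0 x)) - j (p (ρ n (q (π 0 x)))) := by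
      rw [sub_eq_sub_iff_add_eq_add, add_comm (ρ n (q _)), ← this]
    rw [e]
    simp only [map_add, map_sub, map_smul, hpj, smul_smul, b1, sub_self, zero_add, one_smul]
    abel
  have qS : ∀ y, q (π 0 (S y)) = B y := by
    intro x
    rw [hS0]; simp [hqi]
  have AS : ∀ y, A (S y) = p (ρ 0 y) := by
    intro x
    apply hX.ext
    intro n
    rw [hAπ, hS1]
    have : i (q (π n (S x))) + π n (p (ρ 0 x)) = π n (S x) + i (q (π n (p (ρ 0 x)))) := by
      cases n with
      | zero => rw [hS0]; simp only [map_add, map_sub, hqi]; abel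
      | succ m => rw [hS1]; simp only [map_add, map_sub, map_smul, hqi]; abel
    have e : π n (S x) - i (q (π n (S x))) = π n (p (ρ 0 x)) - i (q (π n (p (ρ 0 x)))) := by
      rw [sub_eq_sub_iff_add_eq_add, add_comm (π n (p _)), ← this]
    rw [e]
    simp only [map_add, map_sub, map_smul, hqi, smul_smul, b1, sub_self, zero_add, one_smul]
    abel
  have ST : ∀ x, S (T x) = x := by
    intro x
    apply hX.ext
    intro n
    cases n with
    | zero => rw [hS0, pT, BT, hAπ]; simp only [map_add, map_sub, map_smul, hqi]; abel
    | succ m =>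
      rw [hS1, pT, hAπ, hAπ]
      simp only [map_add, map_sub, map_smul, hqi, smul_smul, smul_add, smul_sub, b2, sub_self,
        smul_zero, zero_add, one_smul]
      abel
  have TS : ∀ x, T (S x) = x := by
    intro x
    apply hY.ext
    intro n
    cases n with
    | zero => rw [hT0, qS, AS, hBπ]; simp only [map_add, map_sub, map_smul, hpj]; abel
    | succ m =>
      rw [hT1, qS, hBπ, hBπ]
      simp only [map_add, map_sub, map_smul, hpj, smul_smul, smul_add, smul_sub, b2, sub_self,
        smul_zero, zero_add, one_smul]
      abel
  let E : X ≃L[ℝ] Y := ContinuousLinearEquiv.equivOfInverse (T.mkContinuous _ hT)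
    (S.mkContinuous _ hS) ST TS
  refine ⟨E, ?_⟩
  have e1 : ‖(E : X →L[ℝ] Y)‖ ≤ 3 + s :=
    ContinuousLinearMap.opNorm_le_bound _ (by linarith) hT
  have e2 : ‖(E.symm : Y →L[ℝ] X)‖ ≤ 3 + s :=
    ContinuousLinearMap.opNorm_le_bound _ (by linarith) hS
  rw [sq]
  gcongr
end abs


/-- Lebesgue measure on the unit interval. -/
noncomputable abbrev muI : Measure ℝ := volume.restrict (Set.Icc (0:ℝ) 1)

/-- The space `ℓ∞`. -/
abbrev XX := lp (fun _ : ℕ => ℝ) ∞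

/-- The space `L∞[0,1]`. -/
noncomputable abbrev YY := Lp ℝ ∞ muI

theorem YY.norm_le {f : YY} {C : ℝ} (hC : 0 ≤ C) (h : ∀ᵐ t ∂muI, ‖f t‖ ≤ C) : ‖f‖ ≤ C := by
  have := Lp.norm_le_of_ae_bound hC h
  simpa using this

theorem YY.ae_le (f : YY) : ∀ᵐ t ∂muI, ‖f t‖ ≤ ‖f‖ := by
  have h := ae_le_eLpNormEssSup (f := f) (μ := muI)
  filter_upwards [h] with t ht
  rw [Lp.norm_def, ← toReal_enorm, eLpNorm_exponent_top]
  exact ENNReal.toReal_mono (by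
    have := Lp.eLpNorm_ne_top f; rwa [eLpNorm_exponent_top] at this) ht

section maps
variable {V : Type*} [NormedAddCommGroup V] [NormedSpace ℝ V]

theorem YY.mk (φ : V → ℝ → ℝ) (hm : ∀ v, AEStronglyMeasurable (φ v) muI)
    (hb : ∀ v, ∀ᵐ t ∂muI, ‖φ v t‖ ≤ ‖v‖)
    (hadd : ∀ v w, ∀ᵐ t ∂muI, φ (v + w) t = φ v t + φ w t)
    (hsmul : ∀ (c : ℝ) v, ∀ᵐ t ∂muI, φ (c • v) t = c * φ v t) :
    ∃ L : V →ₗ[ℝ] YY, (∀ v, ‖L v‖ ≤ ‖v‖) ∧ ∀ v, L v =ᵐ[muI] φ v := by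
  have hM : ∀ v, MemLp (φ v) ∞ muI := fun v => memLp_top_of_bound (hm v) _ (hb v)
  refine ⟨{ toFun := fun v => (hM v).toLp, map_add' := ?_, map_smul' := ?_ }, ?_, ?_⟩
  · intro v w
    rw [← MemLp.toLp_add, MemLp.toLp_eq_toLp_iff]
    exact hadd v w
  · intro c v
    rw [RingHom.id_apply, ← MemLp.toLp_const_smul, MemLp.toLp_eq_toLp_iff]
    exact hsmul c v
  · intro v
    apply YY.norm_le (norm_nonneg v)
    filter_upwards [(hM v).coeFn_toLp, hb v] with t h1 h2
    change ‖((hM v).toLp (φ v) : YY) t‖ ≤ _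
    rwa [h1]
  · intro v
    exact (hM v).coeFn_toLp

theorem XX.mk (L : ℕ → V →ₗ[ℝ] ℝ) (h : ∀ n v, |L n v| ≤ ‖v‖) :
    ∃ G : V →ₗ[ℝ] XX, (∀ v, ‖G v‖ ≤ ‖v‖) ∧ ∀ v n, G v n = L n v := by
  have hM : ∀ v, Memℓp (E := fun _ : ℕ => ℝ) (fun n => L n v) ∞ := fun v =>
    memℓp_infty ⟨‖v‖, by rintro _ ⟨n, rfl⟩; exact h n v⟩
  refine ⟨{ toFun := fun v => ⟨fun n => L n v, hM v⟩, map_add' := ?_, map_smul' := ?_ }, ?_, ?_⟩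
  · intro v w
    ext n
    exact map_add (L n) v w
  · intro v w
    ext n
    exact map_smul (L n) v w
  · intro v
    exact lp.norm_le_of_forall_le (norm_nonneg v) (fun n => h n v)
  · intro v n
    rfl
end maps

theorem XX.abs_le (x : XX) (n : ℕ) : |x n| ≤ ‖x‖ := lp.norm_apply_le_norm ENNReal.top_ne_zero x n

theorem exists_glueX : ∃ π : ℕ → XX →ₗ[ℝ] XX, Glue π := by
  choose π h1 h2 using fun n : ℕ => XX.mk (V := XX)
    (fun k => { toFun := fun x => x (Nat.pair n k), map_add' := fun _ _ => rfl,
                map_smul' := fun _ _ => rfl }) (fun k x => XX.abs_le x _)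
  refine ⟨π, h1, ?_, ?_⟩
  · intro w C hw
    have hC : 0 ≤ C := (norm_nonneg _).trans (hw 0)
    have hb : ∀ m : ℕ, ‖w m.unpair.1 m.unpair.2‖ ≤ C := fun m => (XX.abs_le _ _).trans (hw _)
    refine ⟨⟨fun m => w m.unpair.1 m.unpair.2, memℓp_infty ⟨C, by rintro _ ⟨n, rfl⟩; exact hb n⟩⟩,
      lp.norm_le_of_forall_le hC hb, ?_⟩
    intro n
    ext k
    rw [h2]
    change w (Nat.unpair (Nat.pair n k)).1 (Nat.unpair (Nat.pair n k)).2 = w n k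
    rw [Nat.unpair_pair]
  · intro x hx
    ext m
    have := h2 m.unpair.1 x m.unpair.2
    rw [hx] at this
    simpa using this.symm

theorem qmp_of_inverse (g : ℝ → ℝ) (hg : Measurable g) (D : Set ℝ) (hD : D ⊆ Set.Icc 0 1)
    (h : ℕ → ℝ → ℝ) (hd : ∀ n, DifferentiableOn ℝ (h n) D)
    (hinv : ∀ᵐ u ∂muI, ∃ n, g u ∈ D ∧ h n (g u) = u) :
    Measure.QuasiMeasurePreserving g muI muI := by
  refine ⟨hg, ?_⟩
  refine Measure.AbsolutelyContinuous.mk fun s hs h0 => ?_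
  rw [Measure.map_apply hg hs]
  rw [Measure.restrict_apply hs] at h0
  have h1 : volume (⋃ n, h n '' (s ∩ D)) = 0 := by
    rw [measure_iUnion_null_iff]
    intro n
    apply addHaar_image_eq_zero_of_differentiableOn_of_addHaar_eq_zero
    · exact (hd n).mono Set.inter_subset_right
    · exact measure_mono_null (Set.inter_subset_inter_right _ hD) h0
  have h2 : muI (⋃ n, h n '' (s ∩ D)) = 0 :=
    Measure.absolutelyContinuous_of_le Measure.restrict_le_self h1
  have h3 : ∀ᵐ u ∂muI, u ∉ g ⁻¹' s := by
    filter_upwards [hinv, measure_eq_zero_iff_ae_notMem.1 h2] with u ⟨n, hn1, hn2⟩ hu hus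
    exact hu (Set.mem_iUnion.2 ⟨n, g u, ⟨hus, hn1⟩, hn2⟩)
  exact measure_eq_zero_iff_ae_notMem.2 h3

theorem ae_unit : ∀ᵐ u ∂muI, 0 < u ∧ u < 1 := by
  have h1 : ∀ᵐ u ∂muI, u ∈ Set.Icc (0:ℝ) 1 := ae_restrict_mem measurableSet_Icc
  have h2 : ∀ᵐ u ∂muI, u ≠ 0 := Measure.ae_ne muI 0
  have h3 : ∀ᵐ u ∂muI, u ≠ 1 := Measure.ae_ne muI 1
  filter_upwards [h1, h2, h3] with u a b c
  exact ⟨lt_of_le_of_ne a.1 (Ne.symm b), lt_of_le_of_ne a.2 c⟩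

/-- inverse branches of the Gauss map -/
noncomputable def gpsi (n : ℕ) (u : ℝ) : ℝ := ((n:ℝ) + 1 + u)⁻¹
/-- the Gauss map -/
noncomputable def gphi (t : ℝ) : ℝ := t⁻¹ - ⌊t⁻¹⌋₊
/-- the branch index of the Gauss map -/
noncomputable def gN (t : ℝ) : ℕ := ⌊t⁻¹⌋₊ - 1

theorem gpsi_gphi {t : ℝ} (h0 : 0 < t) (h1 : t < 1) : gpsi (gN t) (gphi t) = t := by
  have h : 1 ≤ t⁻¹ := (one_le_inv₀ h0).2 h1.le
  have h2 : 1 ≤ ⌊t⁻¹⌋₊ := Nat.le_floor (by simpa using h)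
  rw [gpsi, gN, gphi, Nat.cast_sub h2]
  simp

theorem gphi_mem {t : ℝ} (h0 : 0 < t) : gphi t ∈ Set.Ico (0:ℝ) 1 := by
  have h : 0 ≤ t⁻¹ := by positivity
  have := Nat.floor_le h
  have := Nat.lt_floor_add_one t⁻¹
  constructor <;> unfold gphi <;> linarith

theorem floor_gpsi (n : ℕ) {u : ℝ} (h0 : 0 < u) (h1 : u < 1) : ⌊(gpsi n u)⁻¹⌋₊ = n + 1 := by
  rw [gpsi, inv_inv, Nat.floor_eq_iff (by positivity)]
  push_cast
  constructor <;> linarith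

theorem gN_gpsi (n : ℕ) {u : ℝ} (h0 : 0 < u) (h1 : u < 1) : gN (gpsi n u) = n := by
  rw [gN, floor_gpsi n h0 h1]; simp

theorem gphi_gpsi (n : ℕ) {u : ℝ} (h0 : 0 < u) (h1 : u < 1) : gphi (gpsi n u) = u := by
  rw [gphi, floor_gpsi n h0 h1, gpsi]; simp

theorem meas_gpsi (n : ℕ) : Measurable (gpsi n) := by unfold gpsi; fun_prop
theorem meas_gphi : Measurable gphi := by
  unfold gphi
  exact measurable_inv.sub (measurable_from_top.comp (Nat.measurable_floor.comp measurable_inv))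
theorem meas_gN : Measurable gN :=
  (measurable_from_top (f := fun n : ℕ => n - 1)).comp (Nat.measurable_floor.comp measurable_inv)

theorem qmp_gpsi (n : ℕ) : Measure.QuasiMeasurePreserving (gpsi n) muI muI := by
  apply qmp_of_inverse _ (meas_gpsi n) (Set.Ioc 0 1) Set.Ioc_subset_Icc_self
    (fun _ t => t⁻¹ - (n + 1))
  · intro _ t ht
    exact ((differentiableAt_inv ht.1.ne').sub_const _).differentiableWithinAt
  · filter_upwards [ae_unit] with u hu
    refine ⟨0, ⟨?_, ?_⟩, ?_⟩
    · unfold gpsi; have := hu.1; positivity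
    · unfold gpsi; apply inv_le_one_of_one_le₀; have := hu.1; linarith [n.cast_nonneg (α := ℝ)]
    · simp [gpsi]

theorem qmp_gphi : Measure.QuasiMeasurePreserving gphi muI muI := by
  apply qmp_of_inverse _ meas_gphi (Set.Ico 0 1) Set.Ico_subset_Icc_self gpsi
  · intro n t ht
    have : (n:ℝ) + 1 + t ≠ 0 := by have := ht.1; positivity
    unfold gpsi
    fun_prop (disch := assumption)
  · filter_upwards [ae_unit] with u hu
    exact ⟨gN u, gphi_mem hu.1, gpsi_gphi hu.1 hu.2⟩

theorem exists_glueY : ∃ ρ : ℕ → YY →ₗ[ℝ] YY, Glue ρ := by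
  choose ρ h1 h2 using fun n : ℕ => YY.mk (V := YY) (fun y u => y (gpsi n u))
    (fun y => ((Lp.stronglyMeasurable y).comp_measurable (meas_gpsi n)).aestronglyMeasurable)
    (fun y => (qmp_gpsi n).ae (YY.ae_le y))
    (fun y z => (qmp_gpsi n).ae (Lp.coeFn_add y z))
    (fun c y => (qmp_gpsi n).ae (Lp.coeFn_smul c y))
  refine ⟨ρ, h1, ?_, ?_⟩
  · intro w C hw
    have hC : 0 ≤ C := (norm_nonneg _).trans (hw 0)
    have hm : Measurable (fun t => w (gN t) (gphi t)) := by
      have h : Measurable (fun z : ℕ × ℝ => w z.1 z.2) :=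
        measurable_from_prod_countable_right fun n => (Lp.stronglyMeasurable (w n)).measurable
      exact h.comp (meas_gN.prodMk meas_gphi)
    have hb : ∀ᵐ t ∂muI, ‖w (gN t) (gphi t)‖ ≤ C := by
      have : ∀ᵐ u ∂muI, ∀ n, ‖w n u‖ ≤ C := by
        rw [ae_all_iff]; intro n
        filter_upwards [YY.ae_le (w n)] with u hu using hu.trans (hw n)
      filter_upwards [qmp_gphi.ae this] with t ht using ht _
    have hM : MemLp (fun t => w (gN t) (gphi t)) ∞ muI :=
      memLp_top_of_bound hm.aestronglyMeasurable C hb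
    refine ⟨hM.toLp, ?_, ?_⟩
    · apply YY.norm_le hC
      filter_upwards [hM.coeFn_toLp, hb] with t e1 e2
      rwa [e1]
    · intro n
      apply Lp.ext
      filter_upwards [h2 n hM.toLp, (qmp_gpsi n).ae hM.coeFn_toLp, ae_unit] with u e1 e2 hu
      rw [e1, e2, gN_gpsi n hu.1 hu.2, gphi_gpsi n hu.1 hu.2]
  · intro y hy
    apply Lp.ext
    have : ∀ᵐ u ∂muI, ∀ n, y (gpsi n u) = 0 := by
      rw [ae_all_iff]; intro n
      filter_upwards [h2 n y, Lp.coeFn_zero ℝ ∞ muI] with u e1 e2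
      rw [← e1, hy n, e2]; rfl
    filter_upwards [qmp_gphi.ae this, ae_unit, Lp.coeFn_zero ℝ ∞ muI] with t ht hu e
    rw [e, ← gpsi_gphi hu.1 hu.2, ht]; rfl

theorem muI_univ : muI.real Set.univ = 1 := by simp [Measure.real]

theorem YY.integrable (y : YY) : Integrable y muI :=
  (Lp.memLp y).integrable (by simp)

theorem exists_jp {ρ : ℕ → YY →ₗ[ℝ] YY} (hY : Glue ρ) : ∃ (j : XX →ₗ[ℝ] YY) (p : YY →ₗ[ℝ] XX),
    (∀ x, ‖j x‖ ≤ ‖x‖) ∧ (∀ y, ‖p y‖ ≤ ‖y‖) ∧ ∀ x, p (j x) = x := by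
  obtain ⟨c, hc1, hc2⟩ := YY.mk (V := ℝ) (fun a _ => a) (fun a => aestronglyMeasurable_const)
    (fun a => ae_of_all _ fun _ => le_rfl) (fun _ _ => ae_of_all _ fun _ => rfl)
    (fun _ _ => ae_of_all _ fun _ => rfl)
  obtain ⟨j, hj1, hj2⟩ := hY.map (V := XX)
    (fun n => c ∘ₗ (
      { toFun := fun x => x n
        map_add' := fun _ _ => rfl
        map_smul' := fun _ _ => rfl } : XX →ₗ[ℝ] ℝ)) 1
    (fun n x => by rw [one_mul]; exact (hc1 _).trans (XX.abs_le x n))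
  obtain ⟨p, hp1, hp2⟩ := XX.mk (V := YY) (fun n =>
    { toFun := fun y => ∫ t, ρ n y t ∂muI
      map_add' := by
        intro y z
        rw [map_add, ← integral_add (YY.integrable _) (YY.integrable _)]
        exact integral_congr_ae (Lp.coeFn_add _ _)
      map_smul' := by
        intro a y
        rw [map_smul, RingHom.id_apply, smul_eq_mul, ← integral_const_mul]
        exact integral_congr_ae (Lp.coeFn_smul _ _) }) (fun n y => by
      have := norm_integral_le_of_norm_le_const (YY.ae_le (ρ n y))
      rw [muI_univ, mul_one] at this
      exact this.trans (hY.le n y))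
  refine ⟨j, p, by simpa using hj1, hp1, ?_⟩
  intro x
  ext n
  rw [hp2]
  change ∫ t, ρ n (j x) t ∂muI = _
  have e : ρ n (j x) = c (x n) := hj2 n x
  rw [e]
  have e2 := integral_congr_ae (hc2 (x n))
  rw [integral_const, muI_univ, one_smul] at e2
  exact e2


theorem ulim_exists (u : ℕ → ℝ) (C : ℝ) (h : ∀ n, |u n| ≤ C) :
    ∃ a, Filter.Tendsto u (Filter.hyperfilter ℕ : Filter ℕ) (𝓝 a) := by
  obtain ⟨a, _, ha⟩ := (isCompact_Icc (a := -C) (b := C)).ultrafilter_le_nhds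
    ((Filter.hyperfilter ℕ).map u) (by
      rw [Ultrafilter.coe_map, Filter.le_principal_iff, Filter.mem_map]
      exact Filter.univ_mem' fun n => abs_le.1 (h n))
  exact ⟨a, ha⟩

/-- Riemann sums. -/
noncomputable def FN (x : XX) (t : ℝ) (n : ℕ) : ℝ :=
  (∑ k ∈ Finset.range ⌊t * (n + 1)⌋₊, x (Nat.pair n k)) / (n + 1)

theorem FN_sub (x : XX) {s t : ℝ} (h : s ≤ t) (n : ℕ) :
    |FN x t n - FN x s n| ≤ ‖x‖ * (t - s + 1 / (n + 1)) := by
  have hn : (0:ℝ) < n + 1 := by positivity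
  have hab : s * (n + 1) ≤ t * (n + 1) := by gcongr
  have hfl : ⌊s * (n + 1)⌋₊ ≤ ⌊t * (n + 1)⌋₊ := Nat.floor_le_floor hab
  have hd : ((⌊t * (n + 1)⌋₊ - ⌊s * (n + 1)⌋₊ : ℕ) : ℝ) ≤ t * (n + 1) - s * (n + 1) + 1 := by
    rw [Nat.cast_sub hfl]
    by_cases hb : 0 ≤ t * (n + 1)
    · have := Nat.floor_le hb
      have := Nat.lt_floor_add_one (s * (n + 1))
      linarith
    · rw [Nat.floor_of_nonpos (not_le.1 hb).le, Nat.floor_of_nonpos (hab.trans (not_le.1 hb).le)]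
      simp; linarith
  unfold FN
  rw [← sub_div, ← Finset.sum_Ico_eq_sub _ hfl, abs_div, abs_of_pos hn, div_le_iff₀ hn]
  calc _ ≤ ∑ k ∈ Finset.Ico ⌊s * (n + 1)⌋₊ ⌊t * (n + 1)⌋₊, ‖x‖ :=
        (Finset.abs_sum_le_sum_abs _ _).trans (Finset.sum_le_sum fun k _ => XX.abs_le x _)
    _ = ((⌊t * (n + 1)⌋₊ - ⌊s * (n + 1)⌋₊ : ℕ) : ℝ) * ‖x‖ := by simp
    _ ≤ (t * (n + 1) - s * (n + 1) + 1) * ‖x‖ := by gcongr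
    _ = _ := by field_simp

theorem FN_zero (x : XX) (n : ℕ) : FN x 0 n = 0 := by simp [FN]

theorem FN_bound (x : XX) (t : ℝ) (n : ℕ) : |FN x t n| ≤ ‖x‖ * (|t| + 1) := by
  have h1 : (1:ℝ) / (n + 1) ≤ 1 := by
    rw [div_le_one (by positivity)]; linarith [n.cast_nonneg (α := ℝ)]
  rcases le_total 0 t with h | h
  · have := FN_sub x h n
    rw [FN_zero, sub_zero] at this
    refine this.trans ?_
    rw [abs_of_nonneg h]
    gcongr; linarith
  · have := FN_sub x h n
    rw [FN_zero, zero_sub, abs_neg] at this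
    refine this.trans ?_
    rw [abs_of_nonpos h]
    gcongr; linarith

theorem FN_add (x y : XX) (t : ℝ) (n : ℕ) : FN (x + y) t n = FN x t n + FN y t n := by
  unfold FN
  rw [← add_div, ← Finset.sum_add_distrib]
  rfl

theorem FN_smul (c : ℝ) (y : XX) (t : ℝ) (n : ℕ) : FN (c • y) t n = c * FN y t n := by
  unfold FN
  rw [← mul_div_assoc, Finset.mul_sum]
  rfl

theorem exists_iq : ∃ (i : YY →ₗ[ℝ] XX) (q : XX →ₗ[ℝ] YY),
    (∀ y, ‖i y‖ ≤ ‖y‖) ∧ (∀ x, ‖q x‖ ≤ ‖x‖) ∧ ∀ y, q (i y) = y := by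
  choose F hF using fun (x : XX) (t : ℝ) => ulim_exists (FN x t) _ (FN_bound x t)
  have hinv : Filter.Tendsto (fun n : ℕ => (1:ℝ) / (n + 1)) (Filter.hyperfilter ℕ : Filter ℕ) (𝓝 0) :=
    tendsto_one_div_add_atTop_nhds_zero_nat.mono_left Nat.hyperfilter_le_atTop
  have hlip1 : ∀ x s t, s ≤ t → |F x t - F x s| ≤ ‖x‖ * (t - s) := by
    intro x s t hst
    have h1 := ((hF x t).sub (hF x s)).abs
    have h2 : Filter.Tendsto (fun n : ℕ => ‖x‖ * (t - s + 1 / (n + 1)))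
        (Filter.hyperfilter ℕ : Filter ℕ) (𝓝 (‖x‖ * (t - s + 0))) :=
      (hinv.const_add _).const_mul _
    rw [add_zero] at h2
    exact le_of_tendsto_of_tendsto' h1 h2 (fun n => FN_sub x hst n)
  have hlip : ∀ x, LipschitzWith ‖x‖₊ (F x) := by
    intro x
    apply LipschitzWith.of_dist_le_mul
    intro s t
    rw [Real.dist_eq, Real.dist_eq, coe_nnnorm]
    rcases le_total s t with h | h
    · rw [abs_sub_comm, abs_sub_comm s, abs_of_nonneg (sub_nonneg.2 h)]; exact hlip1 x s t h
    · rw [abs_of_nonneg (sub_nonneg.2 h)]; exact hlip1 x t s h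
  have hFadd : ∀ x y, F (x + y) = F x + F y := by
    intro x y
    ext t
    refine tendsto_nhds_unique (hF (x + y) t) ?_
    rw [show FN (x + y) t = fun n => FN x t n + FN y t n from funext (FN_add x y t)]
    exact (hF x t).add (hF y t)
  have hFsmul : ∀ (c : ℝ) y, F (c • y) = fun t => c * F y t := by
    intro x y
    ext t
    refine tendsto_nhds_unique (hF (x • y) t) ?_
    rw [show FN (x • y) t = fun n => x * FN y t n from funext (FN_smul x y t)]
    exact (hF y t).const_mul x
  have hdiff : ∀ x, ∀ᵐ t ∂muI, DifferentiableAt ℝ (F x) t := fun x =>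
    ae_restrict_of_ae (hlip x).ae_differentiableAt_real
  obtain ⟨q, hq1, hq2⟩ := YY.mk (V := XX) (fun x => deriv (F x))
    (fun x => (measurable_deriv _).aestronglyMeasurable)
    (fun x => ae_of_all _ fun t => by simpa using norm_deriv_le_of_lipschitz (hlip x) (x₀ := t))
    (fun x y => by
      filter_upwards [hdiff x, hdiff y] with t h1 h2
      rw [hFadd, deriv_add h1 h2])
    (fun c y => by
      filter_upwards [hdiff y] with t h1
      rw [hFsmul, deriv_const_mul c h1])
  -- extension by zero
  let g : YY → ℝ → ℝ := fun y => (Set.Icc (0:ℝ) 1).indicator y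
  have hgi : ∀ y, Integrable (g y) := fun y =>
    (integrable_indicator_iff measurableSet_Icc).2 (YY.integrable y)
  have hgb : ∀ y, ∀ᵐ t, ‖g y t‖ ≤ ‖y‖ := by
    intro y
    have := (ae_restrict_iff' measurableSet_Icc).1 (YY.ae_le y)
    filter_upwards [this] with t ht
    by_cases h : t ∈ Set.Icc (0:ℝ) 1
    · simpa [g, h] using ht h
    · simp [g, h]
  have hgadd : ∀ y z, g (y + z) =ᵐ[volume] fun t => g y t + g z t := by
    intro y z
    have := (ae_restrict_iff' measurableSet_Icc).1 (Lp.coeFn_add y z)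
    filter_upwards [this] with t ht
    by_cases h : t ∈ Set.Icc (0:ℝ) 1
    · simpa [g, h] using ht h
    · simp [g, h]
  have hgsmul : ∀ (c : ℝ) z, g (c • z) =ᵐ[volume] fun t => c * g z t := by
    intro y z
    have := (ae_restrict_iff' measurableSet_Icc).1 (Lp.coeFn_smul y z)
    filter_upwards [this] with t ht
    by_cases h : t ∈ Set.Icc (0:ℝ) 1
    · simpa [g, h] using ht h
    · simp [g, h]
  have hint : ∀ y a b, |∫ t in a..b, g y t| ≤ ‖y‖ * |b - a| := by
    intro y a b
    rw [← Real.norm_eq_abs]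
    refine intervalIntegral.norm_integral_le_of_norm_le_const_ae ?_
    filter_upwards [hgb y] with t ht _ using ht
  obtain ⟨i, hi1, hi2⟩ := XX.mk (V := YY) (fun m =>
    { toFun := fun y => ((m.unpair.1 : ℝ) + 1) * ∫ t in ((m.unpair.2 : ℝ) / (m.unpair.1 + 1))..
        (((m.unpair.2 + 1 : ℕ) : ℝ) / (m.unpair.1 + 1)), g y t
      map_add' := by
        intro y z
        rw [← mul_add, ← intervalIntegral.integral_add (hgi y).intervalIntegrable
          (hgi z).intervalIntegrable]
        congr 1
        apply intervalIntegral.integral_congr_ae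
        filter_upwards [hgadd y z] with t ht _ using ht
      map_smul' := by
        intro c y
        rw [RingHom.id_apply, smul_eq_mul, mul_left_comm, ← intervalIntegral.integral_const_mul c]
        congr 1
        apply intervalIntegral.integral_congr_ae
        filter_upwards [hgsmul c y] with t ht _ using ht }) (by
      intro m y
      have hn : (0:ℝ) < m.unpair.1 + 1 := by positivity
      change |((m.unpair.1 : ℝ) + 1) * ∫ t in ((m.unpair.2 : ℝ) / (m.unpair.1 + 1))..
        (((m.unpair.2 + 1 : ℕ) : ℝ) / (m.unpair.1 + 1)), g y t| ≤ ‖y‖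
      rw [abs_mul, abs_of_pos hn]
      have h := hint y ((m.unpair.2 : ℝ) / (m.unpair.1 + 1))
        (((m.unpair.2 + 1 : ℕ) : ℝ) / (m.unpair.1 + 1))
      have e : |(((m.unpair.2 + 1 : ℕ) : ℝ) / (m.unpair.1 + 1)) -
          ((m.unpair.2 : ℝ) / (m.unpair.1 + 1))| = 1 / (m.unpair.1 + 1) := by
        rw [← sub_div]; push_cast; rw [add_sub_cancel_left, abs_of_pos (by positivity)]
      rw [e] at h
      calc _ ≤ ((m.unpair.1 : ℝ) + 1) * (‖y‖ * (1 / (m.unpair.1 + 1))) := by gcongr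
        _ = ‖y‖ := by field_simp)
  refine ⟨i, q, hi1, hq1, ?_⟩
  intro y
  have hFNi : ∀ t n, FN (i y) t n = ∫ u in (0:ℝ)..(⌊t * (n + 1)⌋₊ / (n + 1) : ℝ), g y u := by
    intro t n
    have hn : (0:ℝ) < n + 1 := by positivity
    have h := intervalIntegral.sum_integral_adjacent_intervals (μ := volume) (f := g y)
      (a := fun k : ℕ => (k : ℝ) / (n + 1)) (n := ⌊t * (n + 1)⌋₊)
      (fun k _ => (hgi y).intervalIntegrable)
    simp only [Nat.cast_zero, zero_div] at h
    rw [← h, FN, div_eq_iff hn.ne', Finset.sum_mul]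
    refine Finset.sum_congr rfl fun k _ => ?_
    rw [hi2, mul_comm _ ((n:ℝ) + 1)]
    change ((((Nat.pair n k).unpair).1 : ℝ) + 1) * ∫ t in
        ((((Nat.pair n k).unpair).2 : ℝ) / (((Nat.pair n k).unpair).1 + 1))..
        (((((Nat.pair n k).unpair).2 + 1 : ℕ) : ℝ) / (((Nat.pair n k).unpair).1 + 1)), g y t = _
    rw [Nat.unpair_pair]
  have hFi : ∀ t, 0 ≤ t → F (i y) t = ∫ u in (0:ℝ)..t, g y u := by
    intro t ht
    refine tendsto_nhds_unique (hF (i y) t) ?_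
    rw [tendsto_iff_dist_tendsto_zero]
    have hz : Filter.Tendsto (fun n : ℕ => ‖y‖ * ((1:ℝ) / (n + 1)))
      (Filter.hyperfilter ℕ : Filter ℕ) (𝓝 0) := by simpa using hinv.const_mul ‖y‖
    refine squeeze_zero (fun _ => dist_nonneg) (fun n => ?_) hz
    have hn : (0:ℝ) < n + 1 := by positivity
    rw [Real.dist_eq, hFNi, intervalIntegral.integral_interval_sub_left
      (hgi y).intervalIntegrable (hgi y).intervalIntegrable]
    refine (hint y _ _).trans ?_
    gcongr
    have h1 := Nat.floor_le (a := t * (n + 1)) (by positivity)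
    have h2 := Nat.lt_floor_add_one (t * (n + 1))
    have h3 : (⌊t * (n + 1)⌋₊ / (n + 1) : ℝ) - t = (⌊t * (n + 1)⌋₊ - t * (n + 1)) / (n + 1) := by
      field_simp
    rw [h3, abs_div, abs_of_pos hn]
    gcongr
    rw [abs_le]
    constructor <;> linarith
  apply Lp.ext
  filter_upwards [hq2 (i y), ae_unit,
    ae_restrict_of_ae (LocallyIntegrable.ae_hasDerivAt_integral (hgi y).locallyIntegrable)] with t e hu hd
  rw [e]
  have h1 : F (i y) =ᶠ[𝓝 t] fun t => ∫ u in (0:ℝ)..t, g y u := by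
    filter_upwards [lt_mem_nhds hu.1] with s hs using hFi s hs.le
  rw [h1.deriv_eq, (hd 0).deriv]
  simp [g, hu.1.le, hu.2.le]

theorem main_aux_s4 : ∃ T : XX ≃L[ℝ] YY, ‖(T : XX →L[ℝ] YY)‖ * ‖(T.symm : YY →L[ℝ] XX)‖ ≤
    (3 + Real.sqrt 2) ^ 2 := by
  obtain ⟨π, hX⟩ := exists_glueX
  obtain ⟨ρ, hY⟩ := exists_glueY
  obtain ⟨i, q, hi, hq, hqi⟩ := exists_iq
  obtain ⟨j, p, hj, hp, hpj⟩ := exists_jp hY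
  exact abstract_bm hX hY i q j p hi hq hj hp hqi hpj

/-- `d_BM(ℓ∞, L∞[0,1]) ≤ (3 + √2)²`: there exists a continuous linear equivalence
`T : ℓ∞ ≃ L∞[0,1]` with `‖T‖·‖T⁻¹‖ ≤ (3 + √2)²`. -/
theorem banachMazur_linfty_Linfty_upper_bound :
    ∃ T : lp (fun _ : ℕ => ℝ) ∞ ≃L[ℝ] Lp ℝ ∞ (volume.restrict (Set.Icc (0:ℝ) 1)),
      ‖(T : lp (fun _ : ℕ => ℝ) ∞ →L[ℝ] Lp ℝ ∞ (volume.restrict (Set.Icc (0:ℝ) 1)))‖ *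
        ‖(T.symm : Lp ℝ ∞ (volume.restrict (Set.Icc (0:ℝ) 1)) →L[ℝ] lp (fun _ : ℕ => ℝ) ∞)‖ ≤
        (3 + Real.sqrt 2) ^ 2 := by
  exact main_aux_s4
end

section
/- Let L be a compact metrizable space whose set of isolated points is countably infinite and dense in L, such that the set of non-isolated points of L is homeomorphic to the Cantor space 2^ω and L is homeomorphic to L × {0,1}. Then: (a) every continuous linear equivalence T : C(L,ℝ) ≃ C(2^ω,ℝ) satisfies ‖T‖·‖T⁻¹‖ ≥ 3 + 2√2, and (b) there exists a continuous linear equivalence T : C(L,ℝ) ≃ C(2^ω,ℝ) with ‖T‖·‖T⁻¹‖ ≤ (3 + √2)². -/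
open Filter Topology

namespace BMaux

open Classical in
/-- The function equal to `c i` on `U i` and `0` elsewhere. -/
noncomputable def glueFun {X ι : Type*} (U : ι → Set X) (c : ι → ℝ) (x : X) : ℝ :=
  if h : ∃ i, x ∈ U i then c h.choose else 0

lemma glue_mem {X ι : Type*} {U : ι → Set X} (hd : ∀ i j x, x ∈ U i → x ∈ U j → i = j)
    (c : ι → ℝ) {x : X} {i : ι} (hx : x ∈ U i) : glueFun U c x = c i := by
  have h : ∃ i, x ∈ U i := ⟨i, hx⟩
  unfold glueFun
  rw [dif_pos h, hd _ _ x h.choose_spec hx]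

lemma glue_not {X ι : Type*} {U : ι → Set X} (c : ι → ℝ) {x : X} (hx : ∀ i, x ∉ U i) :
    glueFun U c x = 0 := by
  unfold glueFun
  rw [dif_neg (by simpa using hx)]

lemma glue_cont {X ι : Type*} [TopologicalSpace X] {U : ι → Set X}
    (hd : ∀ i j x, x ∈ U i → x ∈ U j → i = j) (hU : ∀ i, IsClopen (U i)) (c : ι → ℝ)
    (hc : ∀ ε > 0, {i | ε ≤ |c i|}.Finite) : Continuous (glueFun U c) := by
  rw [continuous_iff_continuousAt]
  intro x
  by_cases h : ∃ i, x ∈ U i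
  · obtain ⟨i, hi⟩ := h
    have : glueFun U c =ᶠ[𝓝 x] fun _ => c i := by
      filter_upwards [(hU i).isOpen.mem_nhds hi] with y hy
      exact glue_mem hd c hy
    exact (continuousAt_const).congr this.symm
  · push Not at h
    rw [Metric.continuousAt_iff']
    intro ε hε
    have hfin := hc ε hε
    have hclosed : IsClosed (⋃ i ∈ {i | ε ≤ |c i|}, U i) :=
      hfin.isClosed_biUnion fun i _ => (hU i).isClosed
    have hx : x ∈ (⋃ i ∈ {i | ε ≤ |c i|}, U i)ᶜ := by
      simp only [Set.mem_compl_iff, Set.mem_iUnion, not_exists]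
      intro i _
      exact h i
    filter_upwards [hclosed.isOpen_compl.mem_nhds hx] with y hy
    rw [glue_not c h]
    by_cases h' : ∃ i, y ∈ U i
    · obtain ⟨i, hi⟩ := h'
      rw [glue_mem hd c hi, Real.dist_eq, sub_zero]
      by_contra hcon
      apply hy
      simp only [Set.mem_iUnion]
      exact ⟨i, not_lt.mp hcon, hi⟩
    · push Not at h'
      rw [glue_not c h']
      simpa using hε

/-- rings in the Cantor space -/
def ring (x : ℕ → Bool) (n : ℕ) : Set (ℕ → Bool) := {y | (∀ i < n, y i = x i) ∧ y n ≠ x n}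

lemma ring_disj (x : ℕ → Bool) (i j : ℕ) (y : ℕ → Bool) (hi : y ∈ ring x i) (hj : y ∈ ring x j) :
    i = j := by
  rcases lt_trichotomy i j with h | h | h
  · exact absurd (hj.1 i h) hi.2
  · exact h
  · exact absurd (hi.1 j h) hj.2

lemma ring_clopen (x : ℕ → Bool) (n : ℕ) : IsClopen (ring x n) := by
  have h1 : ∀ i, IsClopen {y : ℕ → Bool | y i = x i} := fun i =>
    (isClopen_discrete ({x i} : Set Bool)).preimage (continuous_apply i)
  have : ring x n = (⋂ i ∈ Finset.range n, {y : ℕ → Bool | y i = x i}) ∩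
      {y : ℕ → Bool | y n = x n}ᶜ := by
    ext y; simp [ring]
  rw [this]
  exact (isClopen_biInter_finset fun i _ => h1 i).inter (h1 n).compl

/-- a point of the ring -/
def pt (x : ℕ → Bool) (n : ℕ) : ℕ → Bool := Function.update x n (!(x n))

lemma pt_mem (x : ℕ → Bool) (n : ℕ) : pt x n ∈ ring x n := by
  refine ⟨fun i hi => ?_, ?_⟩
  · simp [pt, Function.update_of_ne hi.ne]
  · simp [pt]

lemma pt_tendsto (x : ℕ → Bool) : Tendsto (pt x) atTop (𝓝 x) := by
  rw [tendsto_pi_nhds]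
  intro i
  apply tendsto_const_nhds.congr'
  filter_upwards [eventually_gt_atTop i] with n hn
  simp [pt, Function.update_of_ne hn.ne]

lemma ring_subset {x : ℕ → Bool} {W : Set (ℕ → Bool)} (hW : IsOpen W) (hx : x ∈ W) :
    ∃ N, ∀ n ≥ N, ring x n ⊆ W := by
  by_contra hcon
  push Not at hcon
  choose n hn hy using hcon
  simp only [Set.not_subset] at hy
  choose y hy1 hy2 using hy
  have ht : Tendsto y atTop (𝓝 x) := by
    rw [tendsto_pi_nhds]
    intro i
    apply tendsto_const_nhds.congr'
    filter_upwards [eventually_gt_atTop i] with N hN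
    exact ((hy1 N).1 i (lt_of_lt_of_le hN (hn N))).symm
  obtain ⟨N, hN⟩ := (ht.eventually (hW.mem_nhds hx)).exists
  exact hy2 N hN

open Classical in
/-- indicator of a clopen set as a continuous function -/
noncomputable def ind {X : Type*} [TopologicalSpace X] (U : Set X) (hU : IsClopen U) : C(X, ℝ) :=
  ⟨fun x => if x ∈ U then 1 else 0, by
    refine continuous_if (fun a ha => ?_) continuousOn_const continuousOn_const
    rw [show {a | a ∈ U} = U from rfl, hU.frontier_eq] at ha
    exact absurd ha (Set.notMem_empty a)⟩

lemma ind_mem {X : Type*} [TopologicalSpace X] {U : Set X} (hU : IsClopen U) {x : X} (hx : x ∈ U) :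
    ind U hU x = 1 := by simp [ind, hx]

lemma ind_not {X : Type*} [TopologicalSpace X] {U : Set X} (hU : IsClopen U) {x : X} (hx : x ∉ U) :
    ind U hU x = 0 := by simp [ind, hx]

/-- a functional is small on the rings -/
lemma ring_small (S : C(ℕ → Bool, ℝ) →L[ℝ] ℝ) (x : ℕ → Bool) :
    Tendsto (fun n => S (ind (ring x n) (ring_clopen x n))) atTop (𝓝 0) := by
  set a : ℕ → ℝ := fun n => S (ind (ring x n) (ring_clopen x n)) with ha
  have hsum : Summable fun n => |a n| := by
    apply summable_of_sum_le (c := ‖S‖) (fun n => abs_nonneg _)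
    intro J
    set φ : C(ℕ → Bool, ℝ) := ∑ n ∈ J, (SignType.sign (a n) : ℝ) • ind (ring x n) (ring_clopen x n)
      with hφ
    have h1 : S φ = ∑ n ∈ J, |a n| := by
      rw [hφ, map_sum]
      refine Finset.sum_congr rfl fun n _ => ?_
      rw [map_smul, smul_eq_mul]
      exact sign_mul_self (a n)
    have h2 : ‖φ‖ ≤ 1 := by
      rw [ContinuousMap.norm_le _ zero_le_one]
      intro y
      rw [hφ, ContinuousMap.sum_apply]
      by_cases hy : ∃ n ∈ J, y ∈ ring x n
      · obtain ⟨n, hn, hyn⟩ := hy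
        rw [Finset.sum_eq_single_of_mem n hn]
        · rw [ContinuousMap.smul_apply, ind_mem _ hyn]
          rcases lt_trichotomy (a n) 0 with h | h | h <;> simp [h]
        · intro k _ hk
          rw [ContinuousMap.smul_apply, ind_not _ (fun h => hk (ring_disj x _ _ y h hyn)), smul_zero]
      · push Not at hy
        rw [Finset.sum_eq_zero]
        · simp
        · intro k hk
          rw [ContinuousMap.smul_apply, ind_not _ (hy k hk), smul_zero]
    calc ∑ n ∈ J, |a n| = S φ := h1.symm
      _ ≤ ‖S φ‖ := Real.le_norm_self _
      _ ≤ ‖S‖ * ‖φ‖ := S.le_opNorm φ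
      _ ≤ ‖S‖ * 1 := by gcongr
      _ = ‖S‖ := mul_one _
  exact (tendsto_zero_iff_abs_tendsto_zero _).2 hsum.tendsto_atTop_zero

end BMaux

namespace BMaux

lemma final_ineq {M K a : ℝ} (ha : 0 < a) (hM : a ≤ M)
    (h : ∀ ε > 0, 2 * (1 - ε * M) ≤ (M - a + ε) * (K * (1 + 2 * ε / a) - 1 / a)) :
    3 + 2 * Real.sqrt 2 ≤ M * K := by
  have hlim : 2 ≤ (M - a) * (K - 1 / a) := by
    have h1 : Tendsto (fun ε : ℝ => 2 * (1 - ε * M)) (𝓝[>] 0) (𝓝 (2 * (1 - 0 * M))) :=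
      (Continuous.tendsto (by fun_prop) _).mono_left nhdsWithin_le_nhds
    have h2 : Tendsto (fun ε : ℝ => (M - a + ε) * (K * (1 + 2 * ε / a) - 1 / a)) (𝓝[>] 0)
        (𝓝 ((M - a + 0) * (K * (1 + 2 * 0 / a) - 1 / a))) :=
      (Continuous.tendsto (by fun_prop) _).mono_left nhdsWithin_le_nhds
    have := le_of_tendsto_of_tendsto h1 h2
      (by filter_upwards [self_mem_nhdsWithin] with ε hε using h ε hε)
    simpa using this
  set P := M - a with hP
  set Q := K - 1 / a with hQ
  have hP0 : 0 < P := by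
    rcases (sub_nonneg.2 hM).lt_or_eq with h | h
    · exact h
    · rw [hP, ← h] at hlim; norm_num at hlim
  have hQ0 : 0 < Q := by
    by_contra hcon
    nlinarith [mul_nonneg hP0.le (neg_nonneg.2 (not_lt.1 hcon))]
  have e : M * K = P * Q + 1 + (P / a + a * Q) := by
    rw [show M = P + a by simp [hP], show K = Q + 1 / a by simp [hQ]]
    field_simp
    ring
  have hs : 2 * Real.sqrt 2 ≤ P / a + a * Q := by
    have h4 : (P / a) * (a * Q) = P * Q := by field_simp
    have : Real.sqrt 8 ≤ P / a + a * Q := by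
      apply Real.sqrt_le_iff.2
      refine ⟨by positivity, ?_⟩
      nlinarith [sq_nonneg (P / a - a * Q)]
    have h8 : Real.sqrt 8 = 2 * Real.sqrt 2 := by
      rw [show (8 : ℝ) = 2 ^ 2 * 2 by norm_num, Real.sqrt_mul (by norm_num), Real.sqrt_sq (by norm_num)]
    linarith
  linarith

theorem lower {L : Type*} [TopologicalSpace L] [CompactSpace L] [T2Space L] (D : Set L)
    (hD : ∀ d ∈ D, IsOpen {d}) (hinf : D.Infinite) (hdense : Dense D)
    (T : C(L, ℝ) ≃L[ℝ] C(ℕ → Bool, ℝ)) :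
    3 + 2 * Real.sqrt 2 ≤ ‖(T : C(L, ℝ) →L[ℝ] C(ℕ → Bool, ℝ))‖ *
            ‖(T.symm : C(ℕ → Bool, ℝ) →L[ℝ] C(L, ℝ))‖ := by
  set M := ‖(T : C(L, ℝ) →L[ℝ] C(ℕ → Bool, ℝ))‖ with hMdef
  set K := ‖(T.symm : C(ℕ → Bool, ℝ) →L[ℝ] C(L, ℝ))‖ with hKdef
  have hT : ∀ f, ‖T f‖ ≤ M * ‖f‖ := fun f =>
    (T : C(L, ℝ) →L[ℝ] C(ℕ → Bool, ℝ)).le_opNorm f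
  have hS : ∀ f, ‖T.symm f‖ ≤ K * ‖f‖ := fun f =>
    (T.symm : C(ℕ → Bool, ℝ) →L[ℝ] C(L, ℝ)).le_opNorm f
  have hM0 : 0 ≤ M := norm_nonneg (T : C(L, ℝ) →L[ℝ] C(ℕ → Bool, ℝ))
  have hK0 : 0 ≤ K := norm_nonneg (T.symm : C(ℕ → Bool, ℝ) →L[ℝ] C(L, ℝ))
  have hTx : ∀ f x, |T f x| ≤ ‖T f‖ := fun f x => (T f).norm_coe_le_norm x
  have hclopen : ∀ d ∈ D, IsClopen ({d} : Set L) := fun d hd => ⟨isClosed_singleton, hD d hd⟩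
  set E : Set C(L, ℝ) := {e | ‖e‖ ≤ 1 ∧ (Function.support e).Finite ∧ Function.support e ⊆ D}
    with hE
  set a := sSup ((fun e => ‖T e‖) '' E) with hadef
  have hbdd : BddAbove ((fun e => ‖T e‖) '' E) := by
    refine ⟨M, ?_⟩
    rintro _ ⟨e, he, rfl⟩
    calc ‖T e‖ ≤ M * ‖e‖ := hT e
      _ ≤ M * 1 := by gcongr; exact he.1
      _ = M := mul_one _
  have hle : ∀ e ∈ E, ‖T e‖ ≤ a := fun e he => le_csSup hbdd ⟨e, he, rfl⟩
  have hne : ((fun e => ‖T e‖) '' E).Nonempty :=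
    ⟨_, 0, ⟨by simp, by simp, by simp⟩, rfl⟩
  have haM : a ≤ M := by
    refine csSup_le hne ?_
    rintro _ ⟨e, he, rfl⟩
    calc ‖T e‖ ≤ M * ‖e‖ := hT e
      _ ≤ M * 1 := by gcongr; exact he.1
      _ = M := mul_one _
  -- adding a point mass
  have hadd : ∀ e ∈ E, ∀ m (hm : m ∈ D), e m = 0 → ∀ s : ℝ, |s| ≤ 1 →
      e + s • ind {m} (hclopen m hm) ∈ E := by
    intro e he m hm hem s hs
    refine ⟨?_, ?_, ?_⟩
    · rw [ContinuousMap.norm_le _ zero_le_one]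
      intro x
      by_cases hx : x = m
      · subst hx
        simpa [hem, ind_mem (hclopen x hm) (Set.mem_singleton x)] using hs
      · simpa [ind_not (hclopen m hm) (x := x) hx] using (e.norm_coe_le_norm x).trans he.1
    · refine (he.2.1.union (Set.finite_singleton m)).subset ?_
      intro x hx
      by_contra hcon
      simp only [Set.mem_union, Function.mem_support, not_or, not_not] at hcon
      apply hx
      simp [hcon.1, ind_not (hclopen m hm) hcon.2]
    · intro x hx
      by_contra hcon
      have h1 : e x = 0 := by
        by_contra h; exact hcon (he.2.2 h)
      have h2 : x ∉ ({m} : Set L) := fun h => hcon (by rw [Set.mem_singleton_iff.1 h]; exact hm)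
      apply hx
      simp [h1, ind_not (hclopen m hm) h2]
  have hEneg : ∀ e ∈ E, -e ∈ E := by
    intro e he
    have : Function.support (⇑(-e)) = Function.support e := by ext x; simp
    exact ⟨by simpa using he.1, by rw [this]; exact he.2.1, by rw [this]; exact he.2.2⟩
  have ha : 0 < a := by
    obtain ⟨m, hm⟩ := hinf.nonempty
    have h0 : (0 : C(L, ℝ)) + (1 : ℝ) • ind {m} (hclopen m hm) ∈ E :=
      hadd 0 ⟨by simp, by simp, by simp⟩ m hm (by simp) 1 (by simp)
    refine lt_of_lt_of_le ?_ (hle _ h0)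
    rw [norm_pos_iff]
    intro h
    have h1 := (map_eq_zero_iff T T.injective).1 h
    have := DFunLike.congr_fun h1 m
    simp [ind_mem (hclopen m hm) (Set.mem_singleton m)] at this
  apply final_ineq ha haM
  intro ε hε
  -- near maximal element
  obtain ⟨e, heE, x, hx⟩ : ∃ e ∈ E, ∃ x, a - ε < T e x := by
    obtain ⟨_, ⟨e, he, rfl⟩, h⟩ := exists_lt_of_lt_csSup hne (show a - ε < a by linarith)
    by_contra! hcon
    apply absurd h
    rw [not_lt]
    by_cases h0 : 0 ≤ a - ε
    · rw [ContinuousMap.norm_le _ h0]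
      intro x
      rw [Real.norm_eq_abs, abs_le]
      have := hcon (-e) (hEneg e he) x
      simp at this
      exact ⟨by linarith, hcon e he x⟩
    · exfalso
      have h1 := hcon 0 ⟨by simp, by simp, by simp⟩ (fun _ => true)
      simp at h1
      linarith
  set F := Function.support e with hF
  have hFfin : F.Finite := heE.2.1
  have hFD : F ⊆ D := heE.2.2
  have hFclopen : IsClopen F := by
    refine ⟨hFfin.isClosed, ?_⟩
    rw [← Set.biUnion_of_singleton F]
    exact isOpen_biUnion fun i hi => hD i (hFD hi)
  have hW0 : IsOpen {z | a - ε < T e z} := isOpen_lt continuous_const (T e).continuous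
  obtain ⟨N, hN⟩ := ring_subset hW0 hx
  have hsmall : ∀ᶠ n in atTop, ∀ d ∈ F, |T.symm (ind (ring x n) (ring_clopen x n)) d| < ε := by
    rw [Set.Finite.eventually_all hFfin]
    intro d _
    have := ring_small ((ContinuousMap.evalCLM ℝ d).comp
      (T.symm : C(ℕ → Bool, ℝ) →L[ℝ] C(L, ℝ))) x
    have h2 := this.abs.eventually (gt_mem_nhds (show |(0 : ℝ)| < ε by simpa using hε))
    filter_upwards [h2] with n hn
    simpa using hn
  obtain ⟨n, hnN, hn⟩ := ((eventually_ge_atTop N).and hsmall).exists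
  set W := ring x n
  set φ := ind W (ring_clopen x n)
  have hφ1 : ∀ z ∈ W, φ z = 1 := fun z hz => ind_mem (ring_clopen x n) hz
  have hφ0 : ∀ z, z ∉ W → φ z = 0 := fun z hz => ind_not (ring_clopen x n) hz
  have hWsub := hN n hnN
  obtain ⟨w, hw⟩ : ∃ w, w ∈ W := ⟨_, pt_mem x n⟩
  set f := T.symm φ with hf
  have hTf : T f = φ := T.apply_symm_apply φ
  set β := sSup ((fun m => |f m|) '' (D \ F)) with hβ
  have hβbdd : BddAbove ((fun m => |f m|) '' (D \ F)) := by
    refine ⟨‖f‖, ?_⟩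
    rintro _ ⟨m, _, rfl⟩
    exact f.norm_coe_le_norm m
  have hβne : ((fun m => |f m|) '' (D \ F)).Nonempty := (hinf.diff hFfin).nonempty.image _
  have hβle : ∀ m ∈ D \ F, |f m| ≤ β := fun m hm => le_csSup hβbdd ⟨m, hm, rfl⟩
  have hβ0 : 0 ≤ β := by
    obtain ⟨m, hm⟩ := (hinf.diff hFfin).nonempty
    exact (abs_nonneg _).trans (hβle m hm)
  -- inequality (A)
  have hA : 1 - ε * M ≤ (M - a + ε) * β := by
    set k := f * ind F hFclopen with hk
    have hknorm : ‖k‖ ≤ ε := by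
      rw [ContinuousMap.norm_le _ hε.le]
      intro y
      by_cases hy : y ∈ F
      · simpa [hk, ind_mem hFclopen hy] using (hn y hy).le
      · simpa [hk, ind_not hFclopen hy] using hε.le
    set q := f - k + β • e with hq
    have hqnorm : ‖q‖ ≤ β := by
      rw [ContinuousMap.norm_le _ hβ0]
      have hcl : IsClosed {y | ‖q y‖ ≤ β} := isClosed_le (by fun_prop) continuous_const
      have : closure D ⊆ {y | ‖q y‖ ≤ β} := by
        apply closure_minimal _ hcl
        intro y hyD
        by_cases hy : y ∈ F
        · have h1 : |e y| ≤ 1 := (e.norm_coe_le_norm y).trans heE.1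
          simp only [Set.mem_setOf_eq, hq, hk, ContinuousMap.add_apply, ContinuousMap.sub_apply,
            ContinuousMap.mul_apply, ind_mem hFclopen hy, ContinuousMap.smul_apply, smul_eq_mul,
            mul_one, sub_self, zero_add, Real.norm_eq_abs, abs_mul, abs_of_nonneg hβ0]
          nlinarith
        · have h1 : e y = 0 := by
            by_contra h; exact hy h
          simpa [hq, hk, ind_not hFclopen hy, h1] using hβle y ⟨hyD, hy⟩
      intro y
      exact this (by rw [hdense.closure_eq]; trivial)
    have h1 : T q w = 1 - T k w + β * T e w := by
      simp [hq, hTf, hφ1 w hw]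
    have h2 : T q w ≤ M * β :=
      (le_abs_self _).trans ((hTx q w).trans ((hT q).trans (by gcongr)))
    have h3 : T k w ≤ M * ε :=
      (le_abs_self _).trans ((hTx k w).trans ((hT k).trans (by gcongr)))
    have h4 : a - ε < T e w := hWsub hw
    nlinarith
  -- inequality (B)
  have hB : 2 * β ≤ K * (1 + 2 * ε / a) - 1 / a := by
    have key : β ≤ (K * (1 + 2 * ε / a) - 1 / a) / 2 := by
      refine csSup_le hβne ?_
      rintro _ ⟨m, ⟨hmD, hmF⟩, rfl⟩
      have hem : e m = 0 := by
        by_contra h; exact hmF h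
      set δ := ind {m} (hclopen m hmD) with hδ
      obtain ⟨s, hs1, hs2⟩ : ∃ s : ℝ, |s| = 1 ∧ s * f m = |f m| := by
        rcases le_total 0 (f m) with h | h
        · exact ⟨1, by simp, by rw [abs_of_nonneg h, one_mul]⟩
        · exact ⟨-1, by simp, by rw [abs_of_nonpos h]; ring⟩
      have hp := hle _ (hadd e heE m hmD hem s hs1.le)
      have hm' := hle _ (hadd e heE m hmD hem (-s) (by rw [abs_neg, hs1]))
      have hpx : ∀ z, |T e z + s * T δ z| ≤ a := fun z => by
        simpa [hδ] using (hTx _ z).trans hp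
      have hmx : ∀ z, |T e z - s * T δ z| ≤ a := fun z => by
        simpa [hδ, sub_eq_add_neg] using (hTx _ z).trans hm'
      set ψ := (2 : ℝ) • φ - (1 / a) • T e + (s / a) • T δ with hψ
      have hψn : ‖ψ‖ ≤ 1 + 2 * ε / a := by
        rw [ContinuousMap.norm_le _ (by positivity)]
        intro z
        have h1 := abs_le.1 (hpx z)
        have h2 := abs_le.1 (hmx z)
        rw [Real.norm_eq_abs, abs_le]
        by_cases hz : z ∈ W
        · have h3 : a - ε < T e z := hWsub hz
          have e1 : ψ z = 2 - (T e z - s * T δ z) / a := by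
            simp [hψ, hφ1 z hz]; ring
          have u1 : (T e z - s * T δ z) / a ≤ 1 := by rw [div_le_one ha]; exact h2.2
          have u2 : 1 - 2 * ε / a ≤ (T e z - s * T δ z) / a := by
            rw [le_div_iff₀ ha]
            field_simp
            linarith
          have : 0 ≤ 2 * ε / a := by positivity
          rw [e1]; constructor <;> linarith
        · have e1 : ψ z = - ((T e z - s * T δ z) / a) := by
            simp [hψ, hφ0 z hz]; ring
          have u1 : (T e z - s * T δ z) / a ≤ 1 := by rw [div_le_one ha]; exact h2.2
          have u2 : -1 ≤ (T e z - s * T δ z) / a := by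
            rw [le_div_iff₀ ha]; linarith [h2.1]
          have : 0 ≤ 2 * ε / a := by positivity
          rw [e1]; constructor <;> linarith
      have hval : T.symm ψ m = 2 * f m + s / a := by
        simp [hψ, hem, hδ, ind_mem (hclopen m hmD) (Set.mem_singleton m), hf]
      have hup : |T.symm ψ m| ≤ K * (1 + 2 * ε / a) :=
        ((T.symm ψ).norm_coe_le_norm m).trans ((hS ψ).trans (by gcongr))
      have hss : s * s = 1 := by rw [← abs_mul_abs_self, hs1, one_mul]
      have : s * T.symm ψ m = 2 * |f m| + 1 / a := by
        rw [hval, ← hs2]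
        field_simp
        linear_combination hss
      have h5 : s * T.symm ψ m ≤ |T.symm ψ m| := by
        calc s * T.symm ψ m ≤ |s * T.symm ψ m| := le_abs_self _
          _ = _ := by rw [abs_mul, hs1, one_mul]
      change |f m| ≤ _
      linarith
    linarith
  have : 0 ≤ M - a + ε := by linarith
  nlinarith [mul_le_mul_of_nonneg_left hB this]

end BMaux

namespace BMaux

/-- nearest point retraction -/
lemma exists_retract {L : Type*} [TopologicalSpace L] [CompactSpace L] [T2Space L]
    [TopologicalSpace.MetrizableSpace L] (A : Set L) (hA : IsClosed A) (hne : A.Nonempty)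
    (hiso : ∀ d ∉ A, IsOpen {d}) :
    ∃ r : L → L, Continuous r ∧ (∀ x, r x ∈ A) ∧ ∀ x ∈ A, r x = x := by
  letI : MetricSpace L := TopologicalSpace.metrizableSpaceMetric L
  have h : ∀ x : L, ∃ y ∈ A, Metric.infDist x A = dist x y := fun x =>
    hA.isCompact.exists_infDist_eq_dist hne x
  choose r hr hd using h
  have hid : ∀ x ∈ A, r x = x := by
    intro x hx
    have := hd x
    rw [Metric.infDist_zero_of_mem hx] at this
    exact (dist_eq_zero.1 this.symm).symm
  refine ⟨r, ?_, hr, hid⟩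
  rw [continuous_iff_continuousAt]
  intro x
  by_cases hx : x ∈ A
  · rw [Metric.continuousAt_iff]
    intro ε hε
    refine ⟨ε / 2, by positivity, fun {y} hy => ?_⟩
    rw [hid x hx]
    have h1 : dist y (r y) ≤ dist y x := by
      rw [← hd y]; exact Metric.infDist_le_dist_of_mem hx
    have h2 := dist_triangle (r y) y x
    rw [dist_comm (r y) y] at h2
    linarith
  · have : 𝓝 x = pure x := by
      exact isOpen_singleton_iff_nhds_eq_pure x |>.1 (hiso x hx)
    rw [ContinuousAt, this]
    exact tendsto_pure_nhds r x

/-- data for the upper bound -/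
structure Data (L : Type*) [TopologicalSpace L] where
  D : Set L
  rho : C(L, ℕ → Bool)
  j : C(ℕ → Bool, L)
  rho_j : ∀ x, rho (j x) = x
  j_not : ∀ x, j x ∉ D
  j_rho : ∀ y, y ∉ D → j (rho y) = y
  isol : ∀ d ∈ D, IsOpen {d}
  enc : D × ℕ → ℕ
  enc_inj : Function.Injective enc

variable {L : Type*} [TopologicalSpace L] [CompactSpace L] [T2Space L] (A : Data L)

def Data.U (k : A.D × ℕ) : Set (ℕ → Bool) := ring (fun _ => false) (A.enc k)
def Data.p (k : A.D × ℕ) : ℕ → Bool := pt (fun _ => false) (A.enc k)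
def Data.V (d : A.D) : Set L := {(d : L)}

lemma U_disj (i j : A.D × ℕ) (x : ℕ → Bool) (hi : x ∈ A.U i) (hj : x ∈ A.U j) : i = j :=
  A.enc_inj (ring_disj _ _ _ x hi hj)
lemma U_clopen (i : A.D × ℕ) : IsClopen (A.U i) := ring_clopen _ _
lemma p_mem (i : A.D × ℕ) : A.p i ∈ A.U i := pt_mem _ _
lemma V_disj (i j : A.D) (x : L) (hi : x ∈ A.V i) (hj : x ∈ A.V j) : i = j := by
  apply Subtype.ext
  rw [← Set.mem_singleton_iff.1 hi, ← Set.mem_singleton_iff.1 hj]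
lemma V_clopen (i : A.D) : IsClopen (A.V i) := ⟨isClosed_singleton, A.isol i i.2⟩

lemma p_tendsto : Tendsto A.p cofinite (𝓝 fun _ => false) := by
  have := pt_tendsto (fun _ => false)
  rw [← Nat.cofinite_eq_atTop] at this
  exact this.comp A.enc_inj.tendsto_cofinite

lemma shift_inj : Function.Injective (fun k : A.D × ℕ => (k.1, k.2 + 1)) := by
  rintro ⟨d, i⟩ ⟨d', i'⟩ h
  simp at h
  ext <;> simp [h.1, h.2]

lemma diff_fin (g : C(ℕ → Bool, ℝ)) (ε : ℝ) (hε : 0 < ε) :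
    {k : A.D × ℕ | ε ≤ |g (A.p k) - g (A.p (k.1, k.2 + 1))|}.Finite := by
  have h1 : Tendsto (fun k => g (A.p k)) cofinite (𝓝 (g fun _ => false)) :=
    (g.continuous.tendsto _).comp (p_tendsto A)
  have h2 : Tendsto (fun k : A.D × ℕ => g (A.p (k.1, k.2 + 1))) cofinite (𝓝 (g fun _ => false)) :=
    h1.comp (shift_inj A).tendsto_cofinite
  have h3 := (h1.sub h2).abs
  rw [sub_self, abs_zero] at h3
  have := h3.eventually (gt_mem_nhds hε)
  rw [Filter.eventually_cofinite] at this
  simpa using this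

lemma h_fin (f : C(L, ℝ)) (ε : ℝ) (hε : 0 < ε) :
    {d : A.D | ε ≤ |f d - f (A.j (A.rho d))|}.Finite := by
  set B : Set L := {y | ε ≤ |f y - f (A.j (A.rho y))|} with hB
  have hcl : IsClosed B := isClosed_le continuous_const (by fun_prop)
  have hsub : B ⊆ A.D := by
    intro y hy
    by_contra hcon
    have : ε ≤ |f y - f (A.j (A.rho y))| := hy
    rw [A.j_rho y hcon, sub_self, abs_zero] at this
    linarith
  have hdisc : DiscreteTopology B := by
    rw [discreteTopology_subtype_iff']
    intro y hy
    refine ⟨{y}, A.isol y (hsub hy), ?_⟩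
    ext z; simp; rintro rfl; exact hy
  have hfin : B.Finite := hcl.isCompact.finite (isDiscrete_iff_discreteTopology.mpr hdisc)
  have h := Set.Finite.preimage (f := (Subtype.val : A.D → L)) Subtype.val_injective.injOn hfin
  exact h

/-- coefficients of the forward map -/
def Data.c (f : C(L, ℝ)) : A.D × ℕ → ℝ
  | (d, 0) => f d - f (A.j (A.rho d))
  | (d, i + 1) => f (A.j (A.p (d, i))) - f (A.j (A.p (d, i + 1)))

lemma c_fin (f : C(L, ℝ)) (ε : ℝ) (hε : 0 < ε) : {k | ε ≤ |A.c f k|}.Finite := by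
  refine (((h_fin A f ε hε).image (fun d => (d, 0))).union
    ((diff_fin A (f.comp A.j) ε hε).image (fun k => (k.1, k.2 + 1)))).subset ?_
  rintro ⟨d, i⟩ hk
  cases i with
  | zero => left; exact ⟨d, hk, rfl⟩
  | succ i => right; exact ⟨(d, i), hk, rfl⟩

/-- forward map -/
noncomputable def Data.Tf (f : C(L, ℝ)) : C(ℕ → Bool, ℝ) :=
  f.comp A.j + ⟨glueFun A.U (A.c f), glue_cont (U_disj A) (U_clopen A) _ (c_fin A f)⟩

/-- coefficients of the backward map -/
def Data.c' (g : C(ℕ → Bool, ℝ)) (k : A.D × ℕ) : ℝ := g (A.p (k.1, k.2 + 1)) - g (A.p k)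

lemma c'_fin (f : C(ℕ → Bool, ℝ)) (ε : ℝ) (hε : 0 < ε) : {k | ε ≤ |A.c' f k|}.Finite := by
  refine (diff_fin A f ε hε).subset fun k hk => ?_
  simpa [Data.c', abs_sub_comm] using hk

noncomputable def Data.G (g : C(ℕ → Bool, ℝ)) : C(ℕ → Bool, ℝ) :=
  g + ⟨glueFun A.U (A.c' g), glue_cont (U_disj A) (U_clopen A) _ (c'_fin A g)⟩

def Data.c2 (g : C(ℕ → Bool, ℝ)) (d : A.D) : ℝ := g (A.p (d, 0)) - g (A.p (d, 1))

lemma c2_fin (f : C(ℕ → Bool, ℝ)) (ε : ℝ) (hε : 0 < ε) : {k | ε ≤ |A.c2 f k|}.Finite := by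
  have := (diff_fin A f ε hε).preimage (f := fun d : A.D => (d, 0))
    (fun x _ y _ h => by simpa using h)
  exact this

noncomputable def Data.Sg (g : C(ℕ → Bool, ℝ)) : C(L, ℝ) :=
  (A.G g).comp A.rho + ⟨glueFun A.V (A.c2 g), glue_cont (V_disj A) (V_clopen A) _ (c2_fin A g)⟩

lemma Tf_mem (f : C(L, ℝ)) {x : ℕ → Bool} {k : A.D × ℕ} (hx : x ∈ A.U k) :
    A.Tf f x = f (A.j x) + A.c f k := by
  simp [Data.Tf, glue_mem (U_disj A) _ hx]

lemma Tf_not (f : C(L, ℝ)) {x : ℕ → Bool} (hx : ∀ k, x ∉ A.U k) :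
    A.Tf f x = f (A.j x) := by
  simp [Data.Tf, glue_not _ hx]

lemma G_mem (f : C(ℕ → Bool, ℝ)) {x : ℕ → Bool} {k : A.D × ℕ} (hx : x ∈ A.U k) :
    A.G f x = f x + A.c' f k := by
  simp [Data.G, glue_mem (U_disj A) _ hx]

lemma G_not (f : C(ℕ → Bool, ℝ)) {x : ℕ → Bool} (hx : ∀ k, x ∉ A.U k) :
    A.G f x = f x := by
  simp [Data.G, glue_not _ hx]

lemma Sg_mem (g : C(ℕ → Bool, ℝ)) (d : A.D) :
    A.Sg g d = A.G g (A.rho d) + A.c2 g d := by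
  simp [Data.Sg, glue_mem (V_disj A) (A.c2 g) (show (d : L) ∈ A.V d from rfl)]

lemma Sg_not (g : C(ℕ → Bool, ℝ)) {y : L} (hy : y ∉ A.D) :
    A.Sg g y = A.G g (A.rho y) := by
  have : ∀ k, y ∉ A.V k := by
    rintro k hk
    exact hy (by rw [Set.mem_singleton_iff.1 hk]; exact k.2)
  simp [Data.Sg, glue_not _ this]

lemma Sg_j (g : C(ℕ → Bool, ℝ)) (x : ℕ → Bool) : A.Sg g (A.j x) = A.G g x := by
  rw [Sg_not A g (A.j_not x), A.rho_j]

lemma Tf_p0 (f : C(L, ℝ)) (d : A.D) :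
    A.Tf f (A.p (d, 0)) = f (A.j (A.p (d, 0))) + (f d - f (A.j (A.rho d))) :=
  Tf_mem A f (p_mem A _)

lemma Tf_ps (f : C(L, ℝ)) (d : A.D) (i : ℕ) :
    A.Tf f (A.p (d, i + 1)) = f (A.j (A.p (d, i))) := by
  rw [Tf_mem A f (p_mem A _)]
  simp [Data.c]

lemma c'_Tf (f : C(L, ℝ)) (k : A.D × ℕ) : A.c' (A.Tf f) k = - A.c f k := by
  obtain ⟨d, i⟩ := k
  cases i with
  | zero => simp only [Data.c', Tf_ps, Tf_p0, Data.c]; ring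
  | succ i => simp only [Data.c', Tf_ps, Data.c]; ring

lemma G_Tf (f : C(L, ℝ)) (x : ℕ → Bool) : A.G (A.Tf f) x = f (A.j x) := by
  by_cases h : ∃ k, x ∈ A.U k
  · obtain ⟨k, hk⟩ := h
    rw [G_mem A _ hk, Tf_mem A _ hk, c'_Tf]; ring
  · push Not at h
    rw [G_not A _ h, Tf_not A _ h]

lemma left_inv (f : C(L, ℝ)) : A.Sg (A.Tf f) = f := by
  ext y
  by_cases hy : y ∈ A.D
  · have := Sg_mem A (A.Tf f) ⟨y, hy⟩
    rw [G_Tf] at this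
    rw [this]
    simp only [Data.c2, Tf_p0]
    rw [Tf_ps A f _ 0]
    ring
  · rw [Sg_not A _ hy, G_Tf, A.j_rho y hy]

lemma G_p (g : C(ℕ → Bool, ℝ)) (d : A.D) (i : ℕ) : A.G g (A.p (d, i)) = g (A.p (d, i + 1)) := by
  rw [G_mem A _ (p_mem A _)]
  simp [Data.c']

lemma c_Sg (g : C(ℕ → Bool, ℝ)) (k : A.D × ℕ) : A.c (A.Sg g) k = - A.c' g k := by
  obtain ⟨d, i⟩ := k
  cases i with
  | zero => simp only [Data.c', Data.c, Sg_j, Sg_mem, Data.c2]; ring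
  | succ i => simp only [Data.c', Data.c, Sg_j, G_p]; ring

lemma right_inv (g : C(ℕ → Bool, ℝ)) : A.Tf (A.Sg g) = g := by
  ext x
  by_cases h : ∃ k, x ∈ A.U k
  · obtain ⟨k, hk⟩ := h
    rw [Tf_mem A _ hk, c_Sg, Sg_j, G_mem A _ hk]; ring
  · push Not at h
    rw [Tf_not A _ h, Sg_j, G_not A _ h]

lemma Tf_add (f f' : C(L, ℝ)) : A.Tf (f + f') = A.Tf f + A.Tf f' := by
  ext x
  by_cases h : ∃ k, x ∈ A.U k
  · obtain ⟨⟨d, i⟩, hk⟩ := h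
    rw [ContinuousMap.add_apply, Tf_mem A _ hk, Tf_mem A _ hk, Tf_mem A _ hk]
    cases i <;> simp only [Data.c, ContinuousMap.add_apply] <;> ring
  · push Not at h
    simp [Tf_not A _ h]

lemma Tf_smul (t : ℝ) (f : C(L, ℝ)) : A.Tf (t • f) = t • A.Tf f := by
  ext x
  by_cases h : ∃ k, x ∈ A.U k
  · obtain ⟨⟨d, i⟩, hk⟩ := h
    rw [ContinuousMap.smul_apply, Tf_mem A _ hk, Tf_mem A _ hk]
    cases i <;> simp only [Data.c, ContinuousMap.smul_apply, smul_eq_mul] <;> ring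
  · push Not at h
    simp [Tf_not A _ h]

lemma bd {X : Type*} [TopologicalSpace X] [CompactSpace X] (f : C(X, ℝ)) (x : X) :
    -‖f‖ ≤ f x ∧ f x ≤ ‖f‖ := abs_le.1 (f.norm_coe_le_norm x)

lemma Tf_norm (f : C(L, ℝ)) : ‖A.Tf f‖ ≤ 3 * ‖f‖ := by
  have h0 := norm_nonneg f
  rw [ContinuousMap.norm_le _ (by positivity)]
  intro x
  rw [Real.norm_eq_abs, abs_le]
  by_cases h : ∃ k, x ∈ A.U k
  · obtain ⟨⟨d, i⟩, hk⟩ := h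
    rw [Tf_mem A _ hk]
    have h1 := bd f (A.j x)
    cases i with
    | zero =>
      have h2 := bd f d
      have h3 := bd f (A.j (A.rho d))
      simp only [Data.c]
      constructor <;> linarith
    | succ i =>
      have h2 := bd f (A.j (A.p (d, i)))
      have h3 := bd f (A.j (A.p (d, i + 1)))
      simp only [Data.c]
      constructor <;> linarith
  · push Not at h
    rw [Tf_not A _ h]
    have h1 := bd f (A.j x)
    constructor <;> linarith

lemma G_bd (g : C(ℕ → Bool, ℝ)) (x : ℕ → Bool) : - (3 * ‖g‖) ≤ A.G g x ∧ A.G g x ≤ 3 * ‖g‖ := by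
  have h0 := norm_nonneg g
  have h1 := bd g x
  by_cases h : ∃ k, x ∈ A.U k
  · obtain ⟨k, hk⟩ := h
    rw [G_mem A _ hk]
    have h2 := bd g (A.p k)
    have h3 := bd g (A.p (k.1, k.2 + 1))
    simp only [Data.c']
    constructor <;> linarith
  · push Not at h
    rw [G_not A _ h]
    constructor <;> linarith

lemma Sg_norm (g : C(ℕ → Bool, ℝ)) : ‖A.Sg g‖ ≤ 5 * ‖g‖ := by
  have h0 := norm_nonneg g
  rw [ContinuousMap.norm_le _ (by positivity)]
  intro y
  rw [Real.norm_eq_abs, abs_le]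
  have h1 := G_bd A g (A.rho y)
  by_cases hy : y ∈ A.D
  · rw [Sg_mem A g ⟨y, hy⟩]
    have h2 := bd g (A.p (⟨y, hy⟩, 0))
    have h3 := bd g (A.p (⟨y, hy⟩, 1))
    simp only [Data.c2]
    constructor <;> linarith
  · rw [Sg_not A g hy]
    constructor <;> linarith

theorem upper (A : Data L) : ∃ T : C(L, ℝ) ≃L[ℝ] C(ℕ → Bool, ℝ),
        ‖(T : C(L, ℝ) →L[ℝ] C(ℕ → Bool, ℝ))‖ *
            ‖(T.symm : C(ℕ → Bool, ℝ) →L[ℝ] C(L, ℝ))‖ ≤ (3 + Real.sqrt 2) ^ 2 := by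
  let T0 : C(L, ℝ) ≃ₗ[ℝ] C(ℕ → Bool, ℝ) :=
    { toFun := A.Tf
      map_add' := Tf_add A
      map_smul' := Tf_smul A
      invFun := A.Sg
      left_inv := left_inv A
      right_inv := right_inv A }
  let T := T0.toContinuousLinearEquivOfBounds 3 5 (Tf_norm A) (Sg_norm A)
  refine ⟨T, ?_⟩
  have h1 : ‖(T : C(L, ℝ) →L[ℝ] C(ℕ → Bool, ℝ))‖ ≤ 3 :=
    ContinuousLinearMap.opNorm_le_bound _ (by norm_num) (Tf_norm A)
  have h2 : ‖(T.symm : C(ℕ → Bool, ℝ) →L[ℝ] C(L, ℝ))‖ ≤ 5 :=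
    ContinuousLinearMap.opNorm_le_bound _ (by norm_num) (Sg_norm A)
  have h3 : 1 ≤ Real.sqrt 2 := Real.one_le_sqrt.2 (by norm_num)
  calc _ ≤ (3 : ℝ) * 5 := mul_le_mul h1 h2 (ContinuousLinearMap.opNorm_nonneg _) (by norm_num)
    _ ≤ _ := by nlinarith

end BMaux

/-- If `L` is a compact metrizable compactification of ω (countably infinite dense set of
isolated points) whose remainder is homeomorphic to the Cantor space and which is
homeomorphic to `L × {0,1}`, then `3 + 2√2 ≤ d_BM(C(L), C(2^ω)) ≤ (3 + √2)²`. -/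
theorem banachMazur_CL_CCantor_bounds
    {L : Type*} [TopologicalSpace L] [CompactSpace L] [T2Space L]
    [TopologicalSpace.MetrizableSpace L]
    (hDcount : {y : L | ¬ (𝓝[≠] y).NeBot}.Countable)
    (hDinf : {y : L | ¬ (𝓝[≠] y).NeBot}.Infinite)
    (hDdense : Dense {y : L | ¬ (𝓝[≠] y).NeBot})
    (hremainder : Nonempty ({y : L | (𝓝[≠] y).NeBot} ≃ₜ (ℕ → Bool)))
    (hsquare : Nonempty (L ≃ₜ L × Bool)) :
    (∀ T : C(L, ℝ) ≃L[ℝ] C(ℕ → Bool, ℝ),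
        3 + 2 * Real.sqrt 2 ≤
          ‖(T : C(L, ℝ) →L[ℝ] C(ℕ → Bool, ℝ))‖ *
            ‖(T.symm : C(ℕ → Bool, ℝ) →L[ℝ] C(L, ℝ))‖) ∧
    (∃ T : C(L, ℝ) ≃L[ℝ] C(ℕ → Bool, ℝ),
        ‖(T : C(L, ℝ) →L[ℝ] C(ℕ → Bool, ℝ))‖ *
            ‖(T.symm : C(ℕ → Bool, ℝ) →L[ℝ] C(L, ℝ))‖ ≤ (3 + Real.sqrt 2) ^ 2) := by
  have hiso : ∀ d ∈ {y : L | ¬ (𝓝[≠] y).NeBot}, IsOpen ({d} : Set L) := by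
    intro d hd
    rw [isOpen_singleton_iff_punctured_nhds]
    exact not_neBot.1 hd
  refine ⟨fun T => BMaux.lower _ hiso hDinf hDdense T, ?_⟩
  obtain ⟨e⟩ := hremainder
  have hcl : IsClosed {y : L | (𝓝[≠] y).NeBot} := by
    rw [← isOpen_compl_iff, ← Set.biUnion_of_singleton {y : L | (𝓝[≠] y).NeBot}ᶜ]
    exact isOpen_biUnion fun d hd => hiso d hd
  obtain ⟨r, hrc, hrA, hrid⟩ := BMaux.exists_retract {y : L | (𝓝[≠] y).NeBot} hcl
    ⟨_, (e.symm fun _ => true).2⟩ (fun d hd => hiso d hd)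
  have : Countable {y : L | ¬ (𝓝[≠] y).NeBot} := hDcount.to_subtype
  obtain ⟨enc, henc⟩ := exists_injective_nat ({y : L | ¬ (𝓝[≠] y).NeBot} × ℕ)
  have hc : Continuous fun y => e ⟨r y, hrA y⟩ := e.continuous.comp (hrc.subtype_mk _)
  have hc2 : Continuous fun x => (e.symm x : L) := continuous_subtype_val.comp e.symm.continuous
  exact BMaux.upper
    { D := {y : L | ¬ (𝓝[≠] y).NeBot}
      rho := ⟨fun y => e ⟨r y, hrA y⟩, hc⟩
      j := ⟨fun x => (e.symm x : L), hc2⟩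
      rho_j := by
        intro x
        change e ⟨r (e.symm x : L), _⟩ = x
        rw [← e.apply_symm_apply x]
        congr 1
        apply Subtype.ext
        simp [hrid _ (e.symm x).2]
      j_not := fun x h => h (e.symm x).2
      j_rho := by
        intro y hy
        change (e.symm (e ⟨r y, _⟩) : L) = y
        rw [e.symm_apply_apply]
        exact hrid y (not_not.1 hy)
      isol := hiso
      enc := enc
      enc_inj := henc }
end
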